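/- arXiv:1208.3501 — 2 statements merged into one kernel-verified Lean document; each statement's English description precedes it below -/
import Mathlib

section
/- In the setting below, if ξ lies in the intersection over all n ≥ 1 of the sets E^n_μ = ⋃_{ℓ ≥ n} E^{n,ℓ}_μ, then ξ is an embedding: it satisfies T_X ⊗ B ⊆ F ⊗ T_Y mod ξ and F ⊗ T_Y ⊆ T_X ⊗ B mod ξ (where F, B are the Borel σ-algebras of X and Y), and hence arises from a measurable equivariant injection (mod null sets) of (X, T, μ) into (Y, S). -/
open MeasureTheory Filter Set
open scoped ENNReal

/-- Shannon entropy of the finite-valued observable `P` with respect to `μ`. -/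
noncomputable def infoEntropy {X : Type*} [MeasurableSpace X] (μ : Measure X)
    {α : Type*} [Fintype α] (P : X → α) : ℝ :=
  ∑ a : α, Real.negMulLog (μ (P ⁻¹' {a})).toReal

/-- Entropy of the transformation `T` with respect to the observable (finite partition) `P`. -/
noncomputable def entropyWrt {X : Type*} [MeasurableSpace X] (μ : Measure X) (T : X → X)
    {α : Type*} [Fintype α] (P : X → α) : ℝ :=
  Filter.atTop.liminf fun n : ℕ =>
    infoEntropy μ (fun x => fun i : Fin n => P (T^[(i : ℕ)] x)) / n

/-- Kolmogorov–Sinai (measure-theoretic) entropy of `T` with respect to `μ`. -/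
noncomputable def ksEntropy {X : Type*} [MeasurableSpace X] (μ : Measure X) (T : X → X) : ℝ≥0∞ :=
  ⨆ (k : ℕ) (P : X → Fin k) (_ : Measurable P), ENNReal.ofReal (entropyWrt μ T P)

/-- Topological entropy (Bowen–Dinaburg, via dynamical covers). -/
noncomputable def topEntropy {Y : Type*} [UniformSpace Y] (S : Y → Y) : EReal :=
  Dynamics.coverEntropy S Set.univ

/-- `L` is a gap function for the invertible system `S` at scale `ε`. -/
def IsGapFunction {Y : Type*} [MetricSpace Y] (S : Y ≃ Y) (ε : ℝ) (L : ℕ → ℕ) : Prop :=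
  Monotone L ∧ (∀ m, 0 < L m) ∧
    ∀ (n : ℕ) (y : Fin n → Y) (a b : Fin n → ℤ),
      (∀ i, a i ≤ b i) →
      (∀ i j : Fin n, (i : ℕ) + 1 = (j : ℕ) → (L (b j - a j).toNat : ℤ) ≤ a j - b i) →
      ∃ z : Y, ∀ (i : Fin n) (kk : ℤ), a i ≤ kk → kk ≤ b i →
        dist ((S ^ kk) z) ((S ^ kk) (y i)) ≤ ε

/-- Almost weak specification: for every `ε > 0` there is a sublinear gap function. -/
def AlmostWeakSpec {Y : Type*} [MetricSpace Y] (S : Y ≃ Y) : Prop :=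
  ∀ ε : ℝ, 0 < ε → ∃ L : ℕ → ℕ, IsGapFunction S ε L ∧
    Filter.Tendsto (fun m : ℕ => (L m : ℝ) / m) Filter.atTop (nhds 0)

/-- A measure on a topological space has full support. -/
def FullSupport {Y : Type*} [TopologicalSpace Y] [MeasurableSpace Y] (ν : Measure Y) : Prop :=
  ∀ U : Set Y, IsOpen U → U.Nonempty → 0 < ν U

/-- The shift map on bi-infinite sequences. -/
def fullShift {A : Type*} : (ℤ → A) → (ℤ → A) := fun x n => x (n + 1)

noncomputable instance (k : ℕ) : MetricSpace (Fin k) :=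
  MetricSpace.induced (fun i : Fin k => (i : ℝ))
    (fun a b h => Fin.val_injective (Nat.cast_injective h)) inferInstance

/-- The standard metric on the full shift over a finite alphabet. -/
noncomputable instance (k : ℕ) : MetricSpace (ℤ → Fin k) := PiCountable.metricSpace

instance (k : ℕ) : MeasurableSpace (ℤ → Fin k) := borel _
instance (k : ℕ) : BorelSpace (ℤ → Fin k) := ⟨rfl⟩

/-- The space `M₀` of ergodic `μ`-joinings `ξ` of `(Xs, μ, σX)` and `(Y, S)` satisfying
`h_{π₂*ξ}(S) ≥ h_μ(σX)`. -/
def joiningM0 {k : ℕ} (Xs : Set (ℤ → Fin k)) (σX : ↥Xs ≃ ↥Xs) (μ : Measure ↥Xs)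
    {Y : Type*} [MetricSpace Y] [MeasurableSpace Y] (S : Y ≃ₜ Y) :
    Set (ProbabilityMeasure (↥Xs × Y)) :=
  {ξ | (ξ : Measure (↥Xs × Y)).map Prod.fst = μ ∧
    Ergodic (Prod.map (⇑σX) (⇑S)) (ξ : Measure (↥Xs × Y)) ∧
    ksEntropy μ (⇑σX) ≤ ksEntropy ((ξ : Measure (↥Xs × Y)).map Prod.snd) (⇑S)}

open scoped symmDiff

/-- A finite measurable partition of the whole space. -/
def IsFinPartition {Y : Type*} [MeasurableSpace Y] (P : Finset (Set Y)) : Prop :=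
  (∀ s ∈ P, MeasurableSet s) ∧ ⋃₀ (P : Set (Set Y)) = Set.univ ∧
    (P : Set (Set Y)).Pairwise (Disjoint · ·)

/-- `m₁ ⊆ m₂ mod ξ`: every `m₁`-measurable set agrees with an `m₂`-measurable set up to a
`ξ`-null symmetric difference. -/
def SubAlgMod {Z : Type*} [MeasurableSpace Z] (ξ : Measure Z)
    (m₁ m₂ : MeasurableSpace Z) : Prop :=
  ∀ s : Set Z, MeasurableSet[m₁] s → ∃ t : Set Z, MeasurableSet[m₂] t ∧ ξ (s ∆ t) = 0

/-- `m₁ ⊆^ε m₂ mod ξ`: every `m₁`-measurable set agrees with an `m₂`-measurable set up to a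
symmetric difference of `ξ`-measure < `ε`. -/
def SubAlgModLt {Z : Type*} [MeasurableSpace Z] (ξ : Measure Z)
    (m₁ m₂ : MeasurableSpace Z) (ε : ℝ) : Prop :=
  ∀ s : Set Z, MeasurableSet[m₁] s →
    ∃ t : Set Z, MeasurableSet[m₂] t ∧ ξ (s ∆ t) < ENNReal.ofReal ε

/-- The σ-algebra `σ(P)` generated by the natural (zeroth-coordinate) partition of a
subshift. -/
def natPartAlg (k : ℕ) (Xs : Set (ℤ → Fin k)) : MeasurableSpace ↥Xs :=
  MeasurableSpace.comap (fun x : ↥Xs => (x : ℤ → Fin k) 0) ⊤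

/-- The σ-algebra `⋁_{i ∈ ℤ} T^{-i} P` generated by all shifted copies of the natural
partition of a subshift. -/
def natPartOrbitAlg (k : ℕ) (Xs : Set (ℤ → Fin k)) (σX : ↥Xs ≃ ↥Xs) :
    MeasurableSpace ↥Xs :=
  ⨆ i : ℤ, MeasurableSpace.comap (fun x : ↥Xs => (((σX ^ i) x : ℤ → Fin k)) 0) ⊤

/-- The σ-algebra `σ(Q)` generated by a finite partition `Q`. -/
def partAlg {Y : Type*} (Q : Finset (Set Y)) : MeasurableSpace Y :=
  MeasurableSpace.generateFrom ↑Q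

/-- The σ-algebra `⋁_{i ∈ ℤ} S^{-i} Q` generated by all iterates of a finite partition `Q`
under the invertible map `S`. -/
def partOrbitAlg {Y : Type*} (S : Y ≃ Y) (Q : Finset (Set Y)) : MeasurableSpace Y :=
  ⨆ i : ℤ, MeasurableSpace.comap (⇑(S ^ i)) (partAlg Q)

/-- The set `E^{n,ℓ}_μ` of `1/n`-approximate embeddings (at partition scale `ℓ`): joinings
`ξ ∈ M₀` with `T_X ⊗ σ(Q_ℓ) ⊆^{1/n} (⋁_i T^{-i}P) ⊗ T_Y mod ξ` and
`σ(P) ⊗ T_Y ⊆^{1/n} T_X ⊗ ⋁_i S^{-i}Q_ℓ mod ξ`. -/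
def approxEmbeddings {k : ℕ} (Xs : Set (ℤ → Fin k)) (σX : ↥Xs ≃ ↥Xs) (μ : Measure ↥Xs)
    {Y : Type*} [MetricSpace Y] [MeasurableSpace Y] (S : Y ≃ₜ Y) (Q : ℕ → Finset (Set Y))
    (n ℓ : ℕ) : Set (ProbabilityMeasure (↥Xs × Y)) :=
  {ξ ∈ joiningM0 Xs σX μ S |
    SubAlgModLt (ξ : Measure (↥Xs × Y))
      (MeasurableSpace.comap Prod.snd (partAlg (Q ℓ)))
      (MeasurableSpace.comap Prod.fst (natPartOrbitAlg k Xs σX)) (1 / n) ∧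
    SubAlgModLt (ξ : Measure (↥Xs × Y))
      (MeasurableSpace.comap Prod.fst (natPartAlg k Xs))
      (MeasurableSpace.comap Prod.snd (partOrbitAlg S.toEquiv (Q ℓ))) (1 / n)}

/-- `Ψ` is an embedding of the measure-preserving system `(X, μ, T)` into `(Y, S)`. -/
def IsMeasEmbedding {X Y : Type*} [MeasurableSpace X] [MeasurableSpace Y]
    (μ : Measure X) (T : X → X) (S : Y → Y) (Ψ : X → Y) : Prop :=
  Measurable Ψ ∧ ∃ X' : Set X, MeasurableSet X' ∧ μ X'ᶜ = 0 ∧ Set.InjOn Ψ X' ∧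
    ∀ x ∈ X', Ψ (T x) = S (Ψ x)

theorem subAlgMod_iff_le_eventuallyMeasurableSpace {Z : Type*}
    (m₁ m₂ : MeasurableSpace Z) [MeasurableSpace Z] (ξ : Measure Z) :
    SubAlgMod ξ m₁ m₂ ↔ m₁ ≤ eventuallyMeasurableSpace m₂ (ae ξ) := by
  refine forall₂_congr fun s _ => exists_congr fun t => and_congr_right fun _ => ?_
  exact measure_symmDiff_eq_zero_iff

/-- A set which is approximated arbitrarily well by `m`-measurable sets is `m`-measurable up to
a null set. -/
theorem exists_measure_symmDiff_eq_zero_of_approx {Z : Type*}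
    (m : MeasurableSpace Z) [MeasurableSpace Z] (ξ : Measure Z) (s : Set Z)
    (h : ∀ ε : ℝ≥0∞, 0 < ε → ∃ t, MeasurableSet[m] t ∧ ξ (s ∆ t) < ε) :
    ∃ t, MeasurableSet[m] t ∧ ξ (s ∆ t) = 0 := by
  obtain ⟨δ, hδ, hsum⟩ := ENNReal.exists_pos_sum_of_countable' (ε := 1) one_ne_zero ℕ
  choose t ht hlt using fun n => h (δ n) (hδ n)
  refine ⟨limsup t atTop, @MeasurableSet.measurableSet_limsup Z m t ht, ?_⟩
  have h0 : ξ (limsup (fun n => s ∆ t n) atTop) = 0 :=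
    measure_limsup_atTop_eq_zero
      ((ENNReal.tsum_le_tsum fun n => (hlt n).le).trans_lt (hsum.trans ENNReal.one_lt_top)).ne
  refine measure_mono_null (fun x hx => ?_) h0
  rw [mem_limsup_iff_frequently_mem]
  rcases hx with ⟨hxs, hxt⟩ | ⟨hxt, hxs⟩
  · rw [mem_limsup_iff_frequently_mem, not_frequently] at hxt
    exact (hxt.mono fun n hn => Or.inl ⟨hxs, hn⟩).frequently
  · rw [mem_limsup_iff_frequently_mem] at hxt
    exact hxt.mono fun n hn => Or.inr ⟨hn, hxs⟩

theorem measurableSet_preimage_eventuallyMeasurableSpace {Z : Type*}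
    {m : MeasurableSpace Z} [MeasurableSpace Z] {ξ : Measure Z} {R : Z → Z}
    (hR : Measure.QuasiMeasurePreserving R ξ ξ)
    (hRm : Measurable[m, m] R) {s : Set Z}
    (hs : MeasurableSet[eventuallyMeasurableSpace m (ae ξ)] s) :
    MeasurableSet[eventuallyMeasurableSpace m (ae ξ)] (R ⁻¹' s) := by
  obtain ⟨t, ht, hst⟩ := hs
  exact ⟨R ⁻¹' t, hRm ht, hR.preimage_ae_eq hst⟩

/-- If the σ-algebra generated by `g` is contained in that generated by `f` modulo null sets,
then `g` is almost everywhere a measurable function of `f`. -/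
theorem exists_measurable_ae_eq_of_subAlgMod {Ω A B : Type*} [MeasurableSpace Ω]
    [MeasurableSpace A] [MeasurableSpace B] [StandardBorelSpace B] [Nonempty B]
    {ξ : Measure Ω} {f : Ω → A} {g : Ω → B}
    (h : SubAlgMod ξ (MeasurableSpace.comap g inferInstance)
      (MeasurableSpace.comap f inferInstance)) :
    ∃ Ψ : A → B, Measurable Ψ ∧ ∀ᵐ ω ∂ξ, Ψ (f ω) = g ω := by
  classical
  have hemb : MeasurableEmbedding (MeasurableSpace.mapNatBool B) :=
    (MeasurableSpace.measurable_mapNatBool B).measurableEmbedding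
      (MeasurableSpace.injective_mapNatBool B)
  obtain ⟨r, hr, hrB⟩ := hemb.exists_measurable_extend measurable_id fun _ => inferInstance
  have key : ∀ n : ℕ, ∃ u : Set A, MeasurableSet u ∧
      ∀ᵐ ω ∂ξ, f ω ∈ u ↔ g ω ∈ MeasurableSpace.natGeneratingSequence B n := by
    intro n
    obtain ⟨_, ⟨u, hu, rfl⟩, h0⟩ := h (g ⁻¹' MeasurableSpace.natGeneratingSequence B n)
      ⟨_, MeasurableSpace.measurableSet_natGeneratingSequence n, rfl⟩
    refine ⟨u, hu, ?_⟩
    filter_upwards [measure_symmDiff_eq_zero_iff.1 h0] with ω hω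
    exact (iff_of_eq hω).symm
  choose u hu hfu using key
  refine ⟨fun a => r fun n => decide (a ∈ u n), hr.comp (measurable_pi_lambda _ fun n =>
    measurable_to_bool (by
      have : (fun a => decide (a ∈ u n)) ⁻¹' {true} = u n := by ext a; simp
      rw [this]; exact hu n)), ?_⟩
  filter_upwards [ae_all_iff.2 hfu] with ω hω
  have : (fun n => decide (f ω ∈ u n)) = MeasurableSpace.mapNatBool B (g ω) := by
    funext n
    simp [MeasurableSpace.mapNatBool, hω n]
  rw [this]
  exact congrFun hrB (g ω)

/-- Borel sets are approximated in measure by unions of cells of a partition of small mesh. -/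
theorem exists_partAlg_approx {Y : Type*} [MetricSpace Y] [CompactSpace Y] [MeasurableSpace Y]
    [BorelSpace Y] {Q : ℕ → Finset (Set Y)} (hQpart : ∀ ℓ, 1 ≤ ℓ → IsFinPartition (Q ℓ))
    (hQdiam : ∀ ℓ, 1 ≤ ℓ → ∀ s ∈ Q ℓ, Metric.diam s < 1 / ℓ)
    (ν : Measure Y) [IsFiniteMeasure ν] {B : Set Y} (hB : MeasurableSet B)
    {ε : ℝ≥0∞} (hε : 0 < ε) :
    ∃ N : ℕ, ∀ ℓ, N ≤ ℓ → ∃ D, MeasurableSet[partAlg (Q ℓ)] D ∧ ν (B ∆ D) < ε := by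
  have hε2 : ε / 2 ≠ 0 := (ENNReal.half_pos hε.ne').ne'
  obtain ⟨K, hKB, hK, hBK⟩ := hB.exists_isClosed_sdiff_lt (measure_ne_top ν B) hε2
  have hthick : Tendsto (fun δ => ν (Metric.cthickening δ K)) (nhds 0) (nhds (ν K)) :=
    tendsto_measure_cthickening_of_isClosed ⟨1, one_pos, measure_ne_top _ _⟩ hK
  have hseq : Tendsto (fun ℓ : ℕ => ν (Metric.cthickening (1 / (ℓ : ℝ)) K)) atTop (nhds (ν K)) :=
    hthick.comp tendsto_one_div_atTop_nhds_zero_nat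
  have hlt : ν K < ν K + ε / 2 := ENNReal.lt_add_right (measure_ne_top _ _) hε2
  obtain ⟨N, hN⟩ := eventually_atTop.1 (hseq.eventually_lt_const hlt)
  refine ⟨max N 1, fun ℓ hℓ => ?_⟩
  have hℓ1 : 1 ≤ ℓ := (le_max_right _ _).trans hℓ
  set D : Set Y := ⋃₀ {s | s ∈ Q ℓ ∧ (s ∩ K).Nonempty} with hD
  have hKD : K ⊆ D := by
    intro y hy
    obtain ⟨s, hs, hys⟩ : y ∈ ⋃₀ (Q ℓ : Set (Set Y)) := by
      rw [(hQpart ℓ hℓ1).2.1]; trivial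
    exact ⟨s, ⟨hs, y, hys, hy⟩, hys⟩
  have hDK : D ⊆ Metric.cthickening (1 / (ℓ : ℝ)) K := by
    rintro y ⟨s, ⟨hs, z, hzs, hzK⟩, hys⟩
    exact Metric.mem_cthickening_of_dist_le y z _ K hzK
      ((Metric.dist_le_diam_of_mem (Bornology.IsBounded.all s) hys hzs).trans
        (hQdiam ℓ hℓ1 s hs).le)
  refine ⟨D, ?_, ?_⟩
  · refine MeasurableSet.sUnion (((Q ℓ).finite_toSet.subset fun s hs => hs.1).countable) ?_
    exact fun s hs => MeasurableSpace.measurableSet_generateFrom hs.1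
  · have hcK : ν (Metric.cthickening (1 / (ℓ : ℝ)) K \ K) < ε / 2 := by
      rw [measure_sdiff (hKD.trans hDK) hK.measurableSet.nullMeasurableSet (measure_ne_top _ _)]
      exact ENNReal.sub_lt_of_lt_add (measure_mono (hKD.trans hDK))
        (by rw [add_comm]; exact hN ℓ ((le_max_left _ _).trans hℓ))
    calc ν (B ∆ D) ≤ ν ((B \ K) ∪ (Metric.cthickening (1 / (ℓ : ℝ)) K \ K)) := by
          refine measure_mono ?_
          rintro y (⟨hyB, hyD⟩ | ⟨hyD, hyB⟩)
          · exact Or.inl ⟨hyB, fun hyK => hyD (hKD hyK)⟩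
          · exact Or.inr ⟨hDK hyD, fun hyK => hyB (hKB hyK)⟩
      _ ≤ ν (B \ K) + ν (Metric.cthickening (1 / (ℓ : ℝ)) K \ K) := measure_union_le _ _
      _ < ε / 2 + ε / 2 := ENNReal.add_lt_add hBK hcK
      _ = ε := ENNReal.add_halves ε

theorem partOrbitAlg_le {Y : Type*} [TopologicalSpace Y] [MeasurableSpace Y] [BorelSpace Y]
    (S : Y ≃ₜ Y) {Q : Finset (Set Y)} (hQ : ∀ s ∈ Q, MeasurableSet s) :
    partOrbitAlg S.toEquiv Q ≤ ‹MeasurableSpace Y› := by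
  refine iSup_le fun i => ?_
  have hQ' : partAlg Q ≤ ‹MeasurableSpace Y› := MeasurableSpace.generateFrom_le hQ
  refine (MeasurableSpace.comap_mono hQ').trans (Measurable.comap_le ?_)
  induction i using Int.induction_on with
  | zero => exact measurable_id
  | succ n ih =>
    rw [zpow_add_one]
    exact ih.comp S.continuous.measurable
  | pred n ih =>
    rw [zpow_sub_one]
    exact ih.comp S.symm.continuous.measurable

section Subshift

variable {k : ℕ} {Xs : Set (ℤ → Fin k)}

theorem measurable_subshift_apply (i : ℤ) :
    Measurable fun x : ↥Xs => (x : ℤ → Fin k) i :=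
  have h : Measurable fun x : ℤ → Fin k => x i := (continuous_apply i).measurable
  h.comp measurable_subtype_coe

theorem subshift_measurableSpace_le :
    (inferInstance : MeasurableSpace ↥Xs) ≤
      ⨆ i : ℤ, MeasurableSpace.comap (fun x : ↥Xs => (x : ℤ → Fin k) i) ⊤ := by
  have hb : (inferInstance : MeasurableSpace (ℤ → Fin k)) = MeasurableSpace.pi :=
    (Pi.borelSpace (X := fun _ : ℤ => Fin k)).measurable_eq.symm
  change MeasurableSpace.comap _ (inferInstance : MeasurableSpace (ℤ → Fin k)) ≤ _
  rw [hb, MeasurableSpace.pi, MeasurableSpace.comap_iSup]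
  refine iSup_mono fun i => ?_
  rw [MeasurableSpace.comap_comp]
  exact MeasurableSpace.comap_mono le_top

theorem subshift_apply_symm {σX : ↥Xs ≃ ↥Xs}
    (hσ : ∀ x : ↥Xs, (σX x : ℤ → Fin k) = fullShift (x : ℤ → Fin k)) (x : ↥Xs) (i : ℤ) :
    (σX.symm x : ℤ → Fin k) i = (x : ℤ → Fin k) (i - 1) := by
  have h := congrFun (hσ (σX.symm x)) (i - 1)
  rw [Equiv.apply_symm_apply] at h
  simpa [fullShift] using h.symm

theorem subshift_zpow_apply_zero {σX : ↥Xs ≃ ↥Xs}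
    (hσ : ∀ x : ↥Xs, (σX x : ℤ → Fin k) = fullShift (x : ℤ → Fin k)) (i : ℤ) (x : ↥Xs) :
    ((σX ^ i) x : ℤ → Fin k) 0 = (x : ℤ → Fin k) i := by
  induction i using Int.induction_on generalizing x with
  | zero => rfl
  | succ n ih =>
    rw [zpow_add_one, Equiv.Perm.mul_apply, ih, hσ]
    rfl
  | pred n ih =>
    rw [zpow_sub_one, Equiv.Perm.mul_apply, ih]
    exact subshift_apply_symm hσ x _

theorem natPartOrbitAlg_le {σX : ↥Xs ≃ ↥Xs}
    (hσ : ∀ x : ↥Xs, (σX x : ℤ → Fin k) = fullShift (x : ℤ → Fin k)) :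
    natPartOrbitAlg k Xs σX ≤ (inferInstance : MeasurableSpace ↥Xs) := by
  refine iSup_le fun i => ?_
  simp only [subshift_zpow_apply_zero hσ]
  exact (measurable_subshift_apply i).comap_le

theorem measurable_subshift_symm {σX : ↥Xs ≃ ↥Xs}
    (hσ : ∀ x : ↥Xs, (σX x : ℤ → Fin k) = fullShift (x : ℤ → Fin k)) :
    Measurable σX.symm := by
  rw [measurable_iff_comap_le]
  refine (MeasurableSpace.comap_mono subshift_measurableSpace_le).trans ?_
  rw [MeasurableSpace.comap_iSup]
  refine iSup_le fun i => ?_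
  rw [MeasurableSpace.comap_comp]
  have : (fun x : ↥Xs => (x : ℤ → Fin k) i) ∘ σX.symm = fun x : ↥Xs => (x : ℤ → Fin k) (i - 1) :=
    funext fun x => subshift_apply_symm hσ x i
  rw [this]
  exact (measurable_subshift_apply (i - 1)).comap_le

theorem standardBorelSpace_subshift (hcl : IsClosed Xs) : StandardBorelSpace ↥Xs :=
  hcl.measurableSet.standardBorel

end Subshift

/-- **Joinings in all the sets `E^n_μ = ⋃_{ℓ ≥ n} E^{n,ℓ}_μ` are embeddings.**  In the setting
of a non-trivial ergodic subshift `(Xs, μ, σX)` and a self-homeomorphism `S`, with almost weak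
specification, of a compact metric space `Y` having the small boundary property witnessed by
refining partitions `Q_ℓ`: any `ξ ∈ ⋂_{n ≥ 1} E^n_μ` satisfies
`T_X ⊗ B ⊆ F ⊗ T_Y mod ξ` and `F ⊗ T_Y ⊆ T_X ⊗ B mod ξ`, and hence comes from a measurable
equivariant injection (mod null sets) of `(Xs, σX, μ)` into `(Y, S)`. -/
theorem mem_all_approxEmbeddings_is_embedding
    (k : ℕ) (Xs : Set (ℤ → Fin k)) (hne : Xs.Nonempty) (hcl : IsClosed Xs)
    (hsinv : fullShift '' Xs = Xs) (hnontriv : ¬ Xs.Finite)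
    (σX : ↥Xs ≃ ↥Xs) (hσ : ∀ x : ↥Xs, (σX x : ℤ → Fin k) = fullShift (x : ℤ → Fin k))
    (μ : Measure ↥Xs) [IsProbabilityMeasure μ] (herg : Ergodic (⇑σX) μ)
    {Y : Type*} [MetricSpace Y] [CompactSpace Y] [MeasurableSpace Y] [BorelSpace Y]
    (S : Y ≃ₜ Y) (hspec : AlmostWeakSpec S.toEquiv)
    (Q : ℕ → Finset (Set Y))
    (hQpart : ∀ ℓ, 1 ≤ ℓ → IsFinPartition (Q ℓ))
    (hQdiam : ∀ ℓ, 1 ≤ ℓ → ∀ s ∈ Q ℓ, Metric.diam s < 1 / ℓ)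
    (hQrefine : ∀ ℓ, 1 ≤ ℓ → ∀ s ∈ Q (ℓ + 1), ∃ t ∈ Q ℓ, s ⊆ t)
    (hQbdry : ∀ ℓ, 1 ≤ ℓ → ∀ ν : Measure Y, IsProbabilityMeasure ν →
      MeasurePreserving (⇑S) ν ν → ν (⋃ s ∈ Q ℓ, frontier s) = 0)
    (hent : (ksEntropy μ (⇑σX) : EReal) < topEntropy (⇑S))
    (ξ : ProbabilityMeasure (↥Xs × Y))
    (hξ : ∀ n : ℕ, 1 ≤ n → ξ ∈ ⋃ (ℓ : ℕ) (_ : n ≤ ℓ), approxEmbeddings Xs σX μ S Q n ℓ) :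
    SubAlgMod (ξ : Measure (↥Xs × Y))
      (MeasurableSpace.comap Prod.snd inferInstance)
      (MeasurableSpace.comap Prod.fst inferInstance) ∧
    SubAlgMod (ξ : Measure (↥Xs × Y))
      (MeasurableSpace.comap Prod.fst inferInstance)
      (MeasurableSpace.comap Prod.snd inferInstance) ∧
    ∃ Ψ : ↥Xs → Y, IsMeasEmbedding μ (⇑σX) (⇑S) Ψ ∧
      ∀ (F : Set ↥Xs) (B : Set Y), MeasurableSet F → MeasurableSet B →
        (ξ : Measure (↥Xs × Y)) (F ×ˢ B) = μ (F ∩ Ψ ⁻¹' B) := by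
  have hmem : ∀ n : ℕ, 1 ≤ n → ∃ ℓ, n ≤ ℓ ∧ ξ ∈ approxEmbeddings Xs σX μ S Q n ℓ := by
    simpa only [mem_iUnion, exists_prop] using hξ
  obtain ⟨ℓ₁, -, ⟨hfst, hR, -⟩, -⟩ := hmem 1 le_rfl
  set ζ : Measure (↥Xs × Y) := (ξ : Measure (↥Xs × Y))
  have hsmall : ∀ ε : ℝ≥0∞, 0 < ε → ∃ N : ℕ, ∀ n ≥ N, ENNReal.ofReal (1 / (n : ℝ)) < ε := by
    intro ε hε
    have h := (ENNReal.continuous_ofReal.tendsto 0).comp tendsto_one_div_atTop_nhds_zero_nat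
    rw [ENNReal.ofReal_zero] at h
    exact eventually_atTop.1 (h.eventually_lt_const hε)
  have hYX : SubAlgMod ζ (MeasurableSpace.comap Prod.snd inferInstance)
      (MeasurableSpace.comap Prod.fst inferInstance) := by
    rintro _ ⟨B, hB, rfl⟩
    refine exists_measure_symmDiff_eq_zero_of_approx _ _ _ fun ε hε => ?_
    have hε2 : 0 < ε / 2 := ENNReal.half_pos hε.ne'
    obtain ⟨N, hN⟩ := exists_partAlg_approx hQpart hQdiam (ζ.map Prod.snd) hB hε2
    obtain ⟨M, hM⟩ := hsmall _ hε2
    obtain ⟨ℓ, hℓ, -, h1, -⟩ := hmem (max (max N M) 1) (le_max_right _ _)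
    obtain ⟨D, hD, hBD⟩ := hN ℓ (((le_max_left _ _).trans (le_max_left _ _)).trans hℓ)
    obtain ⟨t, ht, hDt⟩ := h1 (Prod.snd ⁻¹' D) ⟨D, hD, rfl⟩
    refine ⟨t, MeasurableSpace.comap_mono (natPartOrbitAlg_le hσ) _ ht, ?_⟩
    have hℓ1 : 1 ≤ ℓ := (le_max_right _ _).trans hℓ
    have hD' : MeasurableSet D := MeasurableSpace.generateFrom_le (hQpart ℓ hℓ1).1 _ hD
    rw [Measure.map_apply measurable_snd (hB.symmDiff hD')] at hBD
    calc ζ ((Prod.snd ⁻¹' B) ∆ t)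
        ≤ ζ ((Prod.snd ⁻¹' B) ∆ (Prod.snd ⁻¹' D)) + ζ ((Prod.snd ⁻¹' D) ∆ t) :=
          measure_symmDiff_le _ _ _
      _ < ε / 2 + ε / 2 := ENNReal.add_lt_add hBD
          (hDt.trans (hM _ ((le_max_right _ _).trans (le_max_left _ _))))
      _ = ε := ENNReal.add_halves ε
  have hXY : SubAlgMod ζ (MeasurableSpace.comap Prod.fst inferInstance)
      (MeasurableSpace.comap Prod.snd inferInstance) := by
    rw [subAlgMod_iff_le_eventuallyMeasurableSpace]
    refine (MeasurableSpace.comap_mono subshift_measurableSpace_le).trans ?_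
    rw [MeasurableSpace.comap_iSup]
    refine iSup_le fun i => ?_
    rw [MeasurableSpace.comap_comp]
    rintro _ ⟨A, -, rfl⟩
    let e : (↥Xs × Y) ≃ᵐ (↥Xs × Y) :=
      { toEquiv := σX.prodCongr S.toEquiv
        measurable_toFun := hR.measurable
        measurable_invFun := (measurable_subshift_symm hσ).prodMap S.symm.continuous.measurable }
    have he : MeasurePreserving e ζ ζ := hR.toMeasurePreserving
    have hem : Measurable[MeasurableSpace.comap Prod.snd inferInstance,
        MeasurableSpace.comap Prod.snd inferInstance] e := by
      rintro _ ⟨u, hu, rfl⟩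
      exact ⟨S ⁻¹' u, S.continuous.measurable hu, rfl⟩
    have hem' : Measurable[MeasurableSpace.comap Prod.snd inferInstance,
        MeasurableSpace.comap Prod.snd inferInstance] e.symm := by
      rintro _ ⟨u, hu, rfl⟩
      exact ⟨S.symm ⁻¹' u, S.symm.continuous.measurable hu, rfl⟩
    induction i using Int.induction_on with
    | zero =>
      obtain ⟨t, ht, h0⟩ := exists_measure_symmDiff_eq_zero_of_approx
        (MeasurableSpace.comap Prod.snd inferInstance) ζ
        (((fun x : ↥Xs => (x : ℤ → Fin k) 0) ∘ Prod.fst) ⁻¹' A) fun ε hε => by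
          obtain ⟨M, hM⟩ := hsmall ε hε
          obtain ⟨ℓ, hℓ, -, -, h2⟩ := hmem (max M 1) (le_max_right _ _)
          obtain ⟨t, ht, hlt⟩ := h2 _ ⟨_, ⟨A, trivial, rfl⟩, rfl⟩
          exact ⟨t, MeasurableSpace.comap_mono
            (partOrbitAlg_le S (hQpart ℓ ((le_max_right _ _).trans hℓ)).1) _ ht,
            hlt.trans (hM _ (le_max_left _ _))⟩
      exact ⟨t, ht, measure_symmDiff_eq_zero_iff.1 h0⟩
    | succ n ih =>
      convert measurableSet_preimage_eventuallyMeasurableSpace he.quasiMeasurePreserving hem ih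
        using 1
      ext p
      change _ ↔ (σX p.1 : ℤ → Fin k) n ∈ A
      rw [hσ]
      rfl
    | pred n ih =>
      convert measurableSet_preimage_eventuallyMeasurableSpace
        (he.symm e).quasiMeasurePreserving hem' ih using 1
      ext p
      change _ ↔ (σX.symm p.1 : ℤ → Fin k) (-n) ∈ A
      rw [subshift_apply_symm hσ]
      rfl
  refine ⟨hYX, hXY, ?_⟩
  have : Nonempty (↥Xs × Y) := ProbabilityMeasure.nonempty ξ
  have : Nonempty Y := Nonempty.map Prod.snd this
  have : Nonempty ↥Xs := hne.to_subtype
  have := standardBorelSpace_subshift hcl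
  obtain ⟨Ψ, hΨ, hΨae⟩ := exists_measurable_ae_eq_of_subAlgMod hYX
  obtain ⟨Θ, hΘ, hΘae⟩ := exists_measurable_ae_eq_of_subAlgMod hXY
  refine ⟨Ψ, ⟨hΨ, ?_⟩, fun F B hF hB => ?_⟩
  · have hgood : ∀ᵐ x ∂μ, Θ (Ψ x) = x ∧ Ψ (σX x) = S (Ψ x) := by
      have hmeas : MeasurableSet {x : ↥Xs | Θ (Ψ x) = x ∧ Ψ (σX x) = S (Ψ x)} :=
        (measurableSet_eq_fun (hΘ.comp hΨ) measurable_id).inter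
          (measurableSet_eq_fun (hΨ.comp herg.measurable) (S.continuous.measurable.comp hΨ))
      rw [← hfst, ae_map_iff measurable_fst.aemeasurable hmeas]
      filter_upwards [hΨae, hΘae,
        hR.toMeasurePreserving.quasiMeasurePreserving.ae hΨae] with p h1 h2 h3
      exact ⟨by rw [h1, h2], by rw [h1]; exact h3⟩
    obtain ⟨X', hX', hX'm, hX'0⟩ := exists_measurable_superset_of_null (ae_iff.1 hgood)
    refine ⟨X'ᶜ, hX'm.compl, by rwa [compl_compl], fun x hx y hy hxy => ?_, fun x hx => ?_⟩
    · have hx' := (not_not.1 fun h => hx (hX' h)).1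
      have hy' := (not_not.1 fun h => hy (hX' h)).1
      rw [← hx', hxy, hy']
    · exact (not_not.1 fun h => hx (hX' h)).2
  · rw [← hfst, Measure.map_apply measurable_fst (hF.inter (hΨ hB))]
    refine measure_congr ?_
    filter_upwards [hΨae] with p hp
    refine propext ?_
    change p.1 ∈ F ∧ p.2 ∈ B ↔ p.1 ∈ F ∧ Ψ p.1 ∈ B
    rw [hp]
end

section
/- Let (X, μ, T) be a non-trivial ergodic subshift and S a self-homeomorphism with almost weak specification of a compact metric space Y, with h_μ(T) < h_top(S). Then the set M_0' of all ξ ∈ M_0 such that the Y-marginal π_2^*(ξ) is fully supported on Y is the intersection of countably many relatively open dense subsets of M_0. -/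
open MeasureTheory Filter Set
open scoped ENNReal

section FiniteEntropy

open scoped Classical in
/-- The mass that the weight `p` gives to the fibre of `f` over `a`. -/
noncomputable def fibreMass {ι α : Type*} [Fintype ι] (p : ι → ℝ) (f : ι → α) (a : α) : ℝ :=
  ∑ i, if f i = a then p i else 0

/-- The Shannon entropy of `f` with respect to the weight `p`. -/
noncomputable def weightEntropy {ι α : Type*} [Fintype ι] (p : ι → ℝ) (f : ι → α) : ℝ :=
  ∑ i, p i * -Real.log (fibreMass p f (f i))

variable {ι : Type*} [Fintype ι] {α β γ : Type*} {p : ι → ℝ}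

lemma fibreMass_nonneg (hp : ∀ i, 0 ≤ p i) (f : ι → α) (a : α) : 0 ≤ fibreMass p f a := by
  classical
  exact Finset.sum_nonneg fun i _ => by split_ifs <;> simp [hp]

lemma le_fibreMass (hp : ∀ i, 0 ≤ p i) (f : ι → α) (i : ι) : p i ≤ fibreMass p f (f i) := by
  classical
  have := Finset.single_le_sum (f := fun j => if f j = f i then p j else 0)
    (fun j _ => by split_ifs <;> simp [hp]) (Finset.mem_univ i)
  simpa [fibreMass] using this

open scoped Classical in
lemma sum_fibreMass_mul (f : ι → α) (φ : α → ℝ) (s : Finset α) (hs : ∀ i, f i ∈ s) :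
    ∑ a ∈ s, fibreMass p f a * φ a = ∑ i, p i * φ (f i) := by
  simp only [fibreMass, Finset.sum_mul]
  rw [Finset.sum_comm]
  refine Finset.sum_congr rfl fun i _ => ?_
  rw [Finset.sum_eq_single (f i)]
  · simp
  · intro b _ hb
    simp [hb.symm]
  · intro h
    exact absurd (hs i) h

open scoped Classical in
lemma sum_fibreMass_pair (f : ι → α) (g : ι → β) (a : α) (s : Finset β) (hs : ∀ i, g i ∈ s) :
    ∑ b ∈ s, fibreMass p (fun i => (f i, g i)) (a, b) = fibreMass p f a := by
  simp only [fibreMass]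
  rw [Finset.sum_comm]
  refine Finset.sum_congr rfl fun i _ => ?_
  rw [Finset.sum_eq_single (g i)]
  · simp
  · intro b _ hb
    simp [hb.symm]
  · intro h
    exact absurd (hs i) h

/-- The Gibbs inequality. -/
lemma weightEntropy_le_of_sum_le (hp : ∀ i, 0 ≤ p i) (f : ι → α) (G : α → ℝ)
    (hG : ∀ i, 0 < p i → 0 < G (f i)) (hG0 : ∀ a, 0 ≤ G a) (s : Finset α) (hs : ∀ i, f i ∈ s)
    (hsum : ∑ a ∈ s, G a ≤ ∑ i, p i) :
    weightEntropy p f ≤ ∑ i, p i * -Real.log (G (f i)) := by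
  have key : ∀ i, p i * -Real.log (fibreMass p f (f i)) - p i * -Real.log (G (f i)) ≤
      p i * (G (f i) / fibreMass p f (f i)) - p i := by
    intro i
    rcases (hp i).eq_or_lt with h | h
    · simp [← h]
    · have h1 := hG i h
      have h2 : 0 < fibreMass p f (f i) := h.trans_le (le_fibreMass hp f i)
      have h3 := Real.log_le_sub_one_of_pos (div_pos h1 h2)
      rw [Real.log_div h1.ne' h2.ne'] at h3
      nlinarith
  have h4 : ∑ i, p i * (G (f i) / fibreMass p f (f i)) ≤ ∑ a ∈ s, G a := by
    rw [← sum_fibreMass_mul (p := p) f (fun a => G a / fibreMass p f a) s hs]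
    refine Finset.sum_le_sum fun a _ => ?_
    rcases (fibreMass_nonneg hp f a).eq_or_lt with h | h
    · rw [← h]; simpa using hG0 a
    · rw [mul_div_cancel₀ _ h.ne']
  have h5 := Finset.sum_le_sum fun i (_ : i ∈ Finset.univ) => key i
  simp only [Finset.sum_sub_distrib] at h5
  unfold weightEntropy
  linarith

lemma weightEntropy_le_of_factor (hp : ∀ i, 0 ≤ p i) (f : ι → α) (g : ι → β)
    (h : ∀ i j, 0 < p i → 0 < p j → g i = g j → f i = f j) :
    weightEntropy p f ≤ weightEntropy p g := by
  classical
  refine Finset.sum_le_sum fun i _ => ?_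
  rcases (hp i).eq_or_lt with h0 | h0
  · simp [← h0]
  · refine mul_le_mul_of_nonneg_left ?_ (hp i)
    refine neg_le_neg (Real.log_le_log (h0.trans_le (le_fibreMass hp g i)) ?_)
    refine Finset.sum_le_sum fun j _ => ?_
    rcases (hp j).eq_or_lt with h1 | h1
    · simp [← h1]
    · by_cases hg : g j = g i
      · simp [hg, h j i h1 h0 hg]
      · simp only [hg, if_false]
        split_ifs <;> simp [hp]

lemma weightEntropy_congr (hp : ∀ i, 0 ≤ p i) (f : ι → α) (g : ι → β)
    (h : ∀ i j, g i = g j ↔ f i = f j) :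
    weightEntropy p f = weightEntropy p g :=
  le_antisymm (weightEntropy_le_of_factor hp f g fun i j _ _ => (h i j).1)
    (weightEntropy_le_of_factor hp g f fun i j _ _ => (h i j).2)

/-- Strong subadditivity of the Shannon entropy. -/
lemma weightEntropy_submodular (hp : ∀ i, 0 ≤ p i) (f : ι → α) (g : ι → β) (h : ι → γ) :
    weightEntropy p (fun i => (f i, g i, h i)) + weightEntropy p h ≤
      weightEntropy p (fun i => (f i, h i)) + weightEntropy p (fun i => (g i, h i)) := by
  classical
  set F : α → γ → ℝ := fun a c => fibreMass p (fun i => (f i, h i)) (a, c) with hF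
  set G : β → γ → ℝ := fun b c => fibreMass p (fun i => (g i, h i)) (b, c) with hG
  set K : γ → ℝ := fun c => fibreMass p h c with hK
  have F0 : ∀ a c, 0 ≤ F a c := fun a c => fibreMass_nonneg hp _ _
  have G0 : ∀ a c, 0 ≤ G a c := fun a c => fibreMass_nonneg hp _ _
  have K0 : ∀ c, 0 ≤ K c := fun c => fibreMass_nonneg hp _ _
  have Fp : ∀ i, 0 < p i → 0 < F (f i) (h i) := fun i hi =>
    hi.trans_le (le_fibreMass hp (fun i => (f i, h i)) i)
  have Gp : ∀ i, 0 < p i → 0 < G (g i) (h i) := fun i hi =>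
    hi.trans_le (le_fibreMass hp (fun i => (g i, h i)) i)
  have Kp : ∀ i, 0 < p i → 0 < K (h i) := fun i hi => hi.trans_le (le_fibreMass hp h i)
  have Fs : ∀ c, ∑ a ∈ Finset.univ.image f, F a c = K c := fun c => by
    rw [show K c = fibreMass p h c from rfl,
      ← sum_fibreMass_pair h f c (Finset.univ.image f) (by simp)]
    refine Finset.sum_congr rfl fun a _ => ?_
    simp only [hF, fibreMass, Prod.mk.injEq, and_comm]
  have Gs : ∀ c, ∑ a ∈ Finset.univ.image g, G a c = K c := fun c => by
    rw [show K c = fibreMass p h c from rfl,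
      ← sum_fibreMass_pair h g c (Finset.univ.image g) (by simp)]
    refine Finset.sum_congr rfl fun a _ => ?_
    simp only [hG, fibreMass, Prod.mk.injEq, and_comm]
  have main := weightEntropy_le_of_sum_le hp (fun i => (f i, g i, h i))
    (fun x => F x.1 x.2.2 * G x.2.1 x.2.2 / K x.2.2)
    (fun i hi => div_pos (mul_pos (Fp i hi) (Gp i hi)) (Kp i hi))
    (fun x => div_nonneg (mul_nonneg (F0 _ _) (G0 _ _)) (K0 _))
    (Finset.univ.image f ×ˢ (Finset.univ.image g ×ˢ Finset.univ.image h)) (by simp) (by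
      calc ∑ x ∈ Finset.univ.image f ×ˢ (Finset.univ.image g ×ˢ Finset.univ.image h),
            F x.1 x.2.2 * G x.2.1 x.2.2 / K x.2.2
          = ∑ c ∈ Finset.univ.image h, K c * K c / K c := by
            simp only [Finset.sum_product]
            rw [Finset.sum_congr rfl fun a _ => Finset.sum_comm, Finset.sum_comm]
            refine Finset.sum_congr rfl fun c _ => ?_
            simp only [← Finset.sum_div, ← Finset.mul_sum, Gs, ← Finset.sum_mul, Fs]
        _ = ∑ c ∈ Finset.univ.image h, fibreMass p h c * 1 := by
            refine Finset.sum_congr rfl fun c _ => ?_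
            rw [mul_one, mul_self_div_self]
        _ = ∑ i, p i * 1 := sum_fibreMass_mul h (fun _ => 1) _ (by simp)
        _ ≤ ∑ i, p i := by simp)
  have e : ∀ i, p i * -Real.log (F (f i) (h i) * G (g i) (h i) / K (h i)) =
      p i * -Real.log (F (f i) (h i)) + p i * -Real.log (G (g i) (h i)) -
        p i * -Real.log (K (h i)) := by
    intro i
    rcases (hp i).eq_or_lt with h0 | h0
    · simp [← h0]
    · rw [Real.log_div (mul_pos (Fp i h0) (Gp i h0)).ne' (Kp i h0).ne',
        Real.log_mul (Fp i h0).ne' (Gp i h0).ne']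
      ring
  simp only [e, Finset.sum_add_distrib, Finset.sum_sub_distrib] at main
  simp only [weightEntropy] at main ⊢
  linarith

lemma weightEntropy_const (hp1 : ∑ i, p i = 1) (f : ι → α)
    (hf : ∀ i j, f i = f j) : weightEntropy p f = 0 := by
  classical
  refine Finset.sum_eq_zero fun i _ => ?_
  have : fibreMass p f (f i) = 1 := by
    rw [← hp1]; exact Finset.sum_congr rfl fun j _ => by simp [hf j i]
  simp [this]

lemma weightEntropy_pair_le (hp : ∀ i, 0 ≤ p i) (hp1 : ∑ i, p i = 1) (f : ι → α) (g : ι → β) :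
    weightEntropy p (fun i => (f i, g i)) ≤ weightEntropy p f + weightEntropy p g := by
  have h := weightEntropy_submodular hp f g (fun _ => ())
  rw [weightEntropy_const hp1 (fun _ => ()) (by simp),
    weightEntropy_congr hp (fun i => (f i, g i, ())) (fun i => (f i, g i)) (by simp),
    weightEntropy_congr hp (fun i => (f i, ())) f (by simp),
    weightEntropy_congr hp (fun i => (g i, ())) g (by simp)] at h
  linarith

/-- A quantitative Fano inequality: if `v` is guessed from `w` with error probability at most `θ`,
then `v` adds little entropy to `w`. -/
lemma weightEntropy_fano (hp : ∀ i, 0 ≤ p i) (hp1 : ∑ i, p i = 1) [Fintype α]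
    (v : ι → α) (w : ι → β) (guess : β → α) {θ η : ℝ} (hη : 0 < η) (hη1 : η < 1)
    (bad : Finset ι) (hbad : ∀ i, 0 < p i → i ∉ bad → v i = guess (w i))
    (hθ : ∑ i ∈ bad, p i ≤ θ) (c : ℝ) (hc : (Fintype.card α : ℝ) ≤ c) (hc1 : 1 ≤ c) :
    weightEntropy p (fun i => (v i, w i)) ≤
      weightEntropy p w - Real.log (1 - η) + θ * Real.log (c / η) := by
  classical
  set W : β → ℝ := fun b => fibreMass p w b with hW
  set q : α → β → ℝ := fun a b => (if a = guess b then 1 - η else 0) + η / c with hq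
  have c0 : 0 < c := by linarith
  have ηc : 0 < η / c := div_pos hη c0
  have q0 : ∀ a b, 0 < q a b := fun a b => by
    simp only [hq]; split_ifs <;> linarith
  have qs : ∀ b, ∑ a, q a b ≤ 1 := fun b => by
    simp only [hq, Finset.sum_add_distrib, Finset.sum_ite_eq', Finset.mem_univ, if_true,
      Finset.sum_const, Finset.card_univ, nsmul_eq_mul]
    have : (Fintype.card α : ℝ) * (η / c) ≤ c * (η / c) := by gcongr
    rw [mul_div_cancel₀ _ c0.ne'] at this
    linarith
  have W0 : ∀ b, 0 ≤ W b := fun b => fibreMass_nonneg hp _ _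
  have Wp : ∀ i, 0 < p i → 0 < W (w i) := fun i hi => hi.trans_le (le_fibreMass hp w i)
  have main := weightEntropy_le_of_sum_le hp (fun i => (v i, w i))
    (fun x => W x.2 * q x.1 x.2) (fun i hi => mul_pos (Wp i hi) (q0 _ _))
    (fun x => mul_nonneg (W0 _) (q0 _ _).le)
    ((Finset.univ : Finset α) ×ˢ Finset.univ.image w) (by simp) (by
      calc ∑ x ∈ (Finset.univ : Finset α) ×ˢ Finset.univ.image w, W x.2 * q x.1 x.2
          = ∑ b ∈ Finset.univ.image w, fibreMass p w b * ∑ a, q a b := by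
            rw [Finset.sum_product, Finset.sum_comm]
            simp only [Finset.mul_sum, hW]
        _ ≤ ∑ b ∈ Finset.univ.image w, fibreMass p w b * 1 :=
            Finset.sum_le_sum fun b _ => mul_le_mul_of_nonneg_left (qs b) (W0 b)
        _ = ∑ i, p i * 1 := sum_fibreMass_mul w (fun _ => 1) _ (by simp)
        _ ≤ ∑ i, p i := by simp)
  have hlog0 : 0 ≤ -Real.log (1 - η) := by
    have := Real.log_nonpos (by linarith : (0:ℝ) ≤ 1 - η) (by linarith)
    linarith
  have hlog1 : 0 ≤ Real.log (c / η) := Real.log_nonneg (by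
    rw [le_div_iff₀ hη]; linarith)
  have e : ∀ i, p i * -Real.log (W (w i) * q (v i) (w i)) ≤
      p i * -Real.log (W (w i)) + p i * -Real.log (1 - η) +
        (if i ∈ bad then p i else 0) * Real.log (c / η) := by
    intro i
    rcases (hp i).eq_or_lt with h0 | h0
    · simp [← h0]
    · rw [Real.log_mul (Wp i h0).ne' (q0 _ _).ne']
      by_cases hb : i ∈ bad
      · have : -Real.log (q (v i) (w i)) ≤ Real.log (c / η) := by
          rw [← Real.log_inv]
          refine Real.log_le_log (inv_pos.2 (q0 _ _)) ?_
          rw [← inv_div]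
          refine inv_anti₀ ηc ?_
          simp only [hq]; split_ifs <;> linarith
        simp only [hb, if_true]
        nlinarith
      · have : -Real.log (q (v i) (w i)) ≤ -Real.log (1 - η) := by
          refine neg_le_neg (Real.log_le_log (by linarith) ?_)
          simp only [hq, hbad i h0 hb, if_true]; linarith
        simp only [hb, if_false]
        nlinarith
  have h2 := Finset.sum_le_sum fun i (_ : i ∈ Finset.univ) => e i
  simp only [Finset.sum_add_distrib, ← Finset.sum_mul, hp1, one_mul] at h2
  have h3 : ∑ i, (if i ∈ bad then p i else 0) ≤ θ := by simpa using hθ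
  have h4 := mul_le_mul_of_nonneg_right h3 hlog1
  simp only [weightEntropy] at main ⊢
  linarith

/-- Entropies of independent pairs, when the second observable may depend on the first. -/
lemma weightEntropy_prod {κ : Type*} [Fintype κ] {r : κ → ℝ} (hp : ∀ i, 0 ≤ p i)
    (hr : ∀ i, 0 ≤ r i) (hr1 : ∑ i, r i = 1) (f : ι → α) (g : α → κ → β) :
    weightEntropy (fun x : ι × κ => p x.1 * r x.2) (fun x => (f x.1, g (f x.1) x.2)) =
      weightEntropy p f + ∑ i, p i * weightEntropy r (g (f i)) := by
  classical
  have hm : ∀ i k, fibreMass (fun x : ι × κ => p x.1 * r x.2) (fun x => (f x.1, g (f x.1) x.2))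
      (f i, g (f i) k) = fibreMass p f (f i) * fibreMass r (g (f i)) (g (f i) k) := by
    intro i k
    simp only [fibreMass, Fintype.sum_prod_type, Finset.sum_mul_sum, Prod.mk.injEq]
    refine Finset.sum_congr rfl fun j _ => Finset.sum_congr rfl fun l _ => ?_
    by_cases h : f j = f i
    · simp [h]
    · simp [h]
  simp only [weightEntropy, Fintype.sum_prod_type, hm, Finset.mul_sum]
  rw [← Finset.sum_add_distrib]
  refine Finset.sum_congr rfl fun i _ => ?_
  have : p i * -Real.log (fibreMass p f (f i)) =
      ∑ k, p i * r k * -Real.log (fibreMass p f (f i)) := by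
    rw [← Finset.sum_mul, ← Finset.mul_sum, hr1, mul_one]
  rw [this, ← Finset.sum_add_distrib]
  refine Finset.sum_congr rfl fun k _ => ?_
  rcases (hp i).eq_or_lt with h0 | h0
  · simp [← h0]
  rcases (hr k).eq_or_lt with h1 | h1
  · simp [← h1]
  rw [Real.log_mul (h0.trans_le (le_fibreMass hp f i)).ne'
    (h1.trans_le (le_fibreMass hr _ k)).ne']
  ring

lemma weightEntropy_prod_map {κ : Type*} [Fintype κ] {r : κ → ℝ} (hp : ∀ i, 0 ≤ p i)
    (hr : ∀ i, 0 ≤ r i) (hp1 : ∑ i, p i = 1) (hr1 : ∑ i, r i = 1) (f : ι → α) (g : κ → β) :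
    weightEntropy (fun x : ι × κ => p x.1 * r x.2) (fun x => (f x.1, g x.2)) =
      weightEntropy p f + weightEntropy r g := by
  rw [weightEntropy_prod hp hr hr1 f (fun _ => g), ← Finset.sum_mul, hp1, one_mul]

/-- The entropy only depends on the law of the observables. -/
lemma weightEntropy_comp {κ : Type*} [Fintype κ] (π : ι → κ) (f : κ → α) :
    weightEntropy p (f ∘ π) = weightEntropy (fibreMass p π) f := by
  classical
  have h1 : ∀ a, fibreMass (fibreMass p π) f a = fibreMass p (f ∘ π) a := by
    intro a
    have := sum_fibreMass_mul (p := p) π (fun k => if f k = a then 1 else 0) Finset.univ (by simp)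
    simpa [fibreMass] using this
  simp only [weightEntropy, h1]
  exact (sum_fibreMass_mul (p := p) π (fun k => -Real.log (fibreMass p (f ∘ π) (f k)))
    Finset.univ (by simp)).symm

end FiniteEntropy

section ProcessEntropy

lemma card_mul_le_weightEntropy_restrict {ι α : Type*} [Fintype ι] {p : ι → ℝ}
    (hp : ∀ i, 0 ≤ p i) {n : ℕ} (f : Fin n → ι → α) (a : ℝ)
    (ha : ∀ t : Fin n, a ≤ weightEntropy p (fun i => fun s : Finset.Iic t => f s i) -
      weightEntropy p (fun i => fun s : Finset.Iio t => f s i)) (hp1 : ∑ i, p i = 1)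
    (J : Finset (Fin n)) :
    J.card * a ≤ weightEntropy p (fun i => fun s : J => f s i) := by
  classical
  induction J using Finset.induction_on_max with
  | empty =>
    rw [weightEntropy_const hp1 _ fun i j => by ext s; exact absurd s.2 (Finset.notMem_empty _)]
    simp
  | insert t s hs ih =>
    have hts : t ∉ s := fun h => lt_irrefl _ (hs t h)
    have h := weightEntropy_submodular hp (f t) (fun i => fun r : Finset.Iio t => f r i)
      (fun i => fun r : s => f r i)
    rw [weightEntropy_congr hp (fun i => (f t i, (fun r : Finset.Iio t => f r i),
        (fun r : s => f r i))) (fun i => fun s : Finset.Iic t => f s i) ?_,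
      weightEntropy_congr hp (fun i => (f t i, (fun r : s => f r i)))
        (fun i => fun r : (insert t s : Finset _) => f r i) ?_,
      weightEntropy_congr hp (fun i => ((fun r : Finset.Iio t => f r i), (fun r : s => f r i)))
        (fun i => fun r : Finset.Iio t => f r i) ?_] at h
    · rw [Finset.card_insert_of_notMem hts]
      push_cast
      linarith [ha t]
    · intro i j
      simp only [Prod.mk.injEq, funext_iff, Subtype.forall, Finset.mem_Iio]
      exact ⟨fun h => ⟨h, fun r hr => h r (hs r hr)⟩, fun h => h.1⟩
    · intro i j
      simp only [Prod.mk.injEq, funext_iff, Subtype.forall, Finset.mem_insert]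
      exact ⟨fun h => ⟨h t (Or.inl rfl), fun r hr => h r (Or.inr hr)⟩, fun h r hr =>
        hr.elim (fun e => e ▸ h.1) (h.2 r)⟩
    · intro i j
      simp only [Prod.mk.injEq, funext_iff, Subtype.forall, Finset.mem_Iio, Finset.mem_Iic]
      exact ⟨fun h => ⟨h t le_rfl, fun r hr => h r hr.le, fun r hr => h r (hs r hr).le⟩,
        fun h r hr => hr.eq_or_lt.elim (fun e => e ▸ h.1) (h.2.1 r)⟩

lemma infoEntropy_comp_eq_weightEntropy {Ω ι α : Type*} [MeasurableSpace Ω] (κ : Measure Ω)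
    [IsFiniteMeasure κ] [Fintype ι] [Fintype α] (F : Ω → ι)
    (hF : ∀ i, MeasurableSet (F ⁻¹' {i})) (f : ι → α) :
    infoEntropy κ (f ∘ F) = weightEntropy (fun i => κ.real (F ⁻¹' {i})) f := by
  classical
  have h : ∀ a, (κ ((f ∘ F) ⁻¹' {a})).toReal = fibreMass (fun i => κ.real (F ⁻¹' {i})) f a := by
    intro a
    have e : (f ∘ F) ⁻¹' {a} = ⋃ i ∈ Finset.univ.filter (fun i => f i = a), F ⁻¹' {i} := by
      ext ω; simp
    change κ.real _ = _
    rw [e, measureReal_biUnion_finset (fun i _ j _ hij => Disjoint.preimage _ (by simpa using hij))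
      fun i _ => hF i, fibreMass, Finset.sum_filter]
  simp only [infoEntropy, h, weightEntropy]
  rw [← sum_fibreMass_mul (p := fun i => κ.real (F ⁻¹' {i})) f
    (fun a => -Real.log (fibreMass (fun i => κ.real (F ⁻¹' {i})) f a)) Finset.univ (by simp)]
  exact Finset.sum_congr rfl fun a _ => by rw [Real.negMulLog]; ring

lemma infoEntropy_map {Ω Ω' α : Type*} [MeasurableSpace Ω] [MeasurableSpace Ω'] [Fintype α]
    (κ : Measure Ω) {g : Ω → Ω'} (hg : Measurable g) (P : Ω' → α)
    (hP : ∀ a, MeasurableSet (P ⁻¹' {a})) :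
    infoEntropy (κ.map g) P = infoEntropy κ (P ∘ g) := by
  unfold infoEntropy
  refine Finset.sum_congr rfl fun a _ => ?_
  rw [Measure.map_apply hg (hP a), preimage_comp]

lemma infoEntropy_nonneg {Ω α : Type*} [MeasurableSpace Ω] [Fintype α]
    (κ : Measure Ω) [IsProbabilityMeasure κ] (P : Ω → α) : 0 ≤ infoEntropy κ P :=
  Finset.sum_nonneg fun _ _ => Real.negMulLog_nonneg ENNReal.toReal_nonneg measureReal_le_one

variable {Y : Type*} [MeasurableSpace Y] {ν : Measure Y} [IsProbabilityMeasure ν] {S : Y → Y}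
  {k : ℕ} {P : Y → Fin k}

/-- The `P`-name of length `n` of a point. -/
def orbitName {α : Type*} (S : Y → Y) (P : Y → α) (n : ℕ) : Y → Fin n → α :=
  fun x i => P (S^[(i : ℕ)] x)

lemma entropyWrt_def (ν : Measure Y) (S : Y → Y) (P : Y → Fin k) :
    entropyWrt ν S P = atTop.liminf fun n : ℕ => infoEntropy ν (orbitName S P n) / n := rfl

lemma measurable_orbitName (hS : Measurable S) (hP : Measurable P) (n : ℕ) :
    Measurable (orbitName S P n) :=
  measurable_pi_lambda _ fun i => hP.comp (hS.iterate i)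

lemma infoEntropy_orbitName_eq_weightEntropy (hS : Measurable S) (hP : Measurable P) {n : ℕ}
    (t : ℕ) (htn : t ≤ n) :
    infoEntropy ν (orbitName S P t) =
      weightEntropy (fun w => ν.real (orbitName S P n ⁻¹' {w}))
        (fun w => fun i : Fin t => w (i.castLE htn)) :=
  infoEntropy_comp_eq_weightEntropy ν (orbitName S P n)
    (fun w => measurable_orbitName hS hP n (measurableSet_singleton w))
    (fun w => fun i : Fin t => w (i.castLE htn))

lemma infoEntropy_orbitName_concave (hS : MeasurePreserving S ν ν) (hP : Measurable P) (t : ℕ) :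
    infoEntropy ν (orbitName S P (t + 2)) + infoEntropy ν (orbitName S P t) ≤
      2 * infoEntropy ν (orbitName S P (t + 1)) := by
  have hm := measurable_orbitName hS.measurable hP
  set p : (Fin (t + 2) → Fin k) → ℝ := fun w => ν.real (orbitName S P (t + 2) ⁻¹' {w}) with hpdef
  have hp : ∀ w, 0 ≤ p w := fun w => measureReal_nonneg
  have hF := fun w => hm (t + 2) (measurableSet_singleton w)
  have inv : ∀ n, infoEntropy ν (orbitName S P n ∘ S) = infoEntropy ν (orbitName S P n) := by
    intro n
    rw [← infoEntropy_map ν hS.measurable _ fun w => hm n (measurableSet_singleton w), hS.map_eq]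
  have e1 : infoEntropy ν (orbitName S P (t + 2)) = weightEntropy p id :=
    infoEntropy_comp_eq_weightEntropy ν _ hF id
  have e2 : infoEntropy ν (orbitName S P t) =
      weightEntropy p (fun w => fun i : Fin t => w i.succ.castSucc) := by
    rw [← inv]
    exact infoEntropy_comp_eq_weightEntropy ν _ hF (fun w => fun i : Fin t => w i.succ.castSucc)
  have e3 : infoEntropy ν (orbitName S P (t + 1)) =
      weightEntropy p (fun w => fun i : Fin (t + 1) => w i.castSucc) :=
    infoEntropy_comp_eq_weightEntropy ν _ hF (fun w => fun i : Fin (t + 1) => w i.castSucc)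
  have e4 : infoEntropy ν (orbitName S P (t + 1)) =
      weightEntropy p (fun w => fun i : Fin (t + 1) => w i.succ) := by
    rw [← inv]
    exact infoEntropy_comp_eq_weightEntropy ν _ hF (fun w => fun i : Fin (t + 1) => w i.succ)
  have h := weightEntropy_submodular hp (fun w => w 0) (fun w => w (Fin.last (t + 1)))
    (fun w => fun i : Fin t => w i.succ.castSucc)
  rw [weightEntropy_congr hp (fun w => (w 0, fun i : Fin t => w i.succ.castSucc))
      (fun w => fun i : Fin (t + 1) => w i.castSucc) ?_,
    weightEntropy_congr hp (fun w => (w (Fin.last (t + 1)), fun i : Fin t => w i.succ.castSucc))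
      (fun w => fun i : Fin (t + 1) => w i.succ) ?_,
    weightEntropy_congr hp (fun w => (w 0, w (Fin.last (t + 1)),
      fun i : Fin t => w i.succ.castSucc)) id ?_, ← e1, ← e2, ← e3, ← e4] at h
  · linarith
  · intro w w'
    simp only [Prod.mk.injEq, funext_iff, id]
    rw [Fin.forall_fin_succ, Fin.forall_fin_succ']
    simp only [Fin.succ_castSucc, Fin.succ_last]
    tauto
  · intro w w'
    simp only [Prod.mk.injEq, funext_iff]
    rw [Fin.forall_fin_succ']
    simp only [Fin.succ_castSucc, Fin.succ_last]
    tauto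
  · intro w w'
    simp only [Prod.mk.injEq, funext_iff]
    rw [Fin.forall_fin_succ]
    simp

lemma infoEntropy_orbitName_increment_antitone (hS : MeasurePreserving S ν ν) (hP : Measurable P) :
    Antitone fun t => infoEntropy ν (orbitName S P (t + 1)) - infoEntropy ν (orbitName S P t) :=
  antitone_nat_of_succ_le fun t => by linarith [infoEntropy_orbitName_concave hS hP t]

lemma infoEntropy_orbitName_le (hS : MeasurePreserving S ν ν) (hP : Measurable P) (t n : ℕ) :
    infoEntropy ν (orbitName S P (t + n)) ≤ infoEntropy ν (orbitName S P t) +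
      n * (infoEntropy ν (orbitName S P (t + 1)) - infoEntropy ν (orbitName S P t)) := by
  induction n with
  | zero => simp
  | succ n ih =>
    have := infoEntropy_orbitName_increment_antitone hS hP (Nat.le_add_right t n)
    simp only at this
    push_cast
    rw [← add_assoc]
    linarith

lemma entropyWrt_le_increment (hS : MeasurePreserving S ν ν) (hP : Measurable P) (t : ℕ) :
    entropyWrt ν S P ≤
      infoEntropy ν (orbitName S P (t + 1)) - infoEntropy ν (orbitName S P t) := by
  set A := infoEntropy ν (orbitName S P t)
  set a := infoEntropy ν (orbitName S P (t + 1)) - A with ha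
  have hlim : Tendsto (fun n : ℕ => (A - t * a) / n + a) atTop (nhds a) := by
    simpa using (tendsto_const_div_atTop_nhds_zero_nat (A - t * a)).add_const a
  rw [← hlim.liminf_eq, entropyWrt_def]
  refine liminf_le_liminf ?_ ?_ ?_
  · filter_upwards [eventually_gt_atTop t] with n hn
    obtain ⟨m, rfl⟩ := Nat.exists_eq_add_of_le hn.le
    have h0 : (0 : ℝ) < ((t + m : ℕ) : ℝ) := by exact_mod_cast (Nat.zero_le t).trans_lt hn
    have := infoEntropy_orbitName_le hS hP t m
    rw [div_add' _ _ _ h0.ne']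
    refine div_le_div_of_nonneg_right (this.trans (le_of_eq ?_)) h0.le
    push_cast
    ring
  · exact isBoundedUnder_of ⟨0, fun n => div_nonneg (infoEntropy_nonneg _ _) (Nat.cast_nonneg _)⟩
  · exact hlim.isCoboundedUnder_ge

lemma le_entropyWrt (hS : MeasurePreserving S ν ν) (hP : Measurable P) (c C : ℝ)
    (h : ∀ n : ℕ, n * c - C ≤ infoEntropy ν (orbitName S P n)) : c ≤ entropyWrt ν S P := by
  have hlim : Tendsto (fun n : ℕ => c - C / n) atTop (nhds c) := by
    simpa using (tendsto_const_div_atTop_nhds_zero_nat C).const_sub c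
  rw [← hlim.liminf_eq, entropyWrt_def]
  refine liminf_le_liminf ?_ hlim.isBoundedUnder_ge ?_
  · filter_upwards [eventually_gt_atTop 0] with n hn
    have h0 : (0 : ℝ) < n := by exact_mod_cast hn
    rw [le_div_iff₀ h0, sub_mul, div_mul_cancel₀ _ h0.ne']
    linarith [h n]
  · set A := infoEntropy ν (orbitName S P 0)
    set a := infoEntropy ν (orbitName S P 1) - A with ha
    have hb : Tendsto (fun n : ℕ => A / n + a) atTop (nhds a) := by
      simpa using (tendsto_const_div_atTop_nhds_zero_nat A).add_const a
    refine IsBoundedUnder.isCoboundedUnder_ge (hb.isBoundedUnder_le.mono_le ?_)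
    filter_upwards [eventually_gt_atTop 0] with n hn
    have h0 : (0 : ℝ) < n := by exact_mod_cast hn
    have := infoEntropy_orbitName_le hS hP 0 n
    rw [zero_add] at this
    rw [div_add' _ _ _ h0.ne']
    refine div_le_div_of_nonneg_right (this.trans (le_of_eq ?_)) h0.le
    rw [ha]; ring

/-- Lower bound for the entropy of the `P`-name of a stationary process along a set of times. -/
lemma card_mul_entropyWrt_le (hS : MeasurePreserving S ν ν) (hP : Measurable P) {n : ℕ}
    (J : Finset (Fin n)) :
    J.card * entropyWrt ν S P ≤ weightEntropy (fun w => ν.real (orbitName S P n ⁻¹' {w}))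
      (fun w => fun s : J => w s) := by
  have hm := measurable_orbitName hS.measurable hP
  have hp : ∀ w, 0 ≤ ν.real (orbitName S P n ⁻¹' {w}) := fun w => measureReal_nonneg
  refine card_mul_le_weightEntropy_restrict hp (fun s w => w s) _ (fun t => ?_) ?_ J
  · refine (entropyWrt_le_increment hS hP t).trans (le_of_eq ?_)
    rw [infoEntropy_orbitName_eq_weightEntropy (n := n) hS.measurable hP (t + 1) t.2,
      infoEntropy_orbitName_eq_weightEntropy (n := n) hS.measurable hP t t.2.le]
    congr 1
    · refine weightEntropy_congr hp _ _ fun w w' => ?_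
      simp only [funext_iff, Subtype.forall, Finset.mem_Iic]
      exact ⟨fun h i => h _ (Fin.le_def.2 (Nat.lt_succ_iff.1 i.2)),
        fun h s hs => h ⟨s, Nat.lt_succ_iff.2 hs⟩⟩
    · refine weightEntropy_congr hp _ _ fun w w' => ?_
      simp only [funext_iff, Subtype.forall, Finset.mem_Iio]
      exact ⟨fun h i => h _ (Fin.lt_def.2 i.2), fun h s hs => h ⟨s, hs⟩⟩
  · have := sum_measureReal_preimage_singleton (μ := ν) (f := orbitName S P n) Finset.univ
      (fun w _ => hm n (measurableSet_singleton w))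
    simpa using this

end ProcessEntropy

section BernoulliExtension

/-- The one-sided shift. -/
def seqShift {A : Type*} (ω : ℕ → A) : ℕ → A := fun n => ω (n + 1)

lemma seqShift_iterate {A : Type*} (r : ℕ) (ω : ℕ → A) (n : ℕ) :
    (seqShift^[r] ω) n = ω (n + r) := by
  induction r generalizing ω with
  | zero => rfl
  | succ r ih => rw [Function.iterate_succ_apply, ih, seqShift]; rfl

variable {A : Type*} [MeasurableSpace A] (p : Measure A) [IsProbabilityMeasure p]

lemma measurable_seqShift : Measurable (seqShift : (ℕ → A) → ℕ → A) :=
  measurable_pi_lambda _ fun _ => measurable_pi_apply _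

lemma measurePreserving_seqShift :
    MeasurePreserving (seqShift : (ℕ → A) → ℕ → A) (Measure.infinitePi fun _ => p)
      (Measure.infinitePi fun _ => p) :=
  ⟨measurable_seqShift, Measure.map_infinitePi_infinitePi_of_inj (P := fun _ : ℕ => p)
    (f := fun n : ℕ => n + 1) fun _ _ h => by simpa using h⟩

lemma infinitePi_inter_preimage_shift (s : Finset ℕ) (t : ℕ → Set A) (ht : ∀ i, MeasurableSet (t i))
    (r : ℕ) (hr : ∀ i ∈ s, i < r) (G : Set (ℕ → A)) (hG : MeasurableSet G) :
    Measure.infinitePi (fun _ : ℕ => p) ((s : Set ℕ).pi t ∩ seqShift^[r] ⁻¹' G) =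
      Measure.infinitePi (fun _ : ℕ => p) ((s : Set ℕ).pi t) *
        Measure.infinitePi (fun _ : ℕ => p) G := by
  have hind := ProbabilityTheory.iIndepFun_infinitePi (P := fun _ : ℕ => p)
    (X := fun _ x => x) (fun _ => measurable_id)
  have h := ProbabilityTheory.indep_iSup_of_disjoint (fun i => (measurable_pi_apply i).comap_le)
    hind.iIndep (S := Set.Iio r) (T := Set.Ici r)
    (Set.Iio_disjoint_Ici le_rfl)
  rw [ProbabilityTheory.Indep_iff] at h
  rw [h _ _ ?_ ?_, ((measurePreserving_seqShift p).iterate r).measure_preimage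
    hG.nullMeasurableSet]
  · rw [Set.pi_def]
    refine Finset.measurableSet_biInter s fun i hi => ?_
    have : MeasurableSpace.comap (fun ω : ℕ → A => ω i) inferInstance ≤
        ⨆ i ∈ Set.Iio r, MeasurableSpace.comap (fun ω : ℕ → A => ω i) inferInstance :=
      le_iSup₂_of_le i (hr i hi) le_rfl
    exact this _ ⟨t i, ht i, rfl⟩
  · have hm : @Measurable _ _ (⨆ i ∈ Set.Ici r, MeasurableSpace.comap (fun ω : ℕ → A => ω i)
        inferInstance) _ (seqShift^[r] : (ℕ → A) → ℕ → A) := by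
      refine @measurable_pi_lambda _ _ _ (_) _ _ fun n => ?_
      simp only [seqShift_iterate]
      exact Measurable.mono (comap_measurable fun ω : ℕ → A => ω (n + r))
        (le_iSup₂_of_le (f := fun i (_ : i ∈ Set.Ici r) => MeasurableSpace.comap
          (fun ω : ℕ → A => ω i) inferInstance) (n + r) (Nat.le_add_left r n) le_rfl) le_rfl
    exact hm hG

/-- The product of an ergodic system with a one-sided Bernoulli shift is ergodic. -/
theorem Ergodic.prod_infinitePi {Ω : Type*} [MeasurableSpace Ω] {μ : Measure Ω}
    [IsProbabilityMeasure μ] {T : Ω → Ω} (hT : Ergodic T μ) :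
    Ergodic (Prod.map T seqShift) (μ.prod (Measure.infinitePi fun _ : ℕ => p)) := by
  set β := Measure.infinitePi fun _ : ℕ => p with hβ
  have hσ := measurePreserving_seqShift p
  refine ⟨hT.toMeasurePreserving.prod hσ, ⟨fun B hB hinv => ?_⟩⟩
  have hsec : ∀ r ω, Prod.mk ω ⁻¹' B = seqShift^[r] ⁻¹' (Prod.mk (T^[r] ω) ⁻¹' B) := by
    intro r ω
    have : (Prod.map T seqShift)^[r] ⁻¹' B = B := by
      rw [Set.preimage_iterate_eq, Function.iterate_fixed hinv]
    conv_lhs => rw [← this]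
    ext c
    simp [Prod.map_iterate]
  have hsm : ∀ ω, MeasurableSet (Prod.mk ω ⁻¹' B) := fun ω => measurable_prodMk_left hB
  have hFm : Measurable fun ω => β (Prod.mk ω ⁻¹' B) := measurable_measure_prodMk_left hB
  obtain ⟨c, hc⟩ := hT.ae_eq_const_of_ae_eq_comp_ae hFm.aestronglyMeasurable
    (Filter.Eventually.of_forall fun ω => by
      change β _ = β _
      conv_rhs => rw [hsec 1 ω]
      exact (hσ.measure_preimage (hsm _).nullMeasurableSet).symm)
  have hcb : c ≤ 1 := by
    obtain ⟨ω, hω⟩ := hc.exists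
    rw [Function.const_apply] at hω
    exact hω ▸ prob_le_one
  have key : (c • μ).prod β = (μ.prod β).restrict B := by
    have : IsFiniteMeasure (c • μ) := ⟨by
      simpa using hcb.trans_lt ENNReal.one_lt_top⟩
    refine Measure.prod_eq_generateFrom MeasurableSpace.generateFrom_measurableSet
      generateFrom_squareCylinders
      MeasurableSpace.isPiSystem_measurableSet
      (isPiSystem_squareCylinders (fun _ => MeasurableSpace.isPiSystem_measurableSet) (by simp))
      (Measure.toFiniteSpanningSetsIn _)
      ⟨fun _ => univ, fun _ => ⟨∅, fun _ => univ, by simp, by simp⟩, fun _ => measure_lt_top _ _,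
        iUnion_const _⟩ ?_
    rintro C hC _ ⟨s, t, ht, rfl⟩
    simp only [mem_univ_pi, mem_ofPred_eq] at ht
    have hD : MeasurableSet ((s : Set ℕ).pi t) :=
      MeasurableSet.pi s.countable_toSet fun i _ => ht i
    obtain ⟨r, hr⟩ : ∃ r, ∀ i ∈ s, i < r := ⟨s.sup id + 1, fun i hi =>
      Nat.lt_succ_of_le (Finset.le_sup (f := id) hi)⟩
    rw [Measure.restrict_apply (MeasurableSet.prod hC hD),
      Measure.prod_apply ((MeasurableSet.prod hC hD).inter hB)]
    have e : ∀ᵐ ω ∂μ, β (Prod.mk ω ⁻¹' (C ×ˢ (s : Set ℕ).pi t ∩ B)) =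
        C.indicator (fun _ => c * β ((s : Set ℕ).pi t)) ω := by
      have := (hT.toMeasurePreserving.iterate r).quasiMeasurePreserving.ae hc
      filter_upwards [this] with ω hω
      by_cases hωC : ω ∈ C
      · rw [Set.indicator_of_mem hωC, Set.preimage_inter, Set.mk_preimage_prod_right hωC, hsec r ω,
          infinitePi_inter_preimage_shift p s t ht r hr _ (hsm _), mul_comm]
        simp only [Function.const_apply] at hω
        rw [hω]
      · rw [Set.indicator_of_notMem hωC, Set.preimage_inter,
          Set.mk_preimage_prod_right_eq_empty hωC]
        simp
    rw [lintegral_congr_ae e, lintegral_indicator hC]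
    simp
    ring
  have h1 : (μ.prod β) B = c := by
    have := congrArg (fun m : Measure _ => m univ) key
    simp only [Measure.restrict_apply_univ] at this
    rw [← this, ← univ_prod_univ, Measure.prod_prod]
    simp
  have h2 : c * c = c := by
    have := congrArg (fun m : Measure _ => m B) key
    simp only [Measure.restrict_apply hB, inter_self] at this
    rw [Measure.prod_smul_left, Measure.smul_apply, h1] at this
    simpa using this
  have h3 : c = 0 ∨ c = 1 := by
    rcases eq_or_ne c 0 with h | h
    · exact Or.inl h
    · right
      have := (ENNReal.mul_eq_left h (hcb.trans_lt ENNReal.one_lt_top).ne).1 h2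
      exact this
  rw [eventuallyConst_set']
  rcases h3 with h | h
  · left
    exact ae_eq_empty.2 (h1.trans h)
  · right
    exact ae_eq_univ.2 ((prob_compl_eq_zero_iff hB).2 (h1.trans h))

end BernoulliExtension

section ErgodicLift

open Topology BoundedContinuousFunction

lemma ProbabilityMeasure.measure_eq_one_of_tendsto {Z ι : Type*} [TopologicalSpace Z]
    [MeasurableSpace Z] [OpensMeasurableSpace Z] [HasOuterApproxClosed Z] {l : Filter ι} [l.NeBot]
    {κ : ProbabilityMeasure Z} {κs : ι → ProbabilityMeasure Z} (h : Tendsto κs l (𝓝 κ))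
    {K : Set Z} (hK : IsClosed K) (hκs : ∀ᶠ i in l, (κs i : Measure Z) K = 1) :
    (κ : Measure Z) K = 1 := by
  refine le_antisymm prob_le_one ?_
  have := ProbabilityMeasure.limsup_measure_closed_le_of_tendsto h hK
  rwa [limsup_congr hκs, limsup_const] at this

variable {Ω Y : Type*} [TopologicalSpace Ω] [TopologicalSpace.MetrizableSpace Ω] [CompactSpace Ω]
  [MeasurableSpace Ω] [BorelSpace Ω] [TopologicalSpace Y] [TopologicalSpace.MetrizableSpace Y]
  [CompactSpace Y] [MeasurableSpace Y] [BorelSpace Y]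

/-- A closed set with nonempty fibres carries a lift of every probability measure on the base. -/
lemma exists_probabilityMeasure_lift (lam : ProbabilityMeasure Ω) {K : Set (Ω × Y)}
    (hK : IsClosed K) (hfib : ∀ ω, ∃ y, (ω, y) ∈ K) :
    ∃ κ : ProbabilityMeasure (Ω × Y), (κ : Measure (Ω × Y)).map Prod.fst = lam ∧
      (κ : Measure (Ω × Y)) K = 1 := by
  let _ := TopologicalSpace.metrizableSpaceMetric Ω
  let _ := TopologicalSpace.metrizableSpaceMetric Y
  have : SecondCountableTopology Ω := inferInstance
  have : SecondCountableTopology Y := inferInstance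
  obtain ⟨ω₀⟩ := lam.nonempty
  choose z hz using hfib
  set φ : ℕ → SimpleFunc Ω Ω := fun n => SimpleFunc.approxOn id measurable_id univ ω₀ (mem_univ _) n
  have hφ : ∀ ω, Tendsto (fun n => φ n ω) atTop (𝓝 ω) := fun ω =>
    SimpleFunc.tendsto_approxOn measurable_id (mem_univ _) (by simp)
  set g : ℕ → SimpleFunc Ω (Ω × Y) := fun n => (φ n).map fun ω => (ω, z ω)
  have hg : ∀ n, AEMeasurable (g n) (lam : Measure Ω) := fun n => (g n).measurable.aemeasurable
  set κs : ℕ → ProbabilityMeasure (Ω × Y) := fun n => lam.map (hg n)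
  obtain ⟨κ, -, hκ⟩ := isCompact_univ.ultrafilter_le_nhds
    ((hyperfilter ℕ).map κs) (by simp)
  have hlim : Tendsto κs (hyperfilter ℕ) (𝓝 κ) := hκ
  refine ⟨κ, ?_, ProbabilityMeasure.measure_eq_one_of_tendsto hlim hK
    (Eventually.of_forall fun n => ?_)⟩
  · have hfst := ProbabilityMeasure.tendsto_map_of_tendsto_of_continuous _ _ hlim continuous_fst
    have hlam : Tendsto (fun n => (κs n).map
        (continuous_fst.measurable.aemeasurable : AEMeasurable Prod.fst (κs n : Measure (Ω × Y))))
        (hyperfilter ℕ) (𝓝 lam) := by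
      rw [ProbabilityMeasure.tendsto_iff_forall_integral_tendsto]
      intro f
      have : Tendsto (fun n => ∫ ω, f (φ n ω) ∂(lam : Measure Ω)) atTop
          (𝓝 (∫ ω, f ω ∂(lam : Measure Ω))) := by
        refine tendsto_integral_of_dominated_convergence (fun _ => ‖f‖) (fun n =>
          (f.continuous.measurable.comp (φ n).measurable).aestronglyMeasurable)
          (integrable_const _) (fun n => Eventually.of_forall fun ω => f.norm_coe_le_norm _)
          (Eventually.of_forall fun ω => (f.continuous.tendsto _).comp (hφ ω))
      refine (this.mono_left (Nat.hyperfilter_le_atTop)).congr fun n => ?_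
      rw [ProbabilityMeasure.toMeasure_map, integral_map
        continuous_fst.measurable.aemeasurable f.continuous.aestronglyMeasurable,
        ProbabilityMeasure.toMeasure_map, integral_map (hg n)
        (f := fun x => f x.1) (f.continuous.comp continuous_fst).aestronglyMeasurable]
      rfl
    have := tendsto_nhds_unique hfst hlam
    rw [← this, ProbabilityMeasure.toMeasure_map]
  · rw [ProbabilityMeasure.toMeasure_map, Measure.map_apply (g n).measurable hK.measurableSet]
    have : g n ⁻¹' K = univ := by ext ω; simp [g, hz]
    rw [this, measure_univ]

variable {Z : Type*} [TopologicalSpace Z] [TopologicalSpace.MetrizableSpace Z] [CompactSpace Z]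
  [MeasurableSpace Z] [BorelSpace Z]

/-- Krylov–Bogolyubov inside a closed convex set of measures. -/
lemma exists_invariant_mem (R : Z → Z) (hR : Continuous R) (C : Set (ProbabilityMeasure Z))
    (hC : IsClosed C) (κ₀ : ProbabilityMeasure Z)
    (havg : ∀ (n : ℕ) (κ : ProbabilityMeasure Z), n ≠ 0 → (κ : Measure Z) = (n : ℝ≥0∞)⁻¹ •
      ∑ i ∈ Finset.range n, (κ₀ : Measure Z).map R^[i] → κ ∈ C) :
    ∃ κ ∈ C, MeasurePreserving R (κ : Measure Z) κ := by
  have hRm : ∀ i, Measurable R^[i] := fun i => hR.measurable.iterate i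
  have hprob : ∀ n : ℕ, IsProbabilityMeasure (((n + 1 : ℕ) : ℝ≥0∞)⁻¹ •
      ∑ i ∈ Finset.range (n + 1), (κ₀ : Measure Z).map R^[i]) := by
    intro n
    constructor
    have : ∀ i, ((κ₀ : Measure Z).map R^[i]) univ = 1 := fun i => by
      rw [Measure.map_apply (hRm i) .univ, preimage_univ, measure_univ]
    simp only [Measure.smul_apply, Measure.coe_finsetSum, Finset.sum_apply, this]
    simp only [Finset.sum_const, Finset.card_range, nsmul_eq_mul, mul_one, smul_eq_mul]
    exact ENNReal.inv_mul_cancel (by simp) (by simp)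
  set κs : ℕ → ProbabilityMeasure Z := fun n => ⟨_, hprob n⟩
  obtain ⟨κ, -, hκ⟩ := isCompact_univ.ultrafilter_le_nhds
    ((hyperfilter ℕ).map κs) (by simp)
  have hlim : Tendsto κs (hyperfilter ℕ) (𝓝 κ) := hκ
  refine ⟨κ, hC.mem_of_tendsto hlim (Eventually.of_forall fun n =>
    havg (n + 1) _ n.succ_ne_zero rfl), hR.measurable, ?_⟩
  have hmap := ProbabilityMeasure.tendsto_map_of_tendsto_of_continuous _ _ hlim hR
  suffices h : Tendsto (fun n => (κs n).map hR.measurable.aemeasurable) (hyperfilter ℕ) (𝓝 κ) by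
    have := tendsto_nhds_unique hmap h
    conv_rhs => rw [← this]
    rw [ProbabilityMeasure.toMeasure_map]
  rw [ProbabilityMeasure.tendsto_iff_forall_integral_tendsto] at hlim ⊢
  intro f
  have hfint : ∀ i, Integrable (fun x => f (R^[i] x)) (κ₀ : Measure Z) := fun i =>
    (f.compContinuous ⟨_, hR.iterate i⟩).integrable _
  have hval : ∀ n (f : Z →ᵇ ℝ), ∫ x, f x ∂(κs n : Measure Z) =
      ((n : ℝ) + 1)⁻¹ * ∑ i ∈ Finset.range (n + 1), ∫ x, f (R^[i] x) ∂(κ₀ : Measure Z) := by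
    intro n f
    change ∫ x, f x ∂(((n + 1 : ℕ) : ℝ≥0∞)⁻¹ •
      ∑ i ∈ Finset.range (n + 1), (κ₀ : Measure Z).map R^[i]) = _
    rw [integral_smul_measure, integral_finsetSum_measure fun i _ => ?_]
    · simp only [smul_eq_mul]
      congr 1
      · rw [ENNReal.toReal_inv, ENNReal.toReal_natCast]; push_cast; rfl
      · exact Finset.sum_congr rfl fun i _ => integral_map (hRm i).aemeasurable
          f.continuous.aestronglyMeasurable
    · have := Measure.isProbabilityMeasure_map (μ := (κ₀ : Measure Z)) (hRm i).aemeasurable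
      exact f.integrable _
  have hdiff : ∀ n, ‖∫ x, f x ∂((κs n).map hR.measurable.aemeasurable : Measure Z) -
      ∫ x, f x ∂(κs n : Measure Z)‖ ≤ ((n : ℝ) + 1)⁻¹ * (2 * ‖f‖) := by
    intro n
    rw [ProbabilityMeasure.toMeasure_map, integral_map hR.measurable.aemeasurable
      f.continuous.aestronglyMeasurable]
    have h1 := hval n (f.compContinuous ⟨R, hR⟩)
    simp only [BoundedContinuousFunction.compContinuous_apply, ContinuousMap.coe_mk,
      ← Function.iterate_succ_apply' R] at h1
    rw [h1, hval n f, ← mul_sub, ← Finset.sum_sub_distrib, Finset.sum_range_sub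
      (fun i => ∫ x, f (R^[i] x) ∂(κ₀ : Measure Z)), norm_mul, norm_inv,
      Real.norm_of_nonneg (by positivity)]
    have hb : ∀ i, ‖∫ x, f (R^[i] x) ∂(κ₀ : Measure Z)‖ ≤ ‖f‖ := fun i => by
      simpa using norm_integral_le_of_norm_le_const (μ := (κ₀ : Measure Z))
        (Eventually.of_forall fun x => f.norm_coe_le_norm (R^[i] x))
    gcongr
    exact (norm_sub_le _ _).trans (by linarith [hb (n + 1), hb 0])
  have h0 : Tendsto (fun n : ℕ => ((n : ℝ) + 1)⁻¹ * (2 * ‖f‖)) (hyperfilter ℕ) (𝓝 0) := by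
    have := (tendsto_one_div_add_atTop_nhds_zero_nat (𝕜 := ℝ)).mul_const (2 * ‖f‖)
    simp only [one_div, zero_mul] at this
    exact this.mono_left Nat.hyperfilter_le_atTop
  have := (squeeze_zero_norm hdiff h0).add (hlim f)
  simpa using this

end ErgodicLift

section InvariantErgodicLift

open Topology BoundedContinuousFunction

lemma MeasureTheory.MeasurePreserving.cond_of_preimage_eq {Z : Type*} [MeasurableSpace Z]
    {κ : Measure Z} {R : Z → Z} (hR : MeasurePreserving R κ κ) {A : Set Z} (hA : MeasurableSet A)
    (hinv : R ⁻¹' A = A) :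
    MeasurePreserving R (ProbabilityTheory.cond κ A) (ProbabilityTheory.cond κ A) := by
  have := hR.restrict_preimage hA
  rw [hinv] at this
  exact this.smul_measure _

variable {Ω Y : Type*} [TopologicalSpace Ω] [TopologicalSpace.MetrizableSpace Ω] [CompactSpace Ω]
  [MeasurableSpace Ω] [BorelSpace Ω] [TopologicalSpace Y] [TopologicalSpace.MetrizableSpace Y]
  [CompactSpace Y] [MeasurableSpace Y] [BorelSpace Y]

/-- A closed forward-invariant set with nonempty fibres over an ergodic system carries an ergodic
lift. -/
theorem exists_ergodic_lift {τ : Ω → Ω} (hτ : Continuous τ) {S : Y → Y} (hS : Continuous S)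
    (lam : ProbabilityMeasure Ω) (herg : Ergodic τ (lam : Measure Ω)) {K : Set (Ω × Y)}
    (hK : IsClosed K) (hKR : MapsTo (Prod.map τ S) K K) (hfib : ∀ ω, ∃ y, (ω, y) ∈ K) :
    ∃ κ : ProbabilityMeasure (Ω × Y), (κ : Measure (Ω × Y)).map Prod.fst = lam ∧
      (κ : Measure (Ω × Y)) K = 1 ∧ Ergodic (Prod.map τ S) (κ : Measure (Ω × Y)) := by
  let _ := TopologicalSpace.metrizableSpaceMetric Ω
  let _ := TopologicalSpace.metrizableSpaceMetric Y
  have : SecondCountableTopology Ω := inferInstance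
  have : SecondCountableTopology Y := inferInstance
  set R := Prod.map τ S with hRdef
  have hR : Continuous R := hτ.prodMap hS
  set C : Set (ProbabilityMeasure (Ω × Y)) :=
    {κ | (κ : Measure (Ω × Y)).map Prod.fst = lam ∧ (κ : Measure (Ω × Y)) K = 1} with hCdef
  have hC : IsClosed C := by
    have h1 : IsClosed {κ : ProbabilityMeasure (Ω × Y) |
        (κ : Measure (Ω × Y)).map Prod.fst = lam} := by
      have := isClosed_eq (ProbabilityMeasure.continuous_map (Ω := Ω × Y) continuous_fst)
        (continuous_const (y := lam))
      convert this using 2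
      ext κ
      rw [← ProbabilityMeasure.toMeasure_injective.eq_iff, ProbabilityMeasure.toMeasure_map]
    refine h1.inter (isClosed_iff_ultrafilter.2 fun κ u hu hmem => ?_)
    exact ProbabilityMeasure.measure_eq_one_of_tendsto (κs := id) hu hK hmem
  obtain ⟨κ₀, hκ₀, hκ₀K⟩ := exists_probabilityMeasure_lift lam hK hfib
  obtain ⟨κ₁, hκ₁C, hκ₁⟩ := exists_invariant_mem R hR C hC κ₀ fun n κ hn hκ => by
    have hn' : (n : ℝ≥0∞)⁻¹ * n = 1 :=
      ENNReal.inv_mul_cancel (by exact_mod_cast hn) (ENNReal.natCast_ne_top n)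
    have hit : ∀ i, MapsTo R^[i] K K := fun i => hKR.iterate i
    refine ⟨?_, ?_⟩
    · ext s hs
      rw [Measure.map_apply measurable_fst hs, hκ]
      have : ∀ i, ((κ₀ : Measure (Ω × Y)).map R^[i]) (Prod.fst ⁻¹' s) = lam s := by
        intro i
        rw [Measure.map_apply (hR.measurable.iterate i) (measurable_fst hs)]
        have e : R^[i] ⁻¹' (Prod.fst ⁻¹' s) = Prod.fst ⁻¹' (τ^[i] ⁻¹' s) := by
          rw [hRdef, Prod.map_iterate]; rfl
        have hm := (hτ.measurable.iterate i) hs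
        rw [e, ← Measure.map_apply measurable_fst hm, hκ₀,
          (herg.toMeasurePreserving.iterate i).measure_preimage hs.nullMeasurableSet,
          ProbabilityMeasure.ennreal_coeFn_eq_coeFn_toMeasure]
      simp only [Measure.smul_apply, Measure.coe_finsetSum, Finset.sum_apply, this]
      simp only [Finset.sum_const, Finset.card_range, nsmul_eq_mul, smul_eq_mul]
      rw [← mul_assoc, hn', one_mul, ProbabilityMeasure.ennreal_coeFn_eq_coeFn_toMeasure]
    · rw [hκ]
      have : ∀ i, ((κ₀ : Measure (Ω × Y)).map R^[i]) K = 1 := by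
        intro i
        rw [Measure.map_apply (hR.measurable.iterate i) hK.measurableSet]
        have := Measure.isProbabilityMeasure_map (μ := (κ₀ : Measure (Ω × Y)))
          (hR.measurable.iterate i).aemeasurable
        refine le_antisymm prob_le_one ?_
        rw [← hκ₀K]
        exact measure_mono (hit i)
      simp only [Measure.smul_apply, Measure.coe_finsetSum, Finset.sum_apply, this]
      simpa using hn'
  set I : Set (ProbabilityMeasure (Ω × Y)) :=
    C ∩ {κ | MeasurePreserving R (κ : Measure (Ω × Y)) κ} with hIdef
  have hI : IsCompact I := by
    refine (hC.inter ?_).isCompact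
    have := isClosed_eq (ProbabilityMeasure.continuous_map (Ω := Ω × Y) hR) continuous_id
    convert this using 2
    ext κ
    rw [← ProbabilityMeasure.toMeasure_injective.eq_iff, ProbabilityMeasure.toMeasure_map]
    exact ⟨fun h => h.map_eq, fun h => ⟨hR.measurable, h⟩⟩
  set Φ : ProbabilityMeasure (Ω × Y) → (C(Ω × Y, ℝ) → ℝ) :=
    fun κ f => ∫ x, f x ∂(κ : Measure (Ω × Y))
  have hΦ : Continuous Φ :=
    continuous_pi fun f => ProbabilityMeasure.continuous_integral_continuousMap f
  have hΦinj : ∀ κ κ', Φ κ = Φ κ' → κ = κ' := by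
    intro κ κ' h
    refine ProbabilityMeasure.toMeasure_injective ?_
    exact ext_of_forall_integral_eq_of_IsFiniteMeasure fun f => congrFun h f.toContinuousMap
  obtain ⟨v, hv⟩ := (hI.image hΦ).extremePoints_nonempty (Set.Nonempty.image Φ ⟨κ₁, hκ₁C, hκ₁⟩)
  rw [mem_extremePoints_iff_left] at hv
  obtain ⟨⟨κ, ⟨hκC, hκinv⟩, rfl⟩, hext⟩ := hv
  have hcond : ∀ A : Set (Ω × Y), MeasurableSet A → R ⁻¹' A = A → (κ : Measure (Ω × Y)) A ≠ 0 →
      ∃ κ' ∈ I, (κ' : Measure (Ω × Y)) = ProbabilityTheory.cond κ A := by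
    intro A hA hAinv hA0
    have hpr := ProbabilityTheory.cond_isProbabilityMeasure hA0
    have hac := ProbabilityTheory.cond_absolutelyContinuous (μ := (κ : Measure (Ω × Y))) (s := A)
    have hmp := hκinv.cond_of_preimage_eq hA hAinv
    refine ⟨⟨_, hpr⟩, ⟨⟨?_, ?_⟩, hmp⟩, rfl⟩
    · have h1 := Measure.isProbabilityMeasure_map (μ := ProbabilityTheory.cond
        (κ : Measure (Ω × Y)) A) measurable_fst.aemeasurable
      refine herg.eq_of_absolutelyContinuous (ν := (ProbabilityTheory.cond
        (κ : Measure (Ω × Y)) A).map Prod.fst) ⟨hτ.measurable, ?_⟩ ?_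
      · rw [Measure.map_map hτ.measurable measurable_fst]
        conv_rhs => rw [← hmp.map_eq, Measure.map_map measurable_fst hR.measurable]
        rfl
      · rw [← hκC.1]
        exact hac.map measurable_fst
    · change ProbabilityTheory.cond (κ : Measure (Ω × Y)) A K = 1
      rw [← prob_compl_eq_zero_iff hK.measurableSet]
      exact hac ((prob_compl_eq_zero_iff hK.measurableSet).2 hκC.2)
  refine ⟨κ, hκC.1, hκC.2, hκinv, ⟨fun A hA hAinv => ?_⟩⟩
  rw [eventuallyConst_set']
  by_contra! hcon
  have hA0 : (κ : Measure (Ω × Y)) A ≠ 0 := fun h => hcon.1 (ae_eq_empty.2 h)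
  have hA1 : (κ : Measure (Ω × Y)) Aᶜ ≠ 0 := fun h => hcon.2 (ae_eq_univ.2 h)
  obtain ⟨κa, hκa, ea⟩ := hcond A hA hAinv hA0
  obtain ⟨κb, hκb, eb⟩ := hcond Aᶜ hA.compl (by rw [preimage_compl, hAinv]) hA1
  have hpos : ∀ B : Set (Ω × Y), (κ : Measure (Ω × Y)) B ≠ 0 →
      0 < (κ : Measure (Ω × Y)).real B := fun B hB =>
    ENNReal.toReal_pos hB (measure_ne_top _ _)
  have hfix := hext (Φ κa) ⟨κa, hκa, rfl⟩ (Φ κb) ⟨κb, hκb, rfl⟩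
    ⟨(κ : Measure (Ω × Y)).real A, (κ : Measure (Ω × Y)).real Aᶜ, hpos A hA0, hpos Aᶜ hA1, ?_, ?_⟩
  · have := hΦinj _ _ hfix
    have h2 : (κa : Measure (Ω × Y)) Aᶜ = 0 := by
      rw [ea, ProbabilityTheory.cond_apply hA]; simp
    rw [this] at h2
    exact hA1 h2
  · rw [probReal_compl_eq_one_sub hA]; ring
  · funext f
    have hfint : Integrable (fun x => f x) (κ : Measure (Ω × Y)) :=
      f.continuous.integrable_of_hasCompactSupport (HasCompactSupport.of_compactSpace _)
    have hmul : ∀ (B : Set (Ω × Y)) (κ' : ProbabilityMeasure (Ω × Y)),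
        (κ : Measure (Ω × Y)) B ≠ 0 → (κ' : Measure (Ω × Y)) = ProbabilityTheory.cond κ B →
        (κ : Measure (Ω × Y)).real B * Φ κ' f = ∫ x in B, f x ∂(κ : Measure (Ω × Y)) := by
      intro B κ' hB e
      change _ * ∫ x, f x ∂(κ' : Measure (Ω × Y)) = _
      rw [e, ProbabilityTheory.cond, integral_smul_measure, ENNReal.toReal_inv, smul_eq_mul,
        ← mul_assoc]
      change (κ : Measure (Ω × Y)).real B * ((κ : Measure (Ω × Y)).real B)⁻¹ * _ = _
      rw [mul_inv_cancel₀ (hpos B hB).ne', one_mul]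
    simp only [Pi.add_apply, Pi.smul_apply, smul_eq_mul]
    rw [hmul A κa hA0 ea, hmul Aᶜ κb hA1 eb, integral_add_compl hA hfint]

end InvariantErgodicLift

section Shadowing

lemma isClosed_setOf_forall {ι : Sort*} {W : Type*} [TopologicalSpace W] {p : ι → W → Prop}
    (h : ∀ i, IsClosed {w | p i w}) : IsClosed {w | ∀ i, p i w} := by
  rw [ofPred_forall]
  exact isClosed_iInter h

lemma IsGapFunction.exists_shadow_fintype {Y : Type*} [MetricSpace Y] {S : Y ≃ Y} {ε : ℝ}
    {L : ℕ → ℕ} (hL : IsGapFunction S ε L) {N g : ℕ} (hg : L N ≤ g) {ι : Type*} [Fintype ι]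
    (y : ι → Y) (a b : ι → ℕ) (hab : ∀ i, a i ≤ b i) (hN : ∀ i, b i ≤ a i + N)
    (hsep : ∀ i j, i ≠ j → b i + g ≤ a j ∨ b j + g ≤ a i) :
    ∃ z : Y, ∀ i t, a i ≤ t → t ≤ b i → dist (S^[t] z) (S^[t] (y i)) ≤ ε := by
  classical
  obtain ⟨hmono, hpos, hspec⟩ := hL
  have hg0 : 0 < g := (hpos N).trans_le hg
  set e := Fintype.equivFin ι
  set σ : Fin (Fintype.card ι) → ι := fun i => e.symm (Tuple.sort (a ∘ e.symm) i) with hσ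
  have hσi : Function.Injective σ := e.symm.injective.comp (Equiv.injective _)
  have hσm : Monotone (a ∘ σ) := Tuple.monotone_sort (a ∘ e.symm)
  obtain ⟨z, hz⟩ := hspec _ (y ∘ σ) (fun i => a (σ i)) (fun i => b (σ i))
    (fun i => by exact_mod_cast hab _) (fun i j hij => by
      have h1 : a (σ i) ≤ a (σ j) := hσm (Fin.le_def.2 (by omega))
      have h2 : σ i ≠ σ j := fun h => by have := hσi h; subst this; omega
      have h3 : L ((b (σ j) : ℤ) - a (σ j)).toNat ≤ L N :=
        hmono (by have := hN (σ j); have := hab (σ j); omega)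
      have := hsep _ _ h2
      have := hab (σ j)
      omega)
  refine ⟨z, fun i t h1 h2 => ?_⟩
  have := hz ((Tuple.sort (a ∘ e.symm)).symm (e i)) t (by simpa [hσ] using h1)
    (by simpa [hσ] using h2)
  simpa [hσ, zpow_natCast, ← Equiv.Perm.iterate_eq_pow] using this

lemma IsGapFunction.exists_shadow {Y : Type*} [MetricSpace Y] [CompactSpace Y] {S : Y ≃ₜ Y} {ε : ℝ}
    {L : ℕ → ℕ} (hL : IsGapFunction S.toEquiv ε L) {N g : ℕ} (hg : L N ≤ g) {ι : Type*}
    (y : ι → Y) (a b : ι → ℕ) (hab : ∀ i, a i ≤ b i) (hN : ∀ i, b i ≤ a i + N)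
    (hsep : ∀ i j, i ≠ j → b i + g ≤ a j ∨ b j + g ≤ a i) :
    ∃ z : Y, ∀ i t, a i ≤ t → t ≤ b i → dist (S^[t] z) (S^[t] (y i)) ≤ ε := by
  have hcl : ∀ i, IsClosed {z : Y | ∀ t, a i ≤ t → t ≤ b i → dist (S^[t] z) (S^[t] (y i)) ≤ ε} := by
    intro i
    exact isClosed_setOf_forall fun t =>
      isClosed_setOf_forall fun _ => isClosed_setOf_forall fun _ =>
      isClosed_le ((S.continuous.iterate t).dist continuous_const) continuous_const
  obtain ⟨z, hz⟩ := CompactSpace.iInter_nonempty hcl fun s => by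
    obtain ⟨z, hz⟩ := hL.exists_shadow_fintype hg (ι := s) (fun i => y i) (fun i => a i)
      (fun i => b i) (fun i => hab i) (fun i => hN i)
      (fun i j hij => hsep i j fun h => hij (Subtype.ext h))
    exact ⟨z, mem_iInter₂.2 fun i hi => hz ⟨i, hi⟩⟩
  exact ⟨z, fun i => mem_iInter.1 hz i⟩

/-- The time `s` is marked and is followed by `R` unmarked times. -/
def IsolatedMark (R : ℕ) (m : ℕ → Bool) (s : ℕ) : Prop :=
  m s = true ∧ ∀ i, s < i → i ≤ s + R → m i = false

/-- After every isolated mark `s`, the orbit of `z` first follows the orbit of the point selected by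
`c s`, and then the orbit of `y` until the next mark, for a time at most `N`. -/
def Follows {Y E : Type*} [MetricSpace Y] (S : Y → Y) (ε : ℝ) (M g N : ℕ) (e : E → Y) (y : Y)
    (m : ℕ → Bool) (c : ℕ → E) (z : Y) : Prop :=
  ∀ s, IsolatedMark (M + 2 * g) m s →
    (∀ j ≤ M, dist (S^[s + g + j] z) (S^[j] (e (c s))) ≤ ε) ∧
    ∀ u, s + (M + 2 * g) ≤ u → u ≤ s + (M + 2 * g) + N → (∀ i, s < i → i ≤ u → m i = false) →
      dist (S^[u] z) (S^[u] y) ≤ ε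

variable {Y E : Type*} [MetricSpace Y]

lemma exists_follows [CompactSpace Y] {S : Y ≃ₜ Y} {ε : ℝ}
    {L : ℕ → ℕ} (hL : IsGapFunction S.toEquiv ε L) {M N g : ℕ} (hg : L N ≤ g) (hMN : M ≤ N)
    (e : E → Y) (y : Y) (m : ℕ → Bool) (c : ℕ → E) : ∃ z, Follows S ε M g N e y m c z := by
  classical
  set R := M + 2 * g with hR
  set endTime : ℕ → ℕ := fun s =>
    Nat.findGreatest (fun u => ∀ i, s < i → i ≤ u → m i = false) (s + R + N) with hendTime
  have endTime_le : ∀ s, endTime s ≤ s + R + N := fun s => Nat.findGreatest_le _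
  have le_endTime : ∀ s u, u ≤ s + R + N → (∀ i, s < i → i ≤ u → m i = false) → u ≤ endTime s :=
    fun s u h1 h2 => Nat.le_findGreatest h1 h2
  have endTime_spec : ∀ s i, s < i → i ≤ endTime s → m i = false := fun s =>
    Nat.findGreatest_spec (P := fun u => ∀ i, s < i → i ≤ u → m i = false) (Nat.zero_le (s + R + N))
      fun i h1 h2 => absurd h1 (by omega)
  have endTime_lt : ∀ s s', s < s' → IsolatedMark R m s' → endTime s < s' := fun s s' h h' => by
    by_contra! hle
    have := endTime_spec s s' h hle
    simp [h'.1] at this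
  have endTime_ge : ∀ s, IsolatedMark R m s → s + R ≤ endTime s := fun s h =>
    le_endTime s _ (by omega) h.2
  set a : {s // IsolatedMark R m s} × Bool → ℕ := fun p => if p.2 then p.1 + g else p.1 + R with ha
  set b : {s // IsolatedMark R m s} × Bool → ℕ :=
    fun p => if p.2 then p.1 + g + M else endTime p.1 with hb
  have sep : ∀ (s s' : {s // IsolatedMark R m s}) (k k' : Bool), (s : ℕ) < s' →
      b (s, k) + g ≤ a (s', k') := by
    intro s s' k k' h
    have h1 := endTime_lt s s' h s'.2
    have h2 := endTime_ge s s.2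
    simp only [ha, hb]
    split_ifs <;> omega
  have hab : ∀ p, a p ≤ b p := by
    rintro ⟨s, k⟩
    have := endTime_ge s s.2
    simp only [ha, hb]
    split_ifs <;> omega
  have hN : ∀ p, b p ≤ a p + N := by
    rintro ⟨s, k⟩
    have := endTime_le s
    simp only [ha, hb]
    split_ifs <;> omega
  have hsep : ∀ p p', p ≠ p' → b p + g ≤ a p' ∨ b p' + g ≤ a p := by
    rintro ⟨s, k⟩ ⟨s', k'⟩ hne
    rcases lt_trichotomy (s : ℕ) s' with h | h | h
    · exact Or.inl (sep s s' k k' h)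
    · obtain rfl : s = s' := Subtype.ext h
      have hk : k ≠ k' := fun h => hne (by rw [h])
      simp only [ha, hb]
      cases k <;> cases k' <;> simp at hk ⊢ <;> omega
    · exact Or.inr (sep s' s k' k h)
  obtain ⟨z, hz⟩ := hL.exists_shadow hg (ι := {s // IsolatedMark R m s} × Bool)
    (fun p => if p.2 then S.symm^[p.1 + g] (e (c p.1)) else y) a b hab hN hsep
  refine ⟨z, fun s hs => ⟨fun j hj => ?_, fun u h1 h2 h3 => ?_⟩⟩
  · have := hz (⟨s, hs⟩, true) (s + g + j) (by simp [ha]) (by simp [hb, hj])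
    simp only [if_true] at this
    rwa [Nat.add_comm (s + g) j, Function.iterate_add_apply S j (s + g) (S.symm^[s + g] _),
      Function.LeftInverse.iterate S.apply_symm_apply (s + g), Nat.add_comm j (s + g)] at this
  · have := hz (⟨s, hs⟩, false) u (by simpa [ha] using h1)
      (by simpa [hb] using le_endTime s u h2 h3)
    simpa using this

lemma isolatedMark_seqShift (R : ℕ) (m : ℕ → Bool) (s : ℕ) :
    IsolatedMark R (seqShift m) s ↔ IsolatedMark R m (s + 1) := by
  refine and_congr Iff.rfl ⟨fun h i h1 h2 => ?_, fun h i h1 h2 => h (i + 1) (by omega) (by omega)⟩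
  obtain ⟨i, rfl⟩ := Nat.exists_eq_add_of_lt (by omega : 0 < i)
  have := h i (by omega) (by omega)
  simpa [seqShift] using this

lemma Follows.seqShift {S : Y → Y} {ε : ℝ} {M g N : ℕ} {e : E → Y} {y : Y} {m : ℕ → Bool}
    {c : ℕ → E} {z : Y} (h : Follows S ε M g N e y m c z) :
    Follows S ε M g N e (S y) (seqShift m) (seqShift c) (S z) := by
  intro s hs
  rw [isolatedMark_seqShift] at hs
  obtain ⟨h1, h2⟩ := h (s + 1) hs
  refine ⟨fun j hj => ?_, fun u hu1 hu2 hu3 => ?_⟩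
  · rw [← Function.iterate_succ_apply]
    have := h1 j hj
    rwa [show s + 1 + g + j = s + g + j + 1 by omega] at this
  · rw [← Function.iterate_succ_apply, ← Function.iterate_succ_apply]
    refine h2 (u + 1) (by omega) (by omega) fun i hi1 hi2 => ?_
    obtain ⟨i, rfl⟩ := Nat.exists_eq_add_of_lt (by omega : 0 < i)
    have := hu3 i (by omega) (by omega)
    simpa [_root_.seqShift] using this

lemma isClopen_isolatedMark (R s : ℕ) : IsClopen {m : ℕ → Bool | IsolatedMark R m s} := by
  have h : ∀ i b, IsClopen {m : ℕ → Bool | m i = b} := fun i b =>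
    (isClopen_discrete {b}).preimage (continuous_apply i)
  have : {m : ℕ → Bool | IsolatedMark R m s} =
      {m | m s = true} ∩ ⋂ i ∈ Finset.Ioc s (s + R), {m | m i = false} := by
    ext m; simp [IsolatedMark]
  rw [this]
  exact (h _ _).inter (isClopen_biInter_finset fun i _ => h _ _)

lemma isClopen_unmarked (s u : ℕ) :
    IsClopen {m : ℕ → Bool | ∀ i, s < i → i ≤ u → m i = false} := by
  have : {m : ℕ → Bool | ∀ i, s < i → i ≤ u → m i = false} =
      ⋂ i ∈ Finset.Ioc s u, {m | m i = false} := by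
    ext m; simp
  rw [this]
  exact isClopen_biInter_finset fun i _ => (isClopen_discrete {false}).preimage (continuous_apply i)

lemma isClosed_follows [TopologicalSpace E] [DiscreteTopology E] {S : Y → Y} (hS : Continuous S)
    (ε : ℝ) (M g N : ℕ) (e : E → Y) {W : Type*} [TopologicalSpace W] {y z : W → Y}
    {m : W → ℕ → Bool} {c : W → ℕ → E} (hy : Continuous y) (hz : Continuous z) (hm : Continuous m)
    (hc : Continuous c) : IsClosed {w | Follows S ε M g N e (y w) (m w) (c w) (z w)} := by
  refine isClosed_setOf_forall fun s =>
    isClosed_imp ((isClopen_isolatedMark _ s).2.preimage hm) (IsClosed.inter ?_ ?_)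
  · exact isClosed_setOf_forall fun j => isClosed_setOf_forall fun _ =>
      isClosed_le (((hS.iterate _).comp hz).dist ((hS.iterate _).comp
        (continuous_of_discreteTopology.comp ((continuous_apply s).comp hc)))) continuous_const
  · exact isClosed_setOf_forall fun u =>
      isClosed_setOf_forall fun _ => isClosed_setOf_forall fun _ =>
      isClosed_imp ((isClopen_unmarked s u).2.preimage hm)
        (isClosed_le (((hS.iterate _).comp hz).dist ((hS.iterate _).comp hy)) continuous_const)

end Shadowing

section SeparatedSets

open Dynamics Uniformity

variable {Y : Type*} [MetricSpace Y]

/-- Distinct points of `E` are at distance at least `ρ` at some time smaller than `M`. -/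
def IsDynSeparated (S : Y → Y) (ρ : ℝ) (M : ℕ) (E : Finset Y) : Prop :=
  ∀ x ∈ E, ∀ y ∈ E, (∀ k < M, dist (S^[k] x) (S^[k] y) < ρ) → x = y

lemma IsDynSeparated.card_le {S : Y → Y} {ρ : ℝ} {M : ℕ} {E F : Finset Y}
    (hE : IsDynSeparated S ρ M E)
    (hF : IsDynCoverOf S univ {p : Y × Y | dist p.1 p.2 < ρ / 2} M (F : Set Y)) :
    E.card ≤ F.card := by
  have key : ∀ x, ∃ z ∈ F, ∀ k < M, dist (S^[k] x) (S^[k] z) < ρ / 2 := fun x => by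
    obtain ⟨z, hz, h⟩ := hF (mem_univ x)
    exact ⟨z, hz, fun k hk => mem_dynEntourage.1 h k hk⟩
  choose f hf h using key
  refine Finset.card_le_card_of_injOn f (fun x _ => hf x) fun x hx y hy hxy => ?_
  refine hE x hx y hy fun k hk => ?_
  have h1 := h x k hk
  have h2 := h y k hk
  rw [← hxy] at h2
  linarith [dist_triangle_right (S^[k] x) (S^[k] y) (S^[k] (f x))]

lemma exists_isDynSeparated [CompactSpace Y] {S : Y → Y} {h : ℝ}
    (hent : (h : EReal) < topEntropy S) :
    ∃ ρ > 0, ∀ᶠ M : ℕ in atTop, ∀ u : Y, ∃ E : Finset Y, u ∈ E ∧ IsDynSeparated S ρ M E ∧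
      Real.exp (M * h) ≤ E.card := by
  classical
  rw [topEntropy, ← coverEntropyInf_eq_coverEntropy S (mapsTo_univ _ _),
    coverEntropyInf_eq_iSup_basis Metric.uniformity_basis_dist] at hent
  obtain ⟨ρ, hent⟩ := lt_iSup_iff.1 hent
  obtain ⟨hρ, hent⟩ := lt_iSup_iff.1 hent
  refine ⟨ρ, hρ, (ExpGrowth.eventually_exp_le hent).mono fun M hM u => ?_⟩
  obtain ⟨F, hF⟩ := exists_isDynCoverOf_of_isCompact_invariant (T := S) isCompact_univ
    (mapsTo_univ _ _) (Metric.dist_mem_uniformity (half_pos hρ)) M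
  set A : Set (Finset Y) := {E | u ∈ E ∧ IsDynSeparated S ρ M E} with hA
  have hbdd : BddAbove (Finset.card '' A) := ⟨F.card, by
    rintro _ ⟨E, hE, rfl⟩
    exact hE.2.card_le hF⟩
  have hne : (Finset.card '' A).Nonempty := ⟨_, {u}, ⟨by simp, fun x hx y hy _ => by
    rw [Finset.mem_singleton.1 hx, Finset.mem_singleton.1 hy]⟩, rfl⟩
  obtain ⟨E, ⟨huE, hE⟩, hmax⟩ := Nat.sSup_mem hne hbdd
  refine ⟨E, huE, hE, ?_⟩
  have hcov : IsDynCoverOf S univ {p : Y × Y | dist p.1 p.2 < ρ} M (E : Set Y) := by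
    intro x _
    by_contra! hx
    have hx' : ∀ y ∈ E, ¬ ∀ k < M, dist (S^[k] x) (S^[k] y) < ρ := fun y hy h =>
      hx y hy (mem_dynEntourage.2 h)
    have hxE : x ∉ E := fun h => hx' x h fun k _ => by simpa using hρ
    have hmem : insert x E ∈ A := by
      refine ⟨Finset.mem_insert_of_mem huE, fun a ha b hb hab => ?_⟩
      rcases Finset.mem_insert.1 ha with rfl | haE <;> rcases Finset.mem_insert.1 hb with rfl | hbE
      · rfl
      · exact absurd hab (hx' b hbE)
      · exact absurd (fun k hk => by rw [dist_comm]; exact hab k hk) (hx' a haE)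
      · exact hE a haE b hbE hab
    have := le_csSup hbdd (mem_image_of_mem Finset.card hmem)
    rw [← hmax, Finset.card_insert_of_notMem hxE] at this
    omega
  have h1 := hM.trans (ENat.toENNReal_mono hcov.coverMincard_le_card)
  have h2 : (h : EReal) * (M : EReal) = ((M * h : ℝ) : EReal) := by
    rw [mul_comm]; push_cast; rfl
  rw [h2, EReal.exp_coe] at h1
  have h3 : ENNReal.ofReal (Real.exp (M * h)) ≤ ENNReal.ofReal (E.card : ℝ) := by
    simpa using h1
  exact (ENNReal.ofReal_le_ofReal_iff (by positivity)).1 h3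

end SeparatedSets

section EntropyEstimate

variable {ι : Type*} [Fintype ι] {p : ι → ℝ}

lemma weightEntropy_pi_pair_le (hp : ∀ i, 0 ≤ p i) {T β γ : Type*} [Fintype T]
    (V : T → ι → γ) (w : ι → β) (φ : ℝ)
    (h : ∀ t, weightEntropy p (fun i => (V t i, w i)) ≤ weightEntropy p w + φ) :
    weightEntropy p (fun i => (fun t => V t i, w i)) ≤
      weightEntropy p w + Fintype.card T * φ := by
  classical
  have key : ∀ s : Finset T, weightEntropy p (fun i => (fun t : s => V t i, w i)) ≤
      weightEntropy p w + s.card * φ := by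
    intro s
    induction s using Finset.induction_on with
    | empty =>
      rw [weightEntropy_congr hp _ w (fun i j => by simp [funext_iff])]
      simp
    | insert t s ht ih =>
      have h1 := weightEntropy_submodular hp (V t) (fun i => fun t : s => V t i) w
      rw [weightEntropy_congr hp (fun i => (V t i, (fun t : s => V t i), w i))
        (fun i => ((fun t : (insert t s : Finset T) => V t i), w i))
        (fun i j => by simp [funext_iff, and_assoc])] at h1
      rw [Finset.card_insert_of_notMem ht]
      push_cast
      linarith [h t]
  have h1 := key Finset.univ
  rwa [Finset.card_univ, weightEntropy_congr hp _ (fun i => (fun t => V t i, w i))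
    (fun i j => by simp [funext_iff])] at h1

/-- If `(m, v, c)` have a product law, `v` is almost determined by `w` at the times of `J m`,
and `c` is determined by `m` and `w` at the times of `C m`, then `w` carries the entropy of `v` on `J m`
and of `c` on `C m`. -/
theorem le_weightEntropy_of_determined (hp : ∀ i, 0 ≤ p i) (hp1 : ∑ i, p i = 1) {n : ℕ}
    {A α β E : Type*} [Fintype A] [Fintype α] [Nonempty α] [Fintype E] (m : ι → A)
    (v : ι → Fin n → α) (c : ι → Fin n → E) (w : ι → Fin n → β) {pm : A → ℝ}
    {pv : (Fin n → α) → ℝ} {pc : (Fin n → E) → ℝ}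
    (hpm : ∀ x, 0 ≤ pm x) (hpv : ∀ x, 0 ≤ pv x) (hpc : ∀ x, 0 ≤ pc x)
    (hpv1 : ∑ x, pv x = 1) (hpc1 : ∑ x, pc x = 1)
    (hlaw : ∀ x, fibreMass p (fun i => (m i, v i, c i)) x = pm x.1 * (pv x.2.1 * pc x.2.2))
    (J C : A → Finset (Fin n)) (a b : ℝ)
    (ha : ∀ J : Finset (Fin n), J.card * a ≤ weightEntropy pv (fun x => fun s : J => x s))
    (hb : ∀ C : Finset (Fin n), C.card * b ≤ weightEntropy pc (fun x => fun s : C => x s))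
    (hdet : ∀ i j, 0 < p i → 0 < p j → m i = m j → w i = w j → ∀ s ∈ C (m i), c i s = c j s)
    (guess : β → α) {θ η : ℝ} (hη : 0 < η) (hη1 : η < 1) (bad : Fin n → Finset ι)
    (hbad : ∀ t i, 0 < p i → i ∉ bad t → t ∈ J (m i) → v i t = guess (w i t))
    (hθ : ∀ t, ∑ i ∈ bad t, p i ≤ θ) :
    ∑ x, pm x * ((J x).card * a + (C x).card * b) ≤ weightEntropy p w +
      n * (-Real.log (1 - η) + θ * Real.log ((Fintype.card α + 1) / η)) := by
  classical
  set V : A → (Fin n → α) → Fin n → Option α := fun x y t => if t ∈ J x then some (y t) else none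
    with hV
  set D : A → (Fin n → E) → Fin n → Option E := fun x y t => if t ∈ C x then some (y t) else none
    with hD
  have hr0 : ∀ y : (Fin n → α) × (Fin n → E), 0 ≤ pv y.1 * pc y.2 :=
    fun y => mul_nonneg (hpv _) (hpc _)
  have hr1 : ∑ y : (Fin n → α) × (Fin n → E), pv y.1 * pc y.2 = 1 := by
    rw [Fintype.sum_prod_type]; simp [← Finset.mul_sum, hpc1, hpv1]
  have h1 : weightEntropy p (fun i => (m i, V (m i) (v i), D (m i) (c i))) =
      weightEntropy pm id + ∑ x, pm x * weightEntropy (fun y => pv y.1 * pc y.2)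
        (fun y : (Fin n → α) × (Fin n → E) => (V x y.1, D x y.2)) := by
    have e := weightEntropy_prod (p := pm) hpm hr0 hr1 id
      (fun x y => (V x y.1, D x y.2))
    simp only [id] at e
    have e' := weightEntropy_comp (p := p) (fun i => (m i, v i, c i))
      (fun x : A × (Fin n → α) × (Fin n → E) => (x.1, V x.1 x.2.1, D x.1 x.2.2))
    rw [funext hlaw] at e'
    exact e'.trans e
  have h2 : ∀ x, (J x).card * a + (C x).card * b ≤ weightEntropy (fun y => pv y.1 * pc y.2)
      (fun y : (Fin n → α) × (Fin n → E) => (V x y.1, D x y.2)) := by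
    intro x
    rw [weightEntropy_prod_map hpv hpc hpv1 hpc1 (V x) (D x)]
    refine add_le_add ((ha (J x)).trans ?_) ((hb (C x)).trans ?_)
    · refine weightEntropy_le_of_factor hpv _ _ fun y y' _ _ h => ?_
      ext ⟨t, ht⟩
      have := congrFun h t
      simpa [hV, ht] using this
    · refine weightEntropy_le_of_factor hpc _ _ fun y y' _ _ h => ?_
      ext ⟨t, ht⟩
      have := congrFun h t
      simpa [hD, ht] using this
  have h3 : weightEntropy p (fun i => (m i, V (m i) (v i), D (m i) (c i))) ≤
      weightEntropy p (fun i => (V (m i) (v i), m i, w i)) := by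
    refine weightEntropy_le_of_factor hp _ _ fun i j hi hj h => ?_
    simp only [Prod.mk.injEq] at h ⊢
    refine ⟨h.2.1, h.1, funext fun t => ?_⟩
    have := hdet i j hi hj h.2.1 h.2.2 t
    simp only [hD, ← h.2.1]
    split_ifs with ht
    · rw [this ht]
    · rfl
  have h4 : weightEntropy p (fun i => (V (m i) (v i), m i, w i)) ≤
      weightEntropy p (fun i => (m i, w i)) +
        n * (-Real.log (1 - η) + θ * Real.log ((Fintype.card α + 1) / η)) := by
    have := weightEntropy_pi_pair_le hp (fun (t : Fin n) i => V (m i) (v i) t)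
      (fun i => (m i, w i)) (-Real.log (1 - η) + θ * Real.log ((Fintype.card α + 1) / η))
      fun t => by
        have := weightEntropy_fano hp hp1 (fun i => V (m i) (v i) t) (fun i => (m i, w i))
          (fun x => if t ∈ J x.1 then some (guess (x.2 t)) else none) hη hη1 (bad t)
          (fun i hi hib => by
            simp only [hV]
            split_ifs with ht
            · rw [hbad t i hi hib ht]
            · rfl) (hθ t) (Fintype.card α + 1) (by simp) (by simp)
        linarith
    simpa using this
  have h5 := weightEntropy_pair_le hp hp1 m w
  have h6 : weightEntropy p m = weightEntropy pm id := by
    have := weightEntropy_comp (p := p) (fun i => (m i, v i, c i))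
      (fun x : A × (Fin n → α) × (Fin n → E) => x.1)
    rw [funext hlaw] at this
    refine Eq.trans this ?_
    have e := weightEntropy_prod (p := pm) hpm hr0 hr1 id
      (fun _ _ => ())
    simp only [weightEntropy_const hr1 (fun _ => ()) (fun _ _ => rfl), mul_zero,
      Finset.sum_const_zero, add_zero] at e
    rw [← e]
    exact weightEntropy_congr (fun x => mul_nonneg (hpm _) (mul_nonneg (hpv _) (hpc _))) _ _
      (by simp)
  have h7 : ∑ x, pm x * ((J x).card * a + (C x).card * b) ≤
      ∑ x, pm x * weightEntropy (fun y => pv y.1 * pc y.2)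
        (fun y : (Fin n → α) × (Fin n → E) => (V x y.1, D x y.2)) :=
    Finset.sum_le_sum fun x _ => mul_le_mul_of_nonneg_left (h2 x) (hpm x)
  linarith

end EntropyEstimate

section FollowingEntropy

/-- The last mark of `m` up to time `t` is at distance between `R` and `R + N` from `t`. -/
def FollowTime (R N : ℕ) (m : ℕ → Bool) (t : ℕ) : Prop :=
  ∃ s, s + R ≤ t ∧ t ≤ s + R + N ∧ m s = true ∧ ∀ i, s < i → i ≤ t → m i = false

lemma Follows.dist_le {Y E : Type*} [MetricSpace Y] {S : Y → Y} {ε : ℝ} {M g N : ℕ} {e : E → Y}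
    {y : Y} {m : ℕ → Bool} {c : ℕ → E} {z : Y} (h : Follows S ε M g N e y m c z) {t : ℕ}
    (ht : FollowTime (M + 2 * g) N m t) : dist (S^[t] z) (S^[t] y) ≤ ε := by
  obtain ⟨s, h1, h2, h3, h4⟩ := ht
  exact (h s ⟨h3, fun i hi hi' => h4 i hi (by omega)⟩).2 t h1 h2 h4

lemma followTime_congr {R N : ℕ} {m m' : ℕ → Bool} {t : ℕ} (h : ∀ i ≤ t, m i = m' i) :
    FollowTime R N m t ↔ FollowTime R N m' t := by
  refine exists_congr fun s => and_congr_right fun h1 => and_congr_right fun h2 => ?_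
  rw [h s (by omega)]
  refine and_congr_right fun _ => forall_congr' fun i => forall_congr' fun _ =>
    forall_congr' fun hi => ?_
  rw [h i hi]

lemma isolatedMark_congr {R : ℕ} {m m' : ℕ → Bool} {s : ℕ} (h : ∀ i ≤ s + R, m i = m' i) :
    IsolatedMark R m s ↔ IsolatedMark R m' s := by
  unfold IsolatedMark
  rw [h s (by omega)]
  refine and_congr_right fun _ => forall_congr' fun i => forall_congr' fun _ =>
    forall_congr' fun hi => ?_
  rw [h i hi]

/-- The first `n` terms of a sequence. -/
def initialName {A : Type*} (n : ℕ) (x : ℕ → A) : Fin n → A := fun i => x i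

lemma measurable_initialName {A : Type*} [MeasurableSpace A] (n : ℕ) :
    Measurable (initialName n : (ℕ → A) → Fin n → A) :=
  measurable_pi_lambda _ fun _ => measurable_pi_apply _

/-- Extension of a finite word by `false`. -/
def extendFalse {n : ℕ} (x : Fin n → Bool) (i : ℕ) : Bool := if h : i < n then x ⟨i, h⟩ else false

lemma extendFalse_initialName {n : ℕ} (m : ℕ → Bool) {i : ℕ} (hi : i < n) :
    extendFalse (initialName n m) i = m i := by
  simp [extendFalse, initialName, hi]

lemma fibreMass_measureReal {Ω ι α : Type*} [MeasurableSpace Ω] (κ : Measure Ω)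
    [IsFiniteMeasure κ] [Fintype ι] (F : Ω → ι) (hF : ∀ i, MeasurableSet (F ⁻¹' {i}))
    (f : ι → α) (a : α) :
    fibreMass (fun i => κ.real (F ⁻¹' {i})) f a = κ.real ((f ∘ F) ⁻¹' {a}) := by
  classical
  have e : (f ∘ F) ⁻¹' {a} = F ⁻¹' (Finset.univ.filter (fun i => f i = a) : Finset ι) := by
    ext; simp
  rw [e, ← sum_measureReal_preimage_singleton _ fun i _ => hF i, Finset.sum_filter]
  exact Finset.sum_congr rfl fun i _ => by congr

lemma mul_sub_mul_le_sum {n r : ℕ} (f : Fin n → ℝ) (hf : ∀ t, 0 ≤ f t) {α : ℝ} (hα : 0 ≤ α)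
    (B : Finset (Fin n)) (hB : B.card ≤ r) (h : ∀ t ∉ B, α ≤ f t) :
    n * α - r * α ≤ ∑ t, f t := by
  classical
  have h1 : ∑ t ∈ Bᶜ, f t ≤ ∑ t, f t :=
    Finset.sum_le_sum_of_subset_of_nonneg (Finset.subset_univ _) fun t _ _ => hf t
  have h2 : (Bᶜ.card : ℝ) * α ≤ ∑ t ∈ Bᶜ, f t := by
    rw [← nsmul_eq_mul]
    exact Finset.card_nsmul_le_sum _ _ _ fun t ht => h t (Finset.mem_compl.1 ht)
  have h3 : (n : ℝ) ≤ Bᶜ.card + r := by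
    have := Finset.card_compl_add_card B
    rw [Fintype.card_fin] at this
    exact_mod_cast this.symm.le.trans (by omega)
  nlinarith

lemma sum_measureReal_mul_card {Ω : Type*} [MeasurableSpace Ω] (κ : Measure Ω)
    [IsFiniteMeasure κ] {ι : Type*} [Fintype ι] {n : ℕ} (F : Ω → ι)
    (hF : ∀ i, MeasurableSet (F ⁻¹' {i})) (J : ι → Finset (Fin n)) :
    ∑ x, κ.real (F ⁻¹' {x}) * (J x).card = ∑ t, κ.real {ω | t ∈ J (F ω)} := by
  classical
  have h : ∀ x, κ.real (F ⁻¹' {x}) * (J x).card =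
      ∑ t, if t ∈ J x then κ.real (F ⁻¹' {x}) else 0 := by
    intro x
    rw [← Finset.sum_filter, Finset.sum_const, nsmul_eq_mul, mul_comm]
    simp
  simp only [h]
  rw [Finset.sum_comm]
  refine Finset.sum_congr rfl fun t _ => ?_
  rw [← Finset.sum_filter, sum_measureReal_preimage_singleton _ fun i _ => hF i]
  congr 1
  ext
  simp

variable {Y : Type*} [MetricSpace Y] [MeasurableSpace Y] {S : Y → Y}
  {E : Type*} [Fintype E] [MeasurableSpace E] [MeasurableSingletonClass E]

theorem le_entropyWrt_of_follows {W : Type*} [MeasurableSpace W] {κ : Measure W}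
    [IsProbabilityMeasure κ] {y z : W → Y} {m : W → ℕ → Bool} {c : W → ℕ → E}
    (hy : Measurable y) (hz : Measurable z) (hm : Measurable m) (hc : Measurable c)
    {pm : Measure (ℕ → Bool)} {ν : Measure Y} {pc : Measure (ℕ → E)} [IsProbabilityMeasure pm]
    [IsProbabilityMeasure ν] [IsProbabilityMeasure pc]
    (hlaw : κ.map (fun w => (m w, y w, c w)) = pm.prod (ν.prod pc))
    (hSν : MeasurePreserving S ν ν) (hSz : MeasurePreserving S (κ.map z) (κ.map z))
    {ε : ℝ} {M g N : ℕ} {e : E → Y}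
    (hfol : ∀ᵐ w ∂κ, Follows S ε M g N e (y w) (m w) (c w) (z w))
    (hsep : ∀ a b : E, (∀ j ≤ M, dist (S^[j] (e a)) (S^[j] (e b)) ≤ 3 * ε) → a = b)
    {k l : ℕ} [NeZero k] {P : Y → Fin k} (hP : Measurable P) {Q : Y → Fin l} (hQ : Measurable Q)
    (hQε : ∀ a b, Q a = Q b → dist a b ≤ ε) {G : Set Y} (hG : MeasurableSet G)
    (guess : Fin l → Fin k) (hguess : ∀ a ∈ G, ∀ b, dist b a ≤ ε → P a = guess (Q b))
    {θ η : ℝ} (hθ : ν.real Gᶜ ≤ θ) (hη : 0 < η) (hη1 : η < 1)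
    {α β a b : ℝ} (hα : 0 ≤ α) (hβ : 0 ≤ β) (ha : 0 ≤ a) (hb : 0 ≤ b)
    (hαm : ∀ t, M + 2 * g + N ≤ t → α ≤ pm.real {m | FollowTime (M + 2 * g) N m t})
    (hβm : ∀ s, β ≤ pm.real {m | IsolatedMark (M + 2 * g) m s})
    (hPa : a ≤ entropyWrt ν S P)
    (hcb : ∀ (n : ℕ) (C : Finset (Fin n)),
      C.card * b ≤ infoEntropy pc (fun c => fun s : C => initialName n c s)) :
    α * a + β * b - (-Real.log (1 - η) + θ * Real.log ((k + 1) / η)) ≤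
      entropyWrt (κ.map z) S Q := by
  classical
  set R := M + 2 * g with hR
  have : IsProbabilityMeasure (κ.map z) := Measure.isProbabilityMeasure_map hz.aemeasurable
  refine le_entropyWrt hSz hQ _ ((R + N : ℕ) * α * a + R * β * b) fun n => ?_
  set Fm : (ℕ → Bool) → Fin n → Bool := initialName n with hFm
  set Fv : Y → Fin n → Fin k := orbitName S P n with hFv
  set Fc : (ℕ → E) → Fin n → E := initialName n with hFc
  set Fw : Y → Fin n → Fin l := orbitName S Q n with hFw
  have mFm : Measurable Fm := measurable_initialName n
  have mFv : Measurable Fv := measurable_orbitName hSν.measurable hP n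
  have mFc : Measurable Fc := measurable_initialName n
  have mFw : Measurable Fw := measurable_orbitName hSν.measurable hQ n
  set F : W → (Fin n → Bool) × (Fin n → Fin k) × (Fin n → E) × (Fin n → Fin l) :=
    fun w => (Fm (m w), Fv (y w), Fc (c w), Fw (z w)) with hF
  have mF : Measurable F := (mFm.comp hm).prodMk ((mFv.comp hy).prodMk
    ((mFc.comp hc).prodMk (mFw.comp hz)))
  have hFs : ∀ i, MeasurableSet (F ⁻¹' {i}) := fun i => mF (measurableSet_singleton i)
  set p : (Fin n → Bool) × (Fin n → Fin k) × (Fin n → E) × (Fin n → Fin l) → ℝ :=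
    fun i => κ.real (F ⁻¹' {i}) with hp
  have hp1 : ∑ i, p i = 1 := by
    rw [hp, sum_measureReal_preimage_singleton _ fun i _ => hFs i]
    simp
  have hex : ∀ i, 0 < p i → ∃ w, F w = i ∧ Follows S ε M g N e (y w) (m w) (c w) (z w) := by
    intro i hi
    have h1 : κ (F ⁻¹' {i}) ≠ 0 := fun h => by simp [hp, Measure.real, h] at hi
    obtain ⟨w, hw1, hw2⟩ := ((frequently_ae_mem_iff.2 h1).and_eventually hfol).exists
    exact ⟨w, hw1, hw2⟩
  set J : (Fin n → Bool) → Finset (Fin n) :=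
    fun x => Finset.univ.filter fun t => FollowTime R N (extendFalse x) t with hJ
  set C : (Fin n → Bool) → Finset (Fin n) :=
    fun x => Finset.univ.filter fun s => s + R < n ∧ IsolatedMark R (extendFalse x) s with hC
  have memJ : ∀ (m : ℕ → Bool) t, t ∈ J (Fm m) ↔ FollowTime R N m t := fun m t => by
    simp only [hJ, Finset.mem_filter, Finset.mem_univ, true_and]
    exact followTime_congr fun i hi => extendFalse_initialName m (hi.trans_lt t.2)
  have memC : ∀ (m : ℕ → Bool) s, s ∈ C (Fm m) ↔ s + R < n ∧ IsolatedMark R m s := fun m s => by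
    simp only [hC, Finset.mem_filter, Finset.mem_univ, true_and]
    exact and_congr_right fun h =>
      isolatedMark_congr fun i hi => extendFalse_initialName m (hi.trans_lt h)
  have main := le_weightEntropy_of_determined (p := p) (fun _ => measureReal_nonneg) hp1
    (fun i => i.1) (fun i => i.2.1) (fun i => i.2.2.1) (fun i => i.2.2.2)
    (pm := fun x => pm.real (Fm ⁻¹' {x})) (pv := fun x => ν.real (Fv ⁻¹' {x}))
    (pc := fun x => pc.real (Fc ⁻¹' {x}))
    (fun _ => measureReal_nonneg) (fun _ => measureReal_nonneg) (fun _ => measureReal_nonneg)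
    (by rw [sum_measureReal_preimage_singleton _ fun i _ => mFv (measurableSet_singleton i)]; simp)
    (by rw [sum_measureReal_preimage_singleton _ fun i _ => mFc (measurableSet_singleton i)]; simp)
    (by
      rintro ⟨x1, x2, x3⟩
      rw [hp, fibreMass_measureReal κ F hFs]
      have e1 : ((fun i : (Fin n → Bool) × (Fin n → Fin k) × (Fin n → E) × (Fin n → Fin l) =>
          (i.1, i.2.1, i.2.2.1)) ∘ F) ⁻¹' {(x1, x2, x3)} = (fun w => (m w, y w, c w)) ⁻¹'
          ((Fm ⁻¹' {x1}) ×ˢ ((Fv ⁻¹' {x2}) ×ˢ (Fc ⁻¹' {x3}))) := by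
        ext w; simp [hF]
      rw [e1, ← map_measureReal_apply (hm.prodMk (hy.prodMk hc))
        ((mFm (measurableSet_singleton _)).prod ((mFv (measurableSet_singleton _)).prod
          (mFc (measurableSet_singleton _)))), hlaw, measureReal_prod_prod, measureReal_prod_prod])
    J C a b
    (fun J => (mul_le_mul_of_nonneg_left hPa (Nat.cast_nonneg _)).trans
      (card_mul_entropyWrt_le hSν hP J))
    (fun C => (hcb n C).trans_eq (infoEntropy_comp_eq_weightEntropy pc Fc
      (fun x => mFc (measurableSet_singleton x)) (fun x => fun s : C => x s)))
    (by
      intro i j hi hj h1 h2 s hs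
      obtain ⟨w, rfl, hw⟩ := hex i hi
      obtain ⟨w', rfl, hw'⟩ := hex j hj
      obtain ⟨hsn, hsw⟩ := (memC (m w) s).1 hs
      have hsw' := ((memC (m w') s).1 (h1 ▸ hs : s ∈ C (F w').1)).2
      refine hsep _ _ fun j hj => ?_
      have d1 := (hw s hsw).1 j hj
      have d2 := (hw' s hsw').1 j hj
      have d3 := hQε _ _ (congrFun h2 ⟨s + g + j, by omega⟩)
      simp only at d3
      have t1 := dist_triangle_left (S^[j] (e (c w s))) (S^[j] (e (c w' s))) (S^[s + g + j] (z w))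
      have t2 := dist_triangle (S^[s + g + j] (z w)) (S^[s + g + j] (z w')) (S^[j] (e (c w' s)))
      exact t1.trans (by linarith))
    guess hη hη1 (θ := θ)
    (fun t => Finset.univ.filter fun i => t ∈ J i.1 ∧ i.2.1 t ≠ guess (i.2.2.2 t))
    (fun t i _ hib ht => by
      by_contra hne
      exact hib (by simp [ht, hne]))
    (fun t => by
      rw [hp, sum_measureReal_preimage_singleton _ fun i _ => hFs i]
      have hGm : MeasurableSet (S^[(t : ℕ)] ⁻¹' Gᶜ) := hSν.measurable.iterate t hG.compl
      have hyν : κ.map y = ν := by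
        have := congrArg (fun μ => (μ.map Prod.snd).map Prod.fst) hlaw
        simp only [Measure.map_snd_prod, Measure.map_fst_prod, measure_univ, one_smul] at this
        rwa [Measure.map_map measurable_snd (hm.prodMk (hy.prodMk hc)),
          Measure.map_map measurable_fst (measurable_snd.comp (hm.prodMk (hy.prodMk hc)))] at this
      have e1 : κ.real (y ⁻¹' (S^[(t : ℕ)] ⁻¹' Gᶜ)) = ν.real Gᶜ := by
        rw [← map_measureReal_apply hy hGm, hyν, (hSν.iterate t).measureReal_preimage
          hG.compl.nullMeasurableSet]
      refine le_trans ?_ (e1.trans_le hθ)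
      refine ENNReal.toReal_mono (measure_ne_top _ _) (measure_mono_ae ?_)
      filter_upwards [hfol] with w hw hwb
      simp only [Finset.coe_filter, Finset.mem_univ, true_and] at hwb
      intro hwG
      exact hwb.2 (hguess _ hwG _ (hw.dist_le ((memJ (m w) t).1 hwb.1))))
  have hH : infoEntropy (κ.map z) (orbitName S Q n) = weightEntropy p (fun i => i.2.2.2) := by
    rw [infoEntropy_map κ hz _ fun x => mFw (measurableSet_singleton x)]
    exact infoEntropy_comp_eq_weightEntropy κ F hFs (fun i => i.2.2.2)
  have hFms := fun x => mFm (measurableSet_singleton x)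
  have hJsum : n * α - (R + N : ℕ) * α ≤ ∑ x, pm.real (Fm ⁻¹' {x}) * (J x).card := by
    rw [sum_measureReal_mul_card pm Fm hFms J]
    refine mul_sub_mul_le_sum _ (fun t => measureReal_nonneg) hα
      (Finset.univ.filter fun t : Fin n => (t : ℕ) < R + N) ?_ fun t ht => ?_
    · rw [← Finset.card_range (R + N)]
      exact Finset.card_le_card_of_injOn (fun t => (t : ℕ)) (fun t ht => by simpa using ht)
        fun _ _ _ _ h => Fin.ext h
    · simp only [memJ]
      exact hαm t (by simpa using ht)
  have hCsum : n * β - R * β ≤ ∑ x, pm.real (Fm ⁻¹' {x}) * (C x).card := by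
    rw [sum_measureReal_mul_card pm Fm hFms C]
    refine mul_sub_mul_le_sum _ (fun t => measureReal_nonneg) hβ
      (Finset.univ.filter fun t : Fin n => n ≤ t + R) ?_ fun t ht => ?_
    · rw [← Finset.card_range R]
      refine Finset.card_le_card_of_injOn (fun t => n - 1 - (t : ℕ)) (fun t ht => ?_)
        fun t _ t' _ h => Fin.ext ?_
      · have : n ≤ t + R := by simpa using ht
        have := t.2
        simp; omega
      · have := t.2
        have := t'.2
        simp only at h
        omega
    · have : (t : ℕ) + R < n := by simpa using ht
      simp only [memC, this, true_and]
      exact hβm t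
  have hsum : ∑ x, pm.real (Fm ⁻¹' {x}) * ((J x).card * a + (C x).card * b) =
      (∑ x, pm.real (Fm ⁻¹' {x}) * (J x).card) * a +
        (∑ x, pm.real (Fm ⁻¹' {x}) * (C x).card) * b := by
    rw [Finset.sum_mul, Finset.sum_mul, ← Finset.sum_add_distrib]
    exact Finset.sum_congr rfl fun x _ => by ring
  rw [hsum, ← hH, Fintype.card_fin] at main
  have e1 := mul_le_mul_of_nonneg_right hJsum ha
  have e2 := mul_le_mul_of_nonneg_right hCsum hb
  linarith

end FollowingEntropy

section BernoulliMarks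

lemma infinitePi_setOf_forall_mem {A κ : Type*} [MeasurableSpace A] (p : Measure A)
    [IsProbabilityMeasure p] [Fintype κ] {f : κ → ℕ} (hf : Function.Injective f) (t : κ → Set A)
    (ht : ∀ k, MeasurableSet (t k)) :
    Measure.infinitePi (fun _ : ℕ => p) {x | ∀ k, x (f k) ∈ t k} = ∏ k, p (t k) := by
  classical
  have e : {x : ℕ → A | ∀ k, x (f k) ∈ t k} =
      (↑(Finset.univ.map ⟨f, hf⟩) : Set ℕ).pi (Function.extend f t fun _ => univ) := by
    ext x
    simp [Set.mem_pi, hf.extend_apply]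
  rw [e, Measure.infinitePi_pi, Finset.prod_map]
  · simp [hf.extend_apply]
  · intro i hi
    obtain ⟨k, -, rfl⟩ := Finset.mem_map.1 hi
    simpa [hf.extend_apply] using ht k

/-- The uniform distribution on `E` has independent coordinates of entropy `log |E|`. -/
lemma infoEntropy_infinitePi_uniform {E : Type*} [Fintype E] [Nonempty E] [MeasurableSpace E]
    [MeasurableSingletonClass E] (p : Measure E) [IsProbabilityMeasure p]
    (hp : ∀ a, p.real {a} = (Fintype.card E : ℝ)⁻¹) (n : ℕ) (C : Finset (Fin n)) :
    C.card * Real.log (Fintype.card E) ≤ infoEntropy (Measure.infinitePi fun _ : ℕ => p)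
      (fun c => fun s : C => initialName n c s) := by
  classical
  have hr : (0 : ℝ) < Fintype.card E := by exact_mod_cast Fintype.card_pos
  have h : ∀ a : C → E, (Measure.infinitePi (fun _ : ℕ => p)
      ((fun c => fun s : C => initialName n c s) ⁻¹' {a})).toReal =
        (Fintype.card E : ℝ)⁻¹ ^ C.card := by
    intro a
    have e : (fun c : ℕ → E => fun s : C => initialName n c s) ⁻¹' {a} =
        {c | ∀ s : C, c ((s : Fin n) : ℕ) ∈ ({a s} : Set E)} := by
      ext c; simp [initialName, funext_iff]
    have hf : Function.Injective fun s : C => ((s : Fin n) : ℕ) :=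
      Fin.val_injective.comp Subtype.val_injective
    rw [e, infinitePi_setOf_forall_mem p hf _ fun _ => measurableSet_singleton _,
      ENNReal.toReal_prod]
    refine (Finset.prod_congr rfl fun s _ => hp (a s)).trans ?_
    simp
  unfold infoEntropy
  rw [Finset.sum_congr rfl fun a _ => by rw [h a], Finset.sum_const, Finset.card_univ,
    Fintype.card_fun, Fintype.card_coe, nsmul_eq_mul, Real.negMulLog, Real.log_pow, Real.log_inv,
    Nat.cast_pow, inv_pow]
  refine le_of_eq ?_
  field_simp

variable (p : Measure Bool) [IsProbabilityMeasure p]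

lemma measureReal_singleton_false : p.real {false} = 1 - p.real {true} := by
  rw [← probReal_compl_eq_one_sub (measurableSet_singleton _)]
  congr 1
  ext b; cases b <;> simp

lemma infinitePi_isolatedMark (R s : ℕ) :
    (Measure.infinitePi fun _ : ℕ => p).real {m | IsolatedMark R m s} =
      p.real {true} * (1 - p.real {true}) ^ R := by
  classical
  have e : {m : ℕ → Bool | IsolatedMark R m s} = {m | ∀ k : Fin (R + 1), m (s + k) ∈
      (Fin.cases {true} (fun _ => {false}) k : Set Bool)} := by
    ext m
    simp only [IsolatedMark, mem_ofPred_eq, Fin.forall_fin_succ, Fin.cases_zero, Fin.cases_succ,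
      Fin.val_zero, add_zero, mem_singleton_iff, Fin.val_succ]
    refine and_congr_right fun _ => ⟨fun h i => h _ (by omega) (by omega), fun h i h1 h2 => ?_⟩
    have := h ⟨i - s - 1, by omega⟩
    simpa [show s + (i - s - 1 + 1) = i by omega] using this
  rw [measureReal_def, e, infinitePi_setOf_forall_mem p (fun a b h => Fin.ext (by simpa using h)) _
    (fun k => MeasurableSet.of_discrete), ENNReal.toReal_prod, Fin.prod_univ_succ]
  simp [← measureReal_def, measureReal_singleton_false]

lemma infinitePi_unmarked (s n : ℕ) :
    (Measure.infinitePi fun _ : ℕ => p).real {m | ∀ i, s ≤ i → i < s + n → m i = false} =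
      (1 - p.real {true}) ^ n := by
  have e : {m : ℕ → Bool | ∀ i, s ≤ i → i < s + n → m i = false} =
      {m | ∀ k : Fin n, m (s + k) ∈ ({false} : Set Bool)} := by
    ext m
    refine ⟨fun h i => h _ (by omega) (by omega), fun h i h1 h2 => ?_⟩
    have := h ⟨i - s, by omega⟩
    simpa [show s + (i - s) = i by omega] using this
  rw [measureReal_def, e, infinitePi_setOf_forall_mem p (fun a b h => Fin.ext (by simpa using h)) _
    (fun k => measurableSet_singleton _), ENNReal.toReal_prod]
  simp [← measureReal_def, measureReal_singleton_false]

lemma infinitePi_mark (s : ℕ) :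
    (Measure.infinitePi fun _ : ℕ => p).real {m | m s = true} = p.real {true} := by
  have e : {m : ℕ → Bool | m s = true} = {m | IsolatedMark 0 m s} := by
    ext m
    exact ⟨fun h => ⟨h, fun i h1 h2 => by omega⟩, fun h => h.1⟩
  rw [e, infinitePi_isolatedMark, pow_zero, mul_one]

lemma le_infinitePi_isolatedMark (R s : ℕ) :
    p.real {true} * (1 - R * p.real {true}) ≤
      (Measure.infinitePi fun _ : ℕ => p).real {m | IsolatedMark R m s} := by
  rw [infinitePi_isolatedMark]
  have h1 : p.real {true} ≤ 1 := measureReal_le_one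
  have h := one_add_mul_le_pow (a := -p.real {true}) (by linarith) R
  have h0 : 0 ≤ p.real {true} := measureReal_nonneg
  refine mul_le_mul_of_nonneg_left ?_ h0
  rw [sub_eq_add_neg, sub_eq_add_neg]
  linarith

lemma exists_last_mark {m : ℕ → Bool} {i t : ℕ} (hi : m i = true) (hit : i ≤ t) :
    ∃ s, i ≤ s ∧ s ≤ t ∧ m s = true ∧ ∀ j, s < j → j ≤ t → m j = false := by
  obtain ⟨d, rfl⟩ := Nat.exists_eq_add_of_le hit
  induction d with
  | zero => exact ⟨i, le_rfl, by omega, hi, fun j h1 h2 => by omega⟩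
  | succ d ih =>
    cases hm : m (i + (d + 1)) with
    | true => exact ⟨_, by omega, le_rfl, hm, fun j h1 h2 => by omega⟩
    | false =>
      obtain ⟨s, h1, h2, h3, h4⟩ := ih (by omega)
      refine ⟨s, h1, by omega, h3, fun j h5 h6 => ?_⟩
      rcases Nat.lt_or_ge j (i + (d + 1)) with h | h
      · exact h4 j h5 (by omega)
      · rwa [show j = i + (d + 1) by omega]

lemma le_infinitePi_followTime (R N t : ℕ) (ht : R + N ≤ t) :
    1 - R * p.real {true} - (1 - p.real {true}) ^ N ≤
      (Measure.infinitePi fun _ : ℕ => p).real {m | FollowTime R N m t} := by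
  classical
  set P := Measure.infinitePi fun _ : ℕ => p
  have hsub : univ ⊆ {m : ℕ → Bool | FollowTime R N m t} ∪
      ((⋃ i ∈ Finset.Ioc (t - R) t, {m | m i = true}) ∪
        {m | ∀ i, t - R - N ≤ i → i < t - R - N + N → m i = false}) := by
    intro m _
    by_contra hc
    simp only [mem_union, mem_iUnion, not_or, not_exists, Finset.mem_Ioc, mem_ofPred_eq] at hc
    obtain ⟨h1, h2, h3⟩ := hc
    push Not at h3
    obtain ⟨i, hi1, hi2, hi3⟩ := h3
    obtain ⟨s, hs1, hs2, hs3, hs4⟩ := exists_last_mark (t := t) (by simpa using hi3) (by omega)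
    rcases Nat.lt_or_ge (t - R) s with h | h
    · exact h2 s ⟨h, hs2⟩ hs3
    · exact h1 ⟨s, by omega, by omega, hs3, hs4⟩
  have h1 : (1 : ℝ) ≤ P.real {m | FollowTime R N m t} +
      (R * p.real {true} + (1 - p.real {true}) ^ N) := by
    calc (1 : ℝ) = P.real univ := by simp
      _ ≤ _ := measureReal_mono hsub
      _ ≤ _ := measureReal_union_le _ _
      _ ≤ _ := by
        gcongr
        refine (measureReal_union_le _ _).trans ?_
        gcongr
        · refine (measureReal_biUnion_finset_le _ _).trans ?_
          rw [Finset.sum_congr rfl fun i _ => infinitePi_mark p i, Finset.sum_const, Nat.card_Ioc,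
            nsmul_eq_mul, Nat.sub_sub_self (by omega)]
        · rw [infinitePi_unmarked]
  linarith

end BernoulliMarks

section FollowingJoining

lemma continuous_seqShift {A : Type*} [TopologicalSpace A] :
    Continuous (seqShift : (ℕ → A) → ℕ → A) :=
  continuous_pi fun n => continuous_apply (n + 1)

variable {X Y E : Type*} [TopologicalSpace X] [TopologicalSpace.MetrizableSpace X] [CompactSpace X]
  [MeasurableSpace X] [BorelSpace X] [MetricSpace Y] [CompactSpace Y] [MeasurableSpace Y]
  [BorelSpace Y]

/-- An ergodic measure on `X × Y`, together with independent marks and choices, extends by a point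
which follows the marks and choices. -/
theorem exists_ergodic_follows [Finite E] [TopologicalSpace E] [DiscreteTopology E]
    [MeasurableSpace E] [BorelSpace E] {T : X → X} (hT : Continuous T) {S : Y ≃ₜ Y}
    {ξ : Measure (X × Y)} [IsProbabilityMeasure ξ] (hξ : Ergodic (Prod.map T S) ξ)
    (p : Measure Bool) [IsProbabilityMeasure p] (pE : Measure E) [IsProbabilityMeasure pE]
    {ε : ℝ} {L : ℕ → ℕ} (hL : IsGapFunction S.toEquiv ε L) {M N g : ℕ} (hg : L N ≤ g)
    (hMN : M ≤ N) (e : E → Y) :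
    ∃ κ : Measure ((((X × Y) × (ℕ → Bool)) × (ℕ → E)) × Y), IsProbabilityMeasure κ ∧
      κ.map Prod.fst = (ξ.prod (Measure.infinitePi fun _ : ℕ => p)).prod
        (Measure.infinitePi fun _ : ℕ => pE) ∧
      (∀ᵐ w ∂κ, Follows S ε M g N e w.1.1.1.2 w.1.1.2 w.1.2 w.2) ∧
      Ergodic (Prod.map (Prod.map (Prod.map (Prod.map T S) seqShift) seqShift) S) κ := by
  have herg := (hξ.prod_infinitePi p).prod_infinitePi pE
  have hcl : IsClosed {w : (((X × Y) × (ℕ → Bool)) × (ℕ → E)) × Y |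
      Follows S ε M g N e w.1.1.1.2 w.1.1.2 w.1.2 w.2} :=
    isClosed_follows S.continuous ε M g N e (by fun_prop) (by fun_prop) (by fun_prop) (by fun_prop)
  obtain ⟨κ, h1, h2, h3⟩ := exists_ergodic_lift
    (((hT.prodMap S.continuous).prodMap continuous_seqShift).prodMap
      continuous_seqShift) S.continuous
    ⟨(ξ.prod (Measure.infinitePi fun _ : ℕ => p)).prod (Measure.infinitePi fun _ : ℕ => pE),
      inferInstance⟩ herg hcl (fun w hw => Follows.seqShift hw)
    (fun ω => exists_follows hL hg hMN e ω.1.1.2 ω.1.2 ω.2)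
  exact ⟨κ, inferInstance, h1, (prob_compl_eq_zero_iff hcl.measurableSet).2 h2, h3⟩

lemma measurableSet_followTime (R N t : ℕ) :
    MeasurableSet {m : ℕ → Bool | FollowTime R N m t} := by
  have e : {m : ℕ → Bool | FollowTime R N m t} =
      initialName (t + 1) ⁻¹' {x | FollowTime R N (extendFalse x) t} := by
    ext m
    exact followTime_congr fun i hi => (extendFalse_initialName m (by omega)).symm
  rw [e]
  exact measurable_initialName _ MeasurableSet.of_discrete

lemma measureReal_dist_le_of_follows {W : Type*} [MeasurableSpace W] {κ : Measure W}
    [IsProbabilityMeasure κ] {S : Y → Y} {y z : W → Y} {m : W → ℕ → Bool}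
    {c : W → ℕ → E} (hy : Measurable y) (hz : Measurable z) (hm : Measurable m)
    {R : W → W} (hR : MeasurePreserving R κ κ) (hyR : ∀ w, y (R w) = S (y w))
    (hzR : ∀ w, z (R w) = S (z w)) {ε : ℝ} {M g N : ℕ} {e : E → Y}
    (hfol : ∀ᵐ w ∂κ, Follows S ε M g N e (y w) (m w) (c w) (z w)) (t : ℕ) :
    (κ.map m).real {m | FollowTime (M + 2 * g) N m t} ≤ κ.real {w | dist (z w) (y w) ≤ ε} := by
  have hyR' : ∀ n w, y (R^[n] w) = S^[n] (y w) := fun n =>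
    (Function.Semiconj.iterate_right (f := y) (ga := R) (gb := S) hyR n)
  have hzR' : ∀ n w, z (R^[n] w) = S^[n] (z w) := fun n =>
    (Function.Semiconj.iterate_right (f := z) (ga := R) (gb := S) hzR n)
  have hmeas : MeasurableSet {w | dist (z w) (y w) ≤ ε} :=
    measurableSet_le (hz.dist hy) measurable_const
  rw [← (hR.iterate t).measureReal_preimage hmeas.nullMeasurableSet,
    map_measureReal_apply hm (measurableSet_followTime _ _ _)]
  refine ENNReal.toReal_mono (measure_ne_top _ _) (measure_mono_ae ?_)
  filter_upwards [hfol] with w hw ht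
  change dist (z (R^[t] w)) (y (R^[t] w)) ≤ ε
  rw [hyR', hzR']
  exact hw.dist_le ht

lemma MeasureTheory.MeasurePreserving.map_of_semiconj {V W : Type*} [MeasurableSpace V]
    [MeasurableSpace W] {κ : Measure V} {f : V → V} (hf : MeasurePreserving f κ κ) {h : V → W}
    (hh : Measurable h) {f' : W → W} (hf' : Measurable f') (hs : Function.Semiconj h f f') :
    MeasurePreserving f' (κ.map h) (κ.map h) := by
  refine ⟨hf', ?_⟩
  rw [Measure.map_map hf' hh, ← hs.comp_eq, ← Measure.map_map hh hf.measurable, hf.map_eq]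

lemma exists_measure_uniform (E : Type*) [Fintype E] [Nonempty E] [MeasurableSpace E]
    [MeasurableSingletonClass E] : ∃ p : Measure E, IsProbabilityMeasure p ∧
      ∀ a, p.real {a} = (Fintype.card E : ℝ)⁻¹ :=
  ⟨(PMF.uniformOfFintype E).toMeasure, inferInstance, fun a => by
    rw [measureReal_def, PMF.toMeasure_apply_singleton _ _ (measurableSet_singleton _)]
    simp⟩

lemma exists_measure_bool {q : ℝ} (hq0 : 0 ≤ q) (hq1 : q ≤ 1) :
    ∃ p : Measure Bool, IsProbabilityMeasure p ∧ p.real {true} = q :=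
  ⟨ProbabilityTheory.bernoulliMeasure true false ⟨q, hq0, hq1⟩, inferInstance, by
    simp⟩

/-- An ergodic measure `ξ` on `X × Y` with `Y`-marginal `ν` is coupled with an ergodic measure
which is close to `ξ`, charges the neighbourhoods of the points of `e`, and whose entropy is
bounded from below in terms of that of `ν` and of the number of points of `e`. -/
theorem exists_joining_follows [Fintype E] [Nonempty E] {T : X → X} (hT : Continuous T) {S : Y ≃ₜ Y}
    {ξ : Measure (X × Y)} [IsProbabilityMeasure ξ] (hξ : Ergodic (Prod.map T S) ξ)
    {q : ℝ} (hq0 : 0 < q) (hq1 : q ≤ 1) {ε : ℝ} {L : ℕ → ℕ} (hL : IsGapFunction S.toEquiv ε L)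
    {M N g R : ℕ} (hR : R = M + 2 * g) (hg : L N ≤ g) (hMN : M ≤ N) (hRq : R * q < 1) {α : ℝ}
    (hα0 : 0 ≤ α) (hα : α ≤ 1 - R * q - (1 - q) ^ N) (e : E → Y) :
    ∃ χ : Measure ((X × Y) × Y), IsProbabilityMeasure χ ∧ χ.map Prod.fst = ξ ∧
      Ergodic (Prod.map T S) (χ.map fun w => (w.1.1, w.2)) ∧
      α ≤ χ.real {w | dist w.2 w.1.2 ≤ ε} ∧
      (∀ a, 0 < χ {w | dist w.2 (e a) ≤ ε}) ∧
      ((∀ a b : E, (∀ j ≤ M, dist (S^[j] (e a)) (S^[j] (e b)) ≤ 3 * ε) → a = b) →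
        ∀ {k l : ℕ} [NeZero k] {P : Y → Fin k} (_ : Measurable P) {Q : Y → Fin l}
        (_ : Measurable Q) (_ : ∀ a b, Q a = Q b → dist a b ≤ ε) {G : Set Y}
        (_ : MeasurableSet G) (guess : Fin l → Fin k)
        (_ : ∀ a ∈ G, ∀ b, dist b a ≤ ε → P a = guess (Q b))
        {θ η a : ℝ} (_ : (ξ.map Prod.snd).real Gᶜ ≤ θ) (_ : 0 < η) (_ : η < 1) (_ : 0 ≤ a)
        (_ : a ≤ entropyWrt (ξ.map Prod.snd) S P),
        α * a + q * (1 - R * q) * Real.log (Fintype.card E) -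
          (-Real.log (1 - η) + θ * Real.log ((k + 1) / η)) ≤
          entropyWrt (χ.map Prod.snd) S Q) := by
  let _ : TopologicalSpace E := ⊥
  have : DiscreteTopology E := ⟨rfl⟩
  let _ : MeasurableSpace E := ⊤
  have : BorelSpace E := ⟨borel_eq_top_of_discrete.symm⟩
  obtain ⟨p, hpm, hp⟩ := exists_measure_bool hq0.le hq1
  obtain ⟨pE, hpEm, hpE⟩ := exists_measure_uniform E
  set pm := Measure.infinitePi fun _ : ℕ => p with hpmdef
  set pc := Measure.infinitePi fun _ : ℕ => pE with hpcdef
  obtain ⟨κ, hκ, hfst, hfol, herg⟩ := exists_ergodic_follows hT hξ p pE hL hg hMN e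
  have hproj : Measurable fun w : (((X × Y) × (ℕ → Bool)) × (ℕ → E)) × Y => (w.1.1.1, w.2) := by
    fun_prop
  have hlaw : κ.map (fun w => (w.1.1.2, w.1.1.1.2, w.1.2)) =
      pm.prod ((ξ.map Prod.snd).prod pc) := by
    have : (fun w : (((X × Y) × (ℕ → Bool)) × (ℕ → E)) × Y => (w.1.1.2, w.1.1.1.2, w.1.2)) =
      (fun ω : ((X × Y) × (ℕ → Bool)) × (ℕ → E) => (ω.1.2, ω.1.1.2, ω.2)) ∘ Prod.fst := rfl
    rw [this, ← Measure.map_map (by fun_prop) measurable_fst, hfst]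
    have hs : MeasurePreserving Prod.snd ξ (ξ.map Prod.snd) := ⟨measurable_snd, rfl⟩
    have : IsProbabilityMeasure (ξ.map Prod.snd) :=
      Measure.isProbabilityMeasure_map measurable_snd.aemeasurable
    exact ((measurePreserving_prodAssoc pm (ξ.map Prod.snd) pc).comp
      ((((MeasurePreserving.id pm).prod hs).comp Measure.measurePreserving_swap).prod
        (MeasurePreserving.id pc))).map_eq
  have hlawm : κ.map (fun w => w.1.1.2) = pm := by
    have : (fun w : (((X × Y) × (ℕ → Bool)) × (ℕ → E)) × Y => w.1.1.2) =
      Prod.snd ∘ Prod.fst ∘ Prod.fst := rfl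
    rw [this, ← Measure.map_map (by fun_prop) (by fun_prop),
      ← Measure.map_map (by fun_prop) (by fun_prop), hfst, Measure.map_fst_prod,
      measure_univ, one_smul, Measure.map_snd_prod, measure_univ, one_smul]
  refine ⟨κ.map fun w => (w.1.1.1, w.2), Measure.isProbabilityMeasure_map hproj.aemeasurable,
    ?_, ?_, ?_, ?_, ?_⟩
  · rw [Measure.map_map (by fun_prop) hproj]
    have : (Prod.fst ∘ fun w : (((X × Y) × (ℕ → Bool)) × (ℕ → E)) × Y => (w.1.1.1, w.2)) =
      Prod.fst ∘ Prod.fst ∘ Prod.fst := rfl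
    rw [this, ← Measure.map_map (by fun_prop) (by fun_prop),
      ← Measure.map_map (by fun_prop) (by fun_prop), hfst, Measure.map_fst_prod,
      measure_univ, one_smul, Measure.map_fst_prod, measure_univ, one_smul]
  · rw [Measure.map_map (by fun_prop) hproj]
    refine MeasurePreserving.ergodic_of_ergodic_semiconj (g := (fun w : (X × Y) × Y =>
      (w.1.1, w.2)) ∘ fun w : (((X × Y) × (ℕ → Bool)) × (ℕ → E)) × Y => (w.1.1.1, w.2))
      ⟨by fun_prop, rfl⟩ herg (hT.measurable.prodMap S.continuous.measurable) fun w => rfl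
  · rw [map_measureReal_apply hproj (measurableSet_le (by fun_prop) measurable_const)]
    have h := measureReal_dist_le_of_follows (y := fun w => w.1.1.1.2) (z := fun w => w.2)
      (m := fun w => w.1.1.2) (by fun_prop) (by fun_prop) (by fun_prop) herg.toMeasurePreserving
      (fun w => rfl) (fun w => rfl) hfol (R + N)
    have h' := le_infinitePi_followTime p R N (R + N) le_rfl
    rw [hp] at h'
    rw [hlawm, ← hR] at h
    exact hα.trans (h'.trans h)
  · intro a
    rw [Measure.map_apply hproj (measurableSet_le (by fun_prop) measurable_const)]
    have hA : MeasurableSet ((univ ×ˢ {m | IsolatedMark R m 0}) ×ˢ {c | c 0 = a} :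
        Set (((X × Y) × (ℕ → Bool)) × (ℕ → E))) :=
      (MeasurableSet.univ.prod (isClopen_isolatedMark R 0).1.measurableSet).prod
        (measurableSet_eq_fun (measurable_pi_apply 0) measurable_const)
    have hI : 0 < pm {m | IsolatedMark R m 0} := by
      have := le_infinitePi_isolatedMark p R 0
      rw [hp] at this
      exact (ENNReal.toReal_pos_iff.1 ((mul_pos hq0 (by linarith)).trans_le this)).1
    have hc : 0 < pc {c | c 0 = a} := by
      have h : pc {c | c 0 = a} = pE {a} := by
        rw [← Measure.infinitePi_map_eval (fun _ : ℕ => pE) 0,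
          Measure.map_apply (measurable_pi_apply 0) (measurableSet_singleton a)]
        rfl
      have h' : 0 < pE.real {a} := by
        rw [hpE]
        exact inv_pos.2 (by exact_mod_cast Fintype.card_pos)
      rw [h]
      exact (ENNReal.toReal_pos_iff.1 h').1
    have hpos : 0 < κ (Prod.fst ⁻¹' ((univ ×ˢ {m | IsolatedMark R m 0}) ×ˢ {c | c 0 = a})) := by
      rw [← Measure.map_apply measurable_fst hA, hfst, Measure.prod_prod, Measure.prod_prod,
        measure_univ, one_mul]
      exact ENNReal.mul_pos hI.ne' hc.ne'
    rw [← (herg.toMeasurePreserving.iterate g).measure_preimage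
      (hproj (measurableSet_le (measurable_snd.dist measurable_const)
        measurable_const)).nullMeasurableSet]
    refine hpos.trans_le (measure_mono_ae ?_)
    filter_upwards [hfol] with w hw hw'
    obtain ⟨⟨-, h1⟩, h2⟩ := hw'
    have := (hw 0 (by rwa [← hR])).1 0 (Nat.zero_le _)
    rw [show w.1.2 0 = a from h2] at this
    have h3 : ((Prod.map (Prod.map (Prod.map (Prod.map T S) seqShift) seqShift) S)^[g] w).2 =
      S^[g] w.2 := by simp [Prod.map_iterate]
    change dist ((Prod.map (Prod.map (Prod.map (Prod.map T S) seqShift) seqShift) S)^[g] w).2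
      (e a) ≤ ε
    rw [h3]
    simpa using this
  · intro hsep k l _ P hP Q hQ hQε G hG guess hguess θ η a hθ hη hη1 ha hPa
    have hmap : (κ.map fun w => (w.1.1.1, w.2)).map Prod.snd = κ.map fun w => w.2 :=
      Measure.map_map (by fun_prop) hproj
    rw [hmap]
    have : IsProbabilityMeasure (ξ.map Prod.snd) :=
      Measure.isProbabilityMeasure_map measurable_snd.aemeasurable
    have hS := S.continuous.measurable
    have hSz : MeasurePreserving S (κ.map fun w => w.2) (κ.map fun w => w.2) :=
      herg.toMeasurePreserving.map_of_semiconj measurable_snd hS fun w => rfl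
    have hSν : MeasurePreserving S (ξ.map Prod.snd) (ξ.map Prod.snd) :=
      hξ.toMeasurePreserving.map_of_semiconj measurable_snd hS fun w => rfl
    have hαm : ∀ t, M + 2 * g + N ≤ t → α ≤ pm.real {m | FollowTime (M + 2 * g) N m t} := by
      intro t ht
      rw [← hR] at ht ⊢
      exact hα.trans (hp ▸ le_infinitePi_followTime p R N t ht)
    have hβm : ∀ s, q * (1 - R * q) ≤ pm.real {m | IsolatedMark (M + 2 * g) m s} := by
      intro s
      rw [← hR]
      exact hp ▸ le_infinitePi_isolatedMark p R s
    have hcb := infoEntropy_infinitePi_uniform pE hpE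
    exact le_entropyWrt_of_follows (κ := κ) (pm := pm) (pc := pc) (ν := ξ.map Prod.snd)
      (y := fun w => w.1.1.1.2) (z := fun w => w.2) (m := fun w => w.1.1.2) (c := fun w => w.1.2)
      (by fun_prop) (by fun_prop) (by fun_prop)
      (by fun_prop) hlaw hSν hSz hfol hsep hP hQ hQε hG guess hguess hθ hη hη1 hα0
      (mul_nonneg hq0.le (by linarith)) ha (Real.log_natCast_nonneg _) hαm hβm hPa hcb

end FollowingJoining

section Partitions

variable {Y : Type*} [MetricSpace Y] [CompactSpace Y] [MeasurableSpace Y] [BorelSpace Y]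

lemma exists_fine_partition {ε : ℝ} (hε : 0 < ε) :
    ∃ (l : ℕ) (Q : Y → Fin l), Measurable Q ∧ ∀ a b, Q a = Q b → dist a b ≤ ε := by
  classical
  obtain ⟨t, -, ht, hcov⟩ := finite_cover_balls_of_compact (isCompact_univ (X := Y)) (half_pos hε)
  have := ht.fintype
  let N : Y → t → Bool := fun y x => decide (dist y x < ε / 2)
  have hN : Measurable N := by
    refine measurable_pi_lambda _ fun x => measurable_to_bool ?_
    have : (fun y => N y x) ⁻¹' {true} = Metric.ball (x : Y) (ε / 2) := by
      ext y; simp [N]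
    rw [this]
    exact measurableSet_ball
  refine ⟨_, Fintype.equivFin (t → Bool) ∘ N, Measurable.of_discrete.comp hN, fun a b hab => ?_⟩
  obtain ⟨x, hx, hax⟩ := mem_iUnion₂.1 (hcov (mem_univ a))
  have h := congrFun ((Fintype.equivFin (t → Bool)).injective hab) ⟨x, hx⟩
  have ha : dist a x < ε / 2 := hax
  have hb : dist b x < ε / 2 := by simpa [N, ha] using h
  linarith [dist_triangle_right a b x]

lemma exists_separated_core (ν : Measure Y) [IsProbabilityMeasure ν] {k : ℕ} {P : Y → Fin k}
    (hP : Measurable P) {θ : ℝ} (hθ : 0 < θ) :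
    ∃ G : Set Y, MeasurableSet G ∧ ν.real Gᶜ ≤ θ ∧
      ∃ r > 0, ∀ a ∈ G, ∀ b ∈ G, dist a b < r → P a = P b := by
  have hk : 0 < k := by
    obtain ⟨y⟩ : Nonempty Y := nonempty_of_isProbabilityMeasure ν
    exact (P y).pos
  have hθk : 0 < θ / k := div_pos hθ (by exact_mod_cast hk)
  choose K hKP hK hν using fun i => (hP (measurableSet_singleton i)).exists_isCompact_sdiff_lt
    (measure_ne_top ν _) (ENNReal.ofReal_pos.2 hθk).ne'
  refine ⟨⋃ i, K i, MeasurableSet.iUnion fun i => (hK i).measurableSet, ?_, ?_⟩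
  · calc ν.real (⋃ i, K i)ᶜ ≤ ν.real (⋃ i ∈ Finset.univ, P ⁻¹' {i} \ K i) := by
          refine measureReal_mono (fun y hy => ?_) (measure_ne_top _ _)
          simp only [mem_compl_iff, mem_iUnion, not_exists] at hy
          exact mem_iUnion₂.2 ⟨P y, Finset.mem_univ _, rfl, hy _⟩
      _ ≤ ∑ i, ν.real (P ⁻¹' {i} \ K i) := measureReal_biUnion_finset_le _ _
      _ ≤ ∑ i : Fin k, θ / k := Finset.sum_le_sum fun i _ =>
          (ENNReal.toReal_le_of_le_ofReal hθk.le (hν i).le)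
      _ = θ := by
          rw [Finset.sum_const, Finset.card_fin, nsmul_eq_mul]
          field_simp
  · have hc : IsCompact (⋃ i, ⋃ j, ⋃ _ : i ≠ j, K i ×ˢ K j) :=
      isCompact_iUnion fun i => isCompact_iUnion fun j => isCompact_iUnion fun _ =>
        (hK i).prod (hK j)
    obtain ⟨r, hr, h⟩ := hc.exists_forall_le' (f := fun w => dist w.1 w.2)
      continuous_dist.continuousOn (a := 0) fun w hw => by
        simp only [mem_iUnion] at hw
        obtain ⟨i, j, hij, h1, h2⟩ := hw
        refine dist_pos.2 fun h => hij ?_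
        have e1 : P w.1 = i := hKP i h1
        have e2 : P w.2 = j := hKP j h2
        rw [← e1, ← e2, h]
    refine ⟨r, hr, fun a ha b hb hab => ?_⟩
    obtain ⟨i, hi⟩ := mem_iUnion.1 ha
    obtain ⟨j, hj⟩ := mem_iUnion.1 hb
    have e1 : P a = i := hKP i hi
    have e2 : P b = j := hKP j hj
    by_contra hne
    rw [e1, e2] at hne
    have := h (a, b) (mem_iUnion.2 ⟨i, mem_iUnion.2 ⟨j, mem_iUnion.2 ⟨hne, hi, hj⟩⟩⟩)
    linarith

lemma exists_guess {Y : Type*} [MetricSpace Y] {k l : ℕ} [NeZero k] (P : Y → Fin k) (Q : Y → Fin l)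
    {ε r : ℝ}
    (hQ : ∀ a b, Q a = Q b → dist a b ≤ ε) {G : Set Y}
    (hG : ∀ a ∈ G, ∀ b ∈ G, dist a b < r → P a = P b) (hr : 3 * ε < r) :
    ∃ guess : Fin l → Fin k, ∀ a ∈ G, ∀ b, dist b a ≤ ε → P a = guess (Q b) := by
  have : ∀ j : Fin l, ∃ i : Fin k, ∀ a ∈ G, ∀ b, dist b a ≤ ε → Q b = j → P a = i := by
    intro j
    by_cases hj : ∃ a ∈ G, ∃ b, dist b a ≤ ε ∧ Q b = j
    · obtain ⟨a', ha', b', hb', hbj'⟩ := hj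
      refine ⟨P a', fun a ha b hb hbj => hG a ha a' ha' ?_⟩
      have h1 := hQ b b' (hbj.trans hbj'.symm)
      have h2 := dist_triangle4 a b b' a'
      rw [dist_comm a b] at h2
      linarith
    · exact ⟨0, fun a ha b hb hbj => absurd ⟨a, ha, b, hb, hbj⟩ hj⟩
  choose guess h using this
  exact ⟨guess, fun a ha b hb => h _ a ha b hb rfl⟩

lemma exists_partition_entropyWrt_ge {Y : Type*} [MeasurableSpace Y] {S : Y → Y} {ν : Measure Y}
    [IsProbabilityMeasure ν] (hS : MeasurePreserving S ν ν) {h : ℝ} (hh : ENNReal.ofReal h ≤ ksEntropy ν S)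
    {η : ℝ}
    (hη : 0 < η) : ∃ (k : ℕ) (_ : NeZero k) (P : Y → Fin k), Measurable P ∧
      ∃ a, 0 ≤ a ∧ h - η ≤ a ∧ a ≤ entropyWrt ν S P := by
  rcases le_or_gt h 0 with h0 | h0
  · refine ⟨1, inferInstance, fun _ => 0, measurable_const, 0, le_rfl, by linarith, ?_⟩
    exact le_entropyWrt hS measurable_const 0 0 fun n => by
      simpa using infoEntropy_nonneg ν _
  · have h1 : ENNReal.ofReal (h - η) < ksEntropy ν S :=
      ((ENNReal.ofReal_lt_ofReal_iff h0).2 (by linarith)).trans_le hh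
    unfold ksEntropy at h1
    simp only [lt_iSup_iff] at h1
    obtain ⟨k, P, hP, hlt⟩ := h1
    obtain ⟨y⟩ : Nonempty Y := nonempty_of_isProbabilityMeasure ν
    refine ⟨k, ⟨(P y).pos.ne'⟩, P, hP, _, ?_, ?_, le_rfl⟩
    · exact (ENNReal.ofReal_pos.1 (pos_of_gt hlt)).le
    · exact ((ENNReal.ofReal_lt_ofReal_iff (ENNReal.ofReal_pos.1 (pos_of_gt hlt))).1 hlt).le

lemma ofReal_entropyWrt_le_ksEntropy {Y : Type*} [MeasurableSpace Y] (ν : Measure Y) (S : Y → Y)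
    {k : ℕ} {P : Y → Fin k} (hP : Measurable P) :
    ENNReal.ofReal (entropyWrt ν S P) ≤ ksEntropy ν S :=
  le_iSup_of_le k (le_iSup_of_le P (le_iSup_of_le hP le_rfl))

end Partitions

section Parameters

lemma entropy_balance {h h' d τ a c F η x : ℝ} (hh : 0 ≤ h) (hd : 0 < d) (hd1 : d ≤ 1 / 4)
    (hhh : h < h') (hdh : d * h' ≤ (h' - h) / 8) (hτ : 0 ≤ τ) (hτ1 : τ ≤ 1)
    (hτh : τ * h ≤ (h' - h) / 8) (hη : η ≤ d * (h' - h) / 8) (ha : h - η ≤ a)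
    (hη0 : 0 ≤ η) (hx : 1 - c ≤ x) (hc0 : 0 ≤ c) (hc : c * h' ≤ (h' - h) / 8)
    (hF : F ≤ d * (h' - h) / 8) :
    h ≤ (1 - d - d * τ) * a + d * (1 - d) * (x * h') - F := by
  have h1 : (1 - d - d * τ) * (h - η) ≤ (1 - d - d * τ) * a :=
    mul_le_mul_of_nonneg_left ha (by nlinarith)
  have h2 : (1 - d - d * τ) * η ≤ η := by nlinarith [mul_nonneg hd.le hτ]
  have h3 : d * ((1 - d) * ((1 - c) * h')) ≤ d * ((1 - d) * (x * h')) := by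
    have : 0 ≤ h' := by linarith
    have : 0 ≤ 1 - d := by linarith
    gcongr
  have h4 : d * (h' - (h' - h) / 4) ≤ d * ((1 - d) * ((1 - c) * h')) := by
    refine mul_le_mul_of_nonneg_left ?_ hd.le
    nlinarith [mul_nonneg (mul_nonneg hd.le hc0) (hh.trans hhh.le)]
  have h5 : d * (τ * h) ≤ d * ((h' - h) / 8) := mul_le_mul_of_nonneg_left hτh hd.le
  nlinarith [mul_pos hd (sub_pos.2 hhh)]

lemma exists_nat_exp_neg_mul_le {a b : ℝ} (ha : 0 < a) (hb : 0 < b) :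
    ∃ n : ℕ, 1 ≤ n ∧ Real.exp (-(a * n)) ≤ b := by
  have h : Tendsto (fun n : ℕ => Real.exp (-(a * n))) atTop (nhds 0) :=
    Real.tendsto_exp_neg_atTop_nhds_zero.comp
      (tendsto_natCast_atTop_atTop.const_mul_atTop ha)
  obtain ⟨n, h1, h2⟩ := ((eventually_ge_atTop 1).and (h.eventually_le_const hb)).exists
  exact ⟨n, h1, h2⟩

/-- The error term of the entropy bound can be made small. -/
lemma exists_fano_le (k : ℕ) {b : ℝ} (hb : 0 < b) : ∃ η θ : ℝ, 0 < η ∧ η < 1 ∧ 0 < θ ∧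
    -Real.log (1 - η) + θ * Real.log ((k + 1) / η) ≤ b := by
  have h : Tendsto (fun η : ℝ => -Real.log (1 - η)) (nhdsWithin 0 (Ioi 0)) (nhds 0) := by
    have : ContinuousAt (fun η : ℝ => -Real.log (1 - η)) 0 :=
      ((continuousAt_const.sub continuousAt_id).log (by norm_num)).neg
    simpa using this.tendsto.mono_left nhdsWithin_le_nhds
  obtain ⟨η, ⟨h1, h2⟩, h3⟩ := ((h.eventually_le_const (half_pos hb)).and
    (Ioo_mem_nhdsGT (zero_lt_one' ℝ)) |>.and self_mem_nhdsWithin).exists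
  set D := Real.log ((k + 1) / η)
  refine ⟨η, b / 2 / (|D| + 1), h2.1, h2.2, by positivity, ?_⟩
  have : b / 2 / (|D| + 1) * D ≤ b / 2 := by
    rw [div_mul_eq_mul_div, div_le_iff₀ (by positivity)]
    have := le_abs_self D
    nlinarith
  linarith

end Parameters

section NearbyJoining

variable {X Y : Type*} [TopologicalSpace X] [TopologicalSpace.MetrizableSpace X] [CompactSpace X]
  [MeasurableSpace X] [BorelSpace X] [MetricSpace Y] [CompactSpace Y] [MeasurableSpace Y]
  [BorelSpace Y]

set_option maxHeartbeats 1000000 in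
/-- An ergodic measure on `X × Y` can be moved by an arbitrarily small amount in the `Y`-direction
so as to charge a given open set, without its `Y`-marginal losing more entropy than is allowed. -/
theorem exists_near_joining_charging {T : X → X} (hT : Continuous T) {S : Y ≃ₜ Y}
    (hspec : AlmostWeakSpec S.toEquiv) {ξ : Measure (X × Y)} [IsProbabilityMeasure ξ]
    (hξ : Ergodic (Prod.map T S) ξ) {h : ℝ≥0∞} (hent : (h : EReal) < topEntropy S)
    (hle : h ≤ ksEntropy (ξ.map Prod.snd) S) {U : Set Y} (hU : IsOpen U) (hUne : U.Nonempty)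
    {δ : ℝ} (hδ : 0 < δ) :
    ∃ χ : Measure ((X × Y) × Y), IsProbabilityMeasure χ ∧ χ.map Prod.fst = ξ ∧
      Ergodic (Prod.map T S) (χ.map fun w => (w.1.1, w.2)) ∧
      χ.real {w | δ < dist w.2 w.1.2} ≤ δ ∧ 0 < χ (Prod.snd ⁻¹' U) ∧
      h ≤ ksEntropy (χ.map Prod.snd) S := by
  classical
  have hνp : IsProbabilityMeasure (ξ.map Prod.snd) :=
    Measure.isProbabilityMeasure_map measurable_snd.aemeasurable
  have hSν : MeasurePreserving S (ξ.map Prod.snd) (ξ.map Prod.snd) :=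
    hξ.toMeasurePreserving.map_of_semiconj measurable_snd S.continuous.measurable fun w => rfl
  obtain ⟨h', hh', hent'⟩ := EReal.lt_iff_exists_real_btwn.1 hent
  have htop : h ≠ ⊤ := by
    rintro rfl
    simp at hh'
  obtain ⟨hr, hr0, rfl⟩ : ∃ r : ℝ, 0 ≤ r ∧ h = ENNReal.ofReal r :=
    ⟨h.toReal, ENNReal.toReal_nonneg, (ENNReal.ofReal_toReal htop).symm⟩
  have hlt : hr < h' := by
    rw [EReal.coe_ennreal_ofReal, max_eq_left hr0] at hh'
    exact EReal.coe_lt_coe_iff.1 hh'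
  have hh0 : 0 < h' := hr0.trans_lt hlt
  have hγ : 0 < h' - hr := sub_pos.2 hlt
  obtain ⟨d, hd, hd1, hdδ, hdh⟩ : ∃ d : ℝ, 0 < d ∧ d ≤ 1 / 4 ∧ 2 * d ≤ δ ∧
      d * h' ≤ (h' - hr) / 8 := by
    refine ⟨min (1 / 4) (min (δ / 2) ((h' - hr) / 8 / h')), by positivity, min_le_left _ _, ?_, ?_⟩
    · have := (min_le_right (1 / 4) (min (δ / 2) ((h' - hr) / 8 / h'))).trans (min_le_left _ _)
      linarith
    · exact (le_div_iff₀ hh0).1 ((min_le_right _ _).trans (min_le_right _ _))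
  obtain ⟨τ, hτ, hτ1, hτh⟩ : ∃ τ : ℝ, 0 < τ ∧ τ ≤ 1 ∧ τ * hr ≤ (h' - hr) / 8 := by
    refine ⟨min 1 ((h' - hr) / 8 / (hr + 1)), by positivity, min_le_left _ _, ?_⟩
    have h1 := (le_div_iff₀ (by positivity : 0 < hr + 1)).1
      (min_le_right 1 ((h' - hr) / 8 / (hr + 1)))
    refine le_trans ?_ h1
    gcongr
    linarith
  obtain ⟨c, hc, hc1, hch⟩ : ∃ c : ℝ, 0 < c ∧ c ≤ 1 ∧ c * h' ≤ (h' - hr) / 8 :=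
    ⟨min 1 ((h' - hr) / 8 / h'), by positivity, min_le_left _ _,
      (le_div_iff₀ hh0).1 (min_le_right _ _)⟩
  obtain ⟨n₀, hn₀, hexp⟩ := exists_nat_exp_neg_mul_le (half_pos hd) (mul_pos hd hτ)
  obtain ⟨k, hk, P, hP, a, ha0, ha, haP⟩ := exists_partition_entropyWrt_ge hSν hle
    (show 0 < d * (h' - hr) / 8 by positivity)
  obtain ⟨η, θ, hη, hη1, hθ, hF⟩ := exists_fano_le k (show 0 < d * (h' - hr) / 8 by positivity)
  obtain ⟨G, hGm, hGθ, r, hr', hG⟩ := exists_separated_core (ξ.map Prod.snd) hP hθ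
  obtain ⟨ρ, hρ, hsep⟩ := exists_isDynSeparated hent'
  obtain ⟨u, hu⟩ := hUne
  obtain ⟨ε₀, hε₀, hball⟩ := Metric.isOpen_iff.1 hU u hu
  obtain ⟨ε, hε, hεr, hερ, hεε, hεδ⟩ : ∃ ε : ℝ, 0 < ε ∧ 3 * ε < r ∧ 3 * ε < ρ ∧ ε < ε₀ ∧
      ε ≤ δ := by
    refine ⟨min (min (r / 4) (ρ / 4)) (min (ε₀ / 2) δ), by positivity, ?_⟩
    have h1 := min_le_left (min (r / 4) (ρ / 4)) (min (ε₀ / 2) δ)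
    have h2 := min_le_right (min (r / 4) (ρ / 4)) (min (ε₀ / 2) δ)
    have h3 := min_le_left (r / 4) (ρ / 4)
    have h4 := min_le_right (r / 4) (ρ / 4)
    have h5 := min_le_left (ε₀ / 2) δ
    have h6 := min_le_right (ε₀ / 2) δ
    refine ⟨?_, ?_, ?_, ?_⟩ <;> linarith
  obtain ⟨l, Q, hQ, hQε⟩ := exists_fine_partition (Y := Y) hε
  obtain ⟨guess, hguess⟩ := exists_guess P Q hQε hG hεr
  obtain ⟨L, hL, hLlim⟩ := hspec ε hε
  have hn₀' : (0 : ℝ) < n₀ := by exact_mod_cast hn₀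
  have hgap : ∀ᶠ M : ℕ in atTop, (L (n₀ * M) : ℝ) / (n₀ * M : ℕ) ≤ c / 2 / n₀ :=
    (hLlim.comp (tendsto_id.const_mul_atTop' (by omega : 0 < n₀))).eventually_le_const
      (by positivity)
  obtain ⟨M, hM, hg, hE⟩ := ((eventually_ge_atTop 1).and (hgap.and hsep)).exists
  obtain ⟨E, huE, hEsep, hcard⟩ := hE u
  have hM0 : (0 : ℝ) < M := by exact_mod_cast hM
  obtain ⟨R, hR⟩ : ∃ R, R = M + 2 * L (n₀ * M) := ⟨_, rfl⟩
  have hRr : (R : ℝ) ≤ (1 + c) * M := by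
    have h1 : (L (n₀ * M) : ℝ) ≤ c / 2 / n₀ * (n₀ * M : ℕ) :=
      (div_le_iff₀ (by positivity)).1 hg
    have h2 : c / 2 / n₀ * (n₀ * M : ℕ) = c / 2 * M := by
      push_cast
      field_simp
    rw [hR]
    push_cast
    linarith
  have hR1 : (1 : ℝ) ≤ R := by exact_mod_cast (by omega : 1 ≤ R)
  have hR0 : (0 : ℝ) < R := by linarith
  have hRq : R * (d / R) = d := by field_simp
  have hq1 : d / R ≤ 1 := (div_le_one hR0).2 (by linarith)
  have hpow : (1 - d / R) ^ (n₀ * M) ≤ d * τ := by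
    refine le_trans ?_ hexp
    refine (pow_le_pow_left₀ (by linarith) (Real.one_sub_le_exp_neg (d / R)) _).trans ?_
    rw [← Real.exp_nat_mul, Real.exp_le_exp]
    have h1 : d / 2 ≤ d / R * M := by
      have hR2 : (R : ℝ) ≤ 2 * M := hRr.trans (by gcongr; linarith)
      rw [div_mul_eq_mul_div, div_le_div_iff₀ two_pos hR0]
      nlinarith
    push_cast
    nlinarith
  have : Nonempty {x // x ∈ E} := ⟨⟨u, huE⟩⟩
  have hα0 : 0 ≤ 1 - d - d * τ := by nlinarith
  obtain ⟨χ, hχ, h1, h2, h3, h4, h5⟩ := exists_joining_follows hT hξ (div_pos hd hR0) hq1 hL hR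
    le_rfl (Nat.le_mul_of_pos_left M hn₀) (by rw [hRq]; linarith) hα0
    (by rw [hRq]; linarith) (fun x : {x // x ∈ E} => (x : Y))
  refine ⟨χ, hχ, h1, h2, ?_, ?_, ?_⟩
  · have e : {w : (X × Y) × Y | δ < dist w.2 w.1.2} = {w | dist w.2 w.1.2 ≤ δ}ᶜ := by
      ext w; simp
    rw [e, probReal_compl_eq_one_sub (measurableSet_le (by fun_prop) measurable_const)]
    have h6 : χ.real {w | dist w.2 w.1.2 ≤ ε} ≤ χ.real {w | dist w.2 w.1.2 ≤ δ} :=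
      measureReal_mono (fun w hw => le_trans hw hεδ)
    have h7 : d * τ ≤ d := mul_le_of_le_one_right hd.le hτ1
    linarith
  · refine (h4 ⟨u, huE⟩).trans_le (measure_mono fun w hw => hball ?_)
    exact lt_of_le_of_lt hw hεε
  · refine le_trans (ENNReal.ofReal_le_ofReal ?_) (ofReal_entropyWrt_le_ksEntropy _ _ hQ)
    refine le_trans ?_ (h5 (fun a b hab => Subtype.ext (hEsep _ a.2 _ b.2 fun j hj =>
      (hab j hj.le).trans_lt hερ)) hP hQ hQε hGm guess hguess hGθ hη hη1 ha0 haP)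
    have hlog : M * h' ≤ Real.log (Fintype.card {x // x ∈ E}) := by
      rw [Fintype.card_coe, Real.le_log_iff_exp_le (by
        exact_mod_cast Finset.card_pos.2 ⟨u, huE⟩)]
      exact hcard
    have hx : 1 - c ≤ M / R := by
      rw [le_div_iff₀ hR0]
      have := mul_le_mul_of_nonneg_left hRr (sub_nonneg.2 hc1)
      nlinarith [mul_pos (mul_pos hc hc) hM0]
    have h6 := entropy_balance hr0 hd hd1 hlt hdh hτ.le hτ1 hτh le_rfl ha (by positivity) hx hc.le
      hch hF
    have h7 : d * (1 - d) * (M / R * h') ≤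
        d / R * (1 - R * (d / R)) * Real.log (Fintype.card {x // x ∈ E}) := by
      rw [hRq]
      calc d * (1 - d) * (M / R * h') = d / R * (1 - d) * (M * h') := by ring
        _ ≤ _ := mul_le_mul_of_nonneg_left hlog
          (mul_nonneg (div_pos hd hR0).le (by linarith))
    linarith

end NearbyJoining

section Residual

/-- The probability measures charging a given open set form a weakly open set. -/
lemma isOpen_setOf_measure_pos {Ω : Type*} [MeasurableSpace Ω] [TopologicalSpace Ω]
    [OpensMeasurableSpace Ω] [HasOuterApproxClosed Ω] {O : Set Ω} (hO : IsOpen O) :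
    IsOpen {ξ : ProbabilityMeasure Ω | 0 < (ξ : Measure Ω) O} := by
  refine isOpen_iff_mem_nhds.2 fun ξ hξ => ?_
  exact eventually_lt_of_lt_liminf (lt_of_lt_of_le hξ
    (ProbabilityMeasure.le_liminf_measure_open_of_tendsto (μs := id) (L := nhds ξ)
      tendsto_id hO))

/-- Two measures with a coupling that is close to the diagonal give close integrals to a bounded
Lipschitz function. -/
lemma abs_integral_map_sub_le {X Y : Type*} [MetricSpace X] [SecondCountableTopology X]
    [MeasurableSpace X] [BorelSpace X] [MetricSpace Y] [SecondCountableTopology Y]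
    [MeasurableSpace Y] [BorelSpace Y] (χ : Measure ((X × Y) × Y)) [IsProbabilityMeasure χ]
    {δ : ℝ} (hδ : 0 ≤ δ) (hχ : χ.real {w | δ < dist w.2 w.1.2} ≤ δ) {f : X × Y → ℝ} {C : ℝ}
    (hC : ∀ x y, dist (f x) (f y) ≤ C) {L : NNReal} (hf : LipschitzWith L f) :
    |∫ p, f p ∂(χ.map fun w => (w.1.1, w.2)) - ∫ p, f p ∂(χ.map Prod.fst)| ≤ (L + C) * δ := by
  have hfm := hf.continuous.measurable
  have hm : Measurable fun w : (X × Y) × Y => (w.1.1, w.2) := by fun_prop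
  rw [integral_map hm.aemeasurable hfm.aestronglyMeasurable,
    integral_map measurable_fst.aemeasurable hfm.aestronglyMeasurable]
  obtain ⟨w₀⟩ : Nonempty ((X × Y) × Y) := nonempty_of_isProbabilityMeasure χ
  have hC0 : 0 ≤ C := dist_nonneg.trans (hC w₀.1 w₀.1)
  have hfint : ∀ g : (X × Y) × Y → X × Y, Measurable g → Integrable (fun w => f (g w)) χ := by
    intro g hg
    refine Integrable.of_bound (hfm.comp hg).aestronglyMeasurable (|f w₀.1| + C)
      (Eventually.of_forall fun w => ?_)
    have h1 := hC (g w) w₀.1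
    rw [Real.dist_eq] at h1
    rw [Real.norm_eq_abs]
    have h2 := abs_sub_abs_le_abs_sub (f (g w)) (f w₀.1)
    linarith
  have hB : MeasurableSet {w : (X × Y) × Y | δ < dist w.2 w.1.2} :=
    measurableSet_lt measurable_const (by fun_prop)
  rw [← integral_sub (hfint _ hm) (hfint _ measurable_fst), ← Real.norm_eq_abs]
  have hbound : ∀ w : (X × Y) × Y, ‖f (w.1.1, w.2) - f w.1‖ ≤
      L * δ + {w : (X × Y) × Y | δ < dist w.2 w.1.2}.indicator (fun _ => C) w := by
    intro w
    rw [← dist_eq_norm]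
    by_cases hw : δ < dist w.2 w.1.2
    · rw [indicator_of_mem (by exact hw)]
      have := hC (w.1.1, w.2) w.1
      have : 0 ≤ L * δ := by positivity
      linarith
    · rw [indicator_of_notMem (by exact hw), add_zero]
      refine (hf.dist_le_mul _ _).trans ?_
      have : dist (w.1.1, w.2) w.1 = dist w.2 w.1.2 := by
        rw [Prod.dist_eq]
        simp
      rw [this]
      gcongr
      exact not_lt.1 hw
  refine (norm_integral_le_of_norm_le ((integrable_const _).add
    ((integrable_const C).indicator hB)) (Eventually.of_forall hbound)).trans ?_
  rw [integral_add' (integrable_const _) ((integrable_const C).indicator hB),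
    integral_indicator_const _ hB]
  simp only [integral_const, probReal_univ, smul_eq_mul, one_mul]
  nlinarith

/-- Couplings converging to the diagonal give weak convergence. -/
lemma tendsto_of_coupling {X Y : Type*} [MetricSpace X] [SecondCountableTopology X]
    [MeasurableSpace X] [BorelSpace X] [MetricSpace Y] [SecondCountableTopology Y]
    [MeasurableSpace Y] [BorelSpace Y] {ξ : ProbabilityMeasure (X × Y)}
    {ζ : ℕ → ProbabilityMeasure (X × Y)} {χ : ℕ → Measure ((X × Y) × Y)}
    (hP : ∀ j, IsProbabilityMeasure (χ j)) (hfst : ∀ j, (χ j).map Prod.fst = ξ)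
    (hζ : ∀ j, (ζ j : Measure (X × Y)) = (χ j).map fun w => (w.1.1, w.2)) {δ : ℕ → ℝ}
    (hδ : ∀ j, 0 ≤ δ j) (hlim : Tendsto δ atTop (nhds 0))
    (hχ : ∀ j, (χ j).real {w | δ j < dist w.2 w.1.2} ≤ δ j) :
    Tendsto ζ atTop (nhds ξ) := by
  rw [tendsto_iff_forall_lipschitz_integral_tendsto]
  rintro f ⟨C, hC⟩ ⟨L, hL⟩
  refine tendsto_iff_dist_tendsto_zero.2 (squeeze_zero (fun _ => dist_nonneg) (fun j => ?_)
    (by simpa using hlim.const_mul (L + C)))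
  have := hP j
  rw [Real.dist_eq, hζ j, ← hfst j]
  exact abs_integral_map_sub_le (χ j) (hδ j) (hχ j) hC hL

/-- Ergodic joinings of large entropy are limits of such joinings whose `Y`-marginal charges a
prescribed non-empty open set. -/
lemma mem_closure_joinings_charging {X Y : Type*} [TopologicalSpace X]
    [TopologicalSpace.MetrizableSpace X] [CompactSpace X] [MeasurableSpace X] [BorelSpace X]
    [MetricSpace Y] [CompactSpace Y] [MeasurableSpace Y] [BorelSpace Y] {T : X → X}
    (hT : Continuous T) {S : Y ≃ₜ Y} (hspec : AlmostWeakSpec S.toEquiv)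
    {ξ : ProbabilityMeasure (X × Y)} (hξ : Ergodic (Prod.map T S) (ξ : Measure (X × Y)))
    {h : ℝ≥0∞} (hent : (h : EReal) < topEntropy S)
    (hle : h ≤ ksEntropy ((ξ : Measure (X × Y)).map Prod.snd) S) {U : Set Y} (hU : IsOpen U)
    (hUne : U.Nonempty) :
    ξ ∈ closure {ζ : ProbabilityMeasure (X × Y) |
      0 < (ζ : Measure (X × Y)) (Prod.snd ⁻¹' U) ∧
      (ζ : Measure (X × Y)).map Prod.fst = (ξ : Measure (X × Y)).map Prod.fst ∧
      Ergodic (Prod.map T S) (ζ : Measure (X × Y)) ∧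
      h ≤ ksEntropy ((ζ : Measure (X × Y)).map Prod.snd) S} := by
  let _ : MetricSpace X := TopologicalSpace.metrizableSpaceMetric X
  have hδ : ∀ j : ℕ, (0 : ℝ) < 1 / ((j : ℝ) + 1) := fun j => Nat.one_div_pos_of_nat
  choose χ hχP hχfst hχerg hχd hχU hχent using fun j : ℕ =>
    exists_near_joining_charging hT hspec hξ hent hle hU hUne (hδ j)
  have hm : Measurable fun w : (X × Y) × Y => (w.1.1, w.2) := by fun_prop
  let ζ : ℕ → ProbabilityMeasure (X × Y) := fun j =>
    ⟨(χ j).map fun w => (w.1.1, w.2), Measure.isProbabilityMeasure_map hm.aemeasurable⟩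
  have hζ : ∀ j, (ζ j : Measure (X × Y)) = (χ j).map fun w => (w.1.1, w.2) := fun j => rfl
  refine mem_closure_of_tendsto (f := ζ) (b := atTop) (tendsto_of_coupling hχP hχfst hζ
    (fun j => (hδ j).le) tendsto_one_div_add_atTop_nhds_zero_nat hχd)
    (Eventually.of_forall fun j => ⟨?_, ?_, hχerg j, ?_⟩)
  · rw [hζ, Measure.map_apply hm ((hU.preimage continuous_snd).measurableSet)]
    exact hχU j
  · rw [← hχfst j, hζ, Measure.map_map measurable_fst hm,
      Measure.map_map measurable_fst measurable_fst]
    rfl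
  · rw [hζ, Measure.map_map measurable_snd hm]
    exact hχent j

end Residual

/-- **Full support of the `Y`-marginal is generic.** The set `M₀'` of joinings in `M₀` whose
`Y`-marginal is fully supported is the intersection of countably many relatively open dense
subsets of `M₀`. -/
theorem fullSupport_joinings_residual
    (k : ℕ) (Xs : Set (ℤ → Fin k)) (hne : Xs.Nonempty) (hcl : IsClosed Xs)
    (hsinv : fullShift '' Xs = Xs) (hnontriv : ¬ Xs.Finite)
    (σX : ↥Xs ≃ ↥Xs) (hσ : ∀ x : ↥Xs, (σX x : ℤ → Fin k) = fullShift (x : ℤ → Fin k))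
    (μ : Measure ↥Xs) [IsProbabilityMeasure μ] (herg : Ergodic (⇑σX) μ)
    {Y : Type*} [MetricSpace Y] [CompactSpace Y] [MeasurableSpace Y] [BorelSpace Y]
    (S : Y ≃ₜ Y) (hspec : AlmostWeakSpec S.toEquiv)
    (hent : (ksEntropy μ (⇑σX) : EReal) < topEntropy (⇑S)) :
    ∃ G : ℕ → Set (ProbabilityMeasure (↥Xs × Y)),
      (∀ n : ℕ, (∃ U, IsOpen U ∧ G n = U ∩ joiningM0 Xs σX μ S) ∧
        joiningM0 Xs σX μ S ⊆ closure (G n)) ∧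
      {ξ ∈ joiningM0 Xs σX μ S |
        FullSupport ((ξ : Measure (↥Xs × Y)).map Prod.snd)} = ⋂ n : ℕ, G n := by
  have hXc : CompactSpace Xs := isCompact_iff_compactSpace.1 hcl.isCompact
  have hshift : Continuous (fullShift : (ℤ → Fin k) → ℤ → Fin k) :=
    continuous_pi fun n => continuous_apply (n + 1)
  have hσc : Continuous σX := by
    refine continuous_induced_rng.2 ?_
    have e : Subtype.val ∘ ⇑σX = fun x : Xs => fullShift (x : ℤ → Fin k) := funext hσ
    rw [e]
    exact hshift.comp continuous_subtype_val
  obtain ⟨V, hVo, hVne, hV⟩ : ∃ V : ℕ → Set Y, (∀ n, IsOpen (V n)) ∧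
      (∀ n, Nonempty Y → (V n).Nonempty) ∧
      ∀ U : Set Y, IsOpen U → U.Nonempty → ∃ n, V n ⊆ U := by
    obtain ⟨b, hbc, hbe, hb⟩ := TopologicalSpace.exists_countable_basis Y
    obtain ⟨V, hV⟩ := (hbc.insert univ).exists_eq_range (insert_nonempty _ _)
    have hmem : ∀ n, V n ∈ insert univ b := fun n => hV ▸ mem_range_self n
    refine ⟨V, fun n => ?_, fun n hY => ?_, fun U hU ⟨y, hy⟩ => ?_⟩
    · rcases hmem n with h | h
      · exact h ▸ isOpen_univ
      · exact hb.isOpen h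
    · rcases hmem n with h | h
      · exact h ▸ univ_nonempty
      · exact nonempty_iff_ne_empty.2 fun h0 => hbe (h0 ▸ h)
    · obtain ⟨v, hv, -, hvU⟩ := hb.exists_subset_of_mem_open hy hU
      obtain ⟨n, rfl⟩ : v ∈ range V := hV ▸ mem_insert_of_mem _ hv
      exact ⟨n, hvU⟩
  have hpre : ∀ (ξ : ProbabilityMeasure (↥Xs × Y)) {U : Set Y}, IsOpen U →
      (ξ : Measure (↥Xs × Y)).map Prod.snd U = (ξ : Measure (↥Xs × Y)) (Prod.snd ⁻¹' U) :=
    fun ξ U hU => Measure.map_apply measurable_snd hU.measurableSet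
  refine ⟨fun n => {ξ : ProbabilityMeasure (↥Xs × Y) |
    0 < (ξ : Measure (↥Xs × Y)) (Prod.snd ⁻¹' V n)} ∩ joiningM0 Xs σX μ S,
    fun n => ⟨⟨_, isOpen_setOf_measure_pos ((hVo n).preimage continuous_snd), rfl⟩,
      fun ξ hξ => ?_⟩, ?_⟩
  · obtain ⟨hξμ, hξerg, hξent⟩ := hξ
    have hYne : Nonempty Y :=
      (nonempty_of_isProbabilityMeasure (ξ : Measure (↥Xs × Y))).map Prod.snd
    refine closure_mono ?_ (mem_closure_joinings_charging hσc hspec hξerg hent hξent (hVo n)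
      (hVne n hYne))
    rintro ζ ⟨h1, h2, h3, h4⟩
    exact ⟨h1, h2.trans hξμ, h3, h4⟩
  · ext ξ
    simp only [mem_iInter]
    constructor
    · rintro ⟨hξ, hfull⟩ n
      have hYne : Nonempty Y :=
        (nonempty_of_isProbabilityMeasure (ξ : Measure (↥Xs × Y))).map Prod.snd
      exact ⟨(hfull _ (hVo n) (hVne n hYne)).trans_eq (hpre ξ (hVo n)), hξ⟩
    · intro h
      refine ⟨(h 0).2, fun U hU hUne => ?_⟩
      obtain ⟨n, hn⟩ := hV U hU hUne
      rw [hpre ξ hU]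
      exact (h n).1.trans_le (measure_mono (preimage_mono hn))
end
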